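/- There exist real constants c_2(C_4) > 0 and c_3(C_4) such that #F_ℚ(C_4; X) = c_2(C_4) X^{1/2} + c_3(C_4) X^{1/3} + O(X^{1/4} (log X)^4) as X → ∞. -/

import Mathlib

open scoped Classical

/-- The absolute value of the discriminant of a finite intermediate field of
`AlgebraicClosure ℚ / ℚ` (junk value `0` if the field is not finite over `ℚ`). -/
noncomputable def absDisc (L : IntermediateField ℚ (AlgebraicClosure ℚ)) : ℕ :=
  if h : FiniteDimensional ℚ L then
    letI := h
    letI : NumberField L := ⟨⟩
    (NumberField.discr L).natAbs
  else 0

/-- `#F_ℚ(G; X)`: the number of field extensions `L/ℚ` inside a fixed algebraic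
closure of `ℚ` that are Galois over `ℚ` with `Gal(L/ℚ) ≅ G` and `|disc(L/ℚ)| ≤ X`. -/
noncomputable def galoisCount (G : Type) [Group G] (X : ℝ) : ℕ :=
  Nat.card {L : IntermediateField ℚ (AlgebraicClosure ℚ) //
    FiniteDimensional ℚ L ∧ IsGalois ℚ L ∧ Nonempty ((L ≃ₐ[ℚ] L) ≃* G) ∧
      (absDisc L : ℝ) ≤ X}

namespace C4Count

section LocalGenerators

variable {R S : Type*} [CommRing R] [CommRing S] [Algebra R S]

lemma mem_adjoin_quadratic_iff {b c : R} {y : S}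
    (hy : y ^ 2 + algebraMap R S b * y + algebraMap R S c = 0) (z : S) :
    z ∈ Algebra.adjoin R {y} ↔ ∃ u v : R, z = algebraMap R S u + algebraMap R S v * y := by
  constructor
  · intro hz
    induction hz using Algebra.adjoin_induction with
    | mem x hx =>
      rw [Set.mem_singleton_iff] at hx
      exact ⟨0, 1, by simp [hx]⟩
    | algebraMap r => exact ⟨r, 0, by simp⟩
    | add x z _ _ hx hz =>
      obtain ⟨u, v, rfl⟩ := hx
      obtain ⟨u', v', rfl⟩ := hz
      exact ⟨u + u', v + v', by simp only [map_add]; ring⟩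
    | mul x z _ _ hx hz =>
      obtain ⟨u, v, rfl⟩ := hx
      obtain ⟨u', v', rfl⟩ := hz
      refine ⟨u * u' - v * v' * c, u * v' + v * u' - v * v' * b, ?_⟩
      simp only [map_add, map_sub, map_mul]
      linear_combination (algebraMap R S v * algebraMap R S v') * hy
  · rintro ⟨u, v, rfl⟩
    exact add_mem (Subalgebra.algebraMap_mem _ _)
      (mul_mem (Subalgebra.algebraMap_mem _ _) (Algebra.self_mem_adjoin_singleton R y))

lemma exists_notMem_mul_mem_span [IsDedekindDomain R] {P : Ideal R} {c : R}
    (hc : c ∈ P) (hc2 : c ∉ P ^ 2) : ∃ r ∉ P, ∀ x ∈ P, ∃ x', r * x = c * x' := by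
  obtain ⟨J, hJ⟩ := Ideal.dvd_iff_le.mpr ((Ideal.span_singleton_le_iff_mem P).mpr hc)
  have hJP : ¬ J ≤ P := by
    intro h
    apply hc2
    have : c ∈ P * J := hJ ▸ Ideal.mem_span_singleton_self c
    rw [pow_two]
    exact Ideal.mul_mono_right h this
  obtain ⟨r, hrJ, hrP⟩ := SetLike.not_le_iff_exists.mp hJP
  refine ⟨r, hrP, fun x hx => ?_⟩
  have : r * x ∈ Ideal.span {c} := by
    rw [hJ, mul_comm r x]
    exact Ideal.mul_mem_mul hx hrJ
  obtain ⟨x', hx'⟩ := Ideal.mem_span_singleton'.mp this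
  exact ⟨x', by rw [← hx']; ring⟩

/-- A quadratic Eisenstein generator generates the ring locally. -/
lemma exists_notMem_mul_mem_adjoin [IsDedekindDomain R] [IsDomain S]
    (hinj : Function.Injective (algebraMap R S))
    {P : Ideal R} [P.IsPrime] {Q : Ideal S} [Q.IsPrime] (hQ : Q.comap (algebraMap R S) = P)
    {b c : R} {y : S} (hy : y ^ 2 + algebraMap R S b * y + algebraMap R S c = 0)
    (hb : b ∈ P) (hc : c ∈ P) (hc2 : c ∉ P ^ 2) {d : R} (hd : d ≠ 0)
    (hdS : ∀ z : S, algebraMap R S d * z ∈ Algebra.adjoin R {y}) :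
    ∃ r ∉ P, ∀ z : S, algebraMap R S r * z ∈ Algebra.adjoin R {y} := by
  obtain ⟨r, hrP, hr⟩ := exists_notMem_mul_mem_span hc hc2
  have memQ : ∀ x : R, x ∈ P ↔ algebraMap R S x ∈ Q := fun x => by rw [← hQ, Ideal.mem_comap]
  have hyQ : y ∈ Q := by
    have : y ^ 2 ∈ Q := by
      have h : y ^ 2 = -(algebraMap R S b * y + algebraMap R S c) := by linear_combination hy
      rw [h]
      exact neg_mem (add_mem (Q.mul_mem_right _ ((memQ b).1 hb)) ((memQ c).1 hc))
    exact Ideal.IsPrime.mem_of_pow_mem ‹_› _ this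
  have hc0 : algebraMap R S c ≠ 0 := by
    intro h
    apply hc2
    rw [(map_eq_zero_iff _ hinj).1 h]
    exact zero_mem _
  have key : ∀ z : S, algebraMap R S c * z ∈ Algebra.adjoin R {y} →
      algebraMap R S (r ^ 2) * z ∈ Algebra.adjoin R {y} := by
    intro z hz
    obtain ⟨u, v, huv⟩ := (mem_adjoin_quadratic_iff hy _).1 hz
    have huP : u ∈ P := by
      rw [memQ]
      have : algebraMap R S u = algebraMap R S c * z - algebraMap R S v * y := by
        rw [huv]; ring
      rw [this]
      exact sub_mem (Q.mul_mem_right _ ((memQ c).1 hc)) (Q.mul_mem_left _ hyQ)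
    obtain ⟨u1, hu1⟩ := hr u huP
    obtain ⟨b1, hb1⟩ := hr b hb
    have hu1' := congrArg (algebraMap R S) hu1
    have hb1' := congrArg (algebraMap R S) hb1
    simp only [map_mul] at hu1' hb1'
    have e1 : algebraMap R S r * (algebraMap R S r * z * y - algebraMap R S u1 * y
        + algebraMap R S r * algebraMap R S v * 1) + algebraMap R S r * algebraMap R S v *
        algebraMap R S b1 * y = 0 := by
      apply mul_left_cancel₀ hc0
      linear_combination (algebraMap R S r) ^ 2 * y * huv + (algebraMap R S r) * y * hu1' -
        (algebraMap R S r) * (algebraMap R S v) * y * hb1' +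
        (algebraMap R S r)^2 * algebraMap R S v * hy
    have hv : r * r * v ∈ P := by
      rw [memQ]
      have : algebraMap R S (r * r * v) = y * -(algebraMap R S r * (algebraMap R S r * z
          - algebraMap R S u1) + algebraMap R S r * algebraMap R S v * algebraMap R S b1) := by
        simp only [map_mul]
        linear_combination e1
      rw [this]
      exact Q.mul_mem_right _ hyQ
    have hvP : v ∈ P := by
      rcases Ideal.IsPrime.mem_or_mem ‹_› hv with h | h
      · rcases Ideal.IsPrime.mem_or_mem ‹_› h with h | h <;> exact absurd h hrP
      · exact h
    obtain ⟨v1, hv1⟩ := hr v hvP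
    have hv1' := congrArg (algebraMap R S) hv1
    simp only [map_mul] at hv1'
    rw [mem_adjoin_quadratic_iff hy]
    refine ⟨r * u1, r * v1, ?_⟩
    apply mul_left_cancel₀ hc0
    simp only [map_mul, map_pow]
    linear_combination (algebraMap R S r) ^ 2 * huv + (algebraMap R S r) * hu1' +
        (algebraMap R S r) * y * hv1'
  have hP0 : P ≠ ⊥ := by
    rintro rfl
    apply hc2
    rw [(Submodule.mem_bot R).1 hc]
    exact zero_mem _
  have hP1 : ¬ IsUnit P := fun h => ‹P.IsPrime›.ne_top (Ideal.isUnit_iff.1 h)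
  have hfin : FiniteMultiplicity P (Ideal.span {d}) :=
    FiniteMultiplicity.of_not_isUnit hP1 (by simpa using hd)
  obtain ⟨J, hJ, hJP⟩ := hfin.exists_eq_pow_mul_and_not_dvd
  set n := multiplicity P (Ideal.span {d})
  obtain ⟨j, hjJ, hjP⟩ := SetLike.not_le_iff_exists.mp (fun h => hJP (Ideal.dvd_iff_le.mpr h))
  have hjc : ∃ x, c ^ n * j = x * d := by
    have : c ^ n * j ∈ Ideal.span {d} := by
      rw [hJ]
      exact Ideal.mul_mem_mul (Ideal.pow_mem_pow hc n) hjJ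
    obtain ⟨x, hx⟩ := Ideal.mem_span_singleton'.mp this
    exact ⟨x, hx.symm⟩
  obtain ⟨x, hx⟩ := hjc
  have key2 : ∀ k : ℕ, ∀ z : S, algebraMap R S (c ^ k) * z ∈ Algebra.adjoin R {y} →
      algebraMap R S ((r ^ 2) ^ k) * z ∈ Algebra.adjoin R {y} := by
    intro k
    induction k with
    | zero => intro z hz; simpa using hz
    | succ k ih =>
      intro z hz
      rw [pow_succ, map_mul, mul_assoc] at hz ⊢
      have := key _ (by
        have h := ih _ hz
        rwa [mul_left_comm] at h)
      rwa [mul_left_comm] at this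
  refine ⟨(r ^ 2) ^ n * j, ?_, fun z => ?_⟩
  · intro h
    rcases Ideal.IsPrime.mem_or_mem ‹_› h with h | h
    · exact hrP (Ideal.IsPrime.mem_of_pow_mem ‹_› _ (Ideal.IsPrime.mem_of_pow_mem ‹_› _ h))
    · exact hjP h
  · rw [map_mul, mul_assoc]
    apply key2
    rw [← mul_assoc, ← map_mul, hx, map_mul, mul_assoc]
    exact Subalgebra.mul_mem _ (Subalgebra.algebraMap_mem _ _) (hdS z)

lemma ideal_le_of_forall_maximal {I J : Ideal S}
    (h : ∀ Q : Ideal S, Q.IsMaximal → ∃ r ∉ Q, ∀ x ∈ I, r * x ∈ J) : I ≤ J := by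
  intro x hx
  by_contra hxJ
  have hne : J.colon {x} ≠ ⊤ := by
    intro htop
    apply hxJ
    have : (1 : S) ∈ J.colon {x} := htop ▸ Submodule.mem_top
    simpa [Submodule.mem_colon_singleton] using this
  obtain ⟨Q, hQ, hle⟩ := Ideal.exists_le_maximal _ hne
  obtain ⟨r, hrQ, hr⟩ := h Q hQ
  exact hrQ (hle (by simpa [Submodule.mem_colon_singleton] using hr x hx))

end LocalGenerators

section Different

open Polynomial

variable {R S : Type*} (K L : Type*) [CommRing R] [CommRing S] [Algebra R S]
  [Field K] [Field L] [Algebra R K] [IsFractionRing R K] [Algebra S L]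
  [Algebra K L] [Algebra R L] [IsScalarTower R K L] [IsScalarTower R S L]
  [IsDedekindDomain R] [IsDedekindDomain S] [IsIntegralClosure S R L]
  [Module.IsTorsionFree R S] [FiniteDimensional K L] [CharZero K]


lemma conductor_mul_differentIdeal_quadratic (hdeg : Module.finrank K L = 2)
    {b c : R} {y : S} (hy : y ^ 2 + algebraMap R S b * y + algebraMap R S c = 0)
    (hyK : algebraMap S L y ∉ Set.range (algebraMap K L)) :
    conductor R y * differentIdeal R S = Ideal.span {2 * y + algebraMap R S b} := by
  have hyint : IsIntegral R y := IsIntegralClosure.isIntegral R L y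
  have hyK' : algebraMap S L y ∉ (⊥ : IntermediateField K L) := by
    rwa [IntermediateField.mem_bot]
  have htop : IntermediateField.adjoin K {algebraMap S L y} = ⊤ := by
    have := IntermediateField.isSimpleOrder_of_finrank_prime K L (hdeg ▸ Nat.prime_two)
    rcases eq_bot_or_eq_top (IntermediateField.adjoin K {algebraMap S L y}) with h | h
    · exact absurd (h ▸ IntermediateField.mem_adjoin_simple_self K _) hyK'
    · exact h
  have htop' : Algebra.adjoin K {algebraMap S L y} = ⊤ := by
    rw [← IntermediateField.adjoin_simple_toSubalgebra_of_isAlgebraic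
      (Algebra.IsAlgebraic.isAlgebraic _), htop, IntermediateField.top_toSubalgebra]
  rw [conductor_mul_differentIdeal R K L y htop']
  have hmin : minpoly R y = X ^ 2 + C b * X + C c := by
    have hmonic : (X ^ 2 + C b * X + C c : R[X]).Monic := by monicity!
    have hdvd : minpoly R y ∣ X ^ 2 + C b * X + C c := by
      apply minpoly.isIntegrallyClosed_dvd hyint
      simpa using hy
    refine (Polynomial.eq_of_monic_of_dvd_of_natDegree_le (minpoly.monic hyint) hmonic hdvd ?_).symm
    have h2 : 2 ≤ (minpoly R y).natDegree := by
      rw [minpoly.two_le_natDegree_iff hyint]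
      rintro ⟨r, rfl⟩
      apply hyK
      exact ⟨algebraMap R K r, by
        rw [← IsScalarTower.algebraMap_apply, ← IsScalarTower.algebraMap_apply]⟩
    refine le_trans ?_ h2
    compute_degree
  rw [hmin]
  simp [one_add_one_eq_two, map_ofNat]

/-- The square of the different of a quadratic extension, computed from local generators. -/
theorem differentIdeal_sq_eq (hdeg : Module.finrank K L = 2) (x : S)
    (h : ∀ Q : Ideal S, Q.IsMaximal → ∃ (b c : R) (y u u' : S),
      y ^ 2 + algebraMap R S b * y + algebraMap R S c = 0 ∧
      algebraMap S L y ∉ Set.range (algebraMap K L) ∧ u ∉ Q ∧ u' ∉ Q ∧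
      u * algebraMap R S (b ^ 2 - 4 * c) = u' * x ∧
      (algebraMap R S (b ^ 2 - 4 * c) ∉ Q ∨
        (algebraMap R S b ∈ Q ∧ algebraMap R S c ∈ Q ∧
          c ∉ (Q.comap (algebraMap R S)) ^ 2))) :
    differentIdeal R S ^ 2 = Ideal.span {x} := by
  have hinj : Function.Injective (algebraMap R S) := FaithfulSMul.algebraMap_injective R S
  have main : ∀ Q : Ideal S, Q.IsMaximal → ∃ (y' : S) (I : Ideal S) (u u' : S),
      u ∉ Q ∧ u' ∉ Q ∧ u * y' ^ 2 = u' * x ∧ I * differentIdeal R S = Ideal.span {y'} ∧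
      ∃ r ∈ I, r ∉ Q := by
    intro Q hQ
    obtain ⟨b, c, y, u, u', hy, hyK, hu, hu', hux, hor⟩ := h Q hQ
    have hsq : (2 * y + algebraMap R S b) ^ 2 = algebraMap R S (b ^ 2 - 4 * c) := by
      simp only [map_sub, map_mul, map_pow, map_ofNat]
      linear_combination 4 * hy
    have hcond := conductor_mul_differentIdeal_quadratic K L hdeg hy hyK
    refine ⟨2 * y + algebraMap R S b, conductor R y, u, u', hu, hu', by rw [hsq, hux], hcond, ?_⟩
    have hmem : 2 * y + algebraMap R S b ∈ conductor R y := by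
      have : 2 * y + algebraMap R S b ∈ conductor R y * differentIdeal R S :=
        hcond.symm ▸ Ideal.mem_span_singleton_self _
      exact (Ideal.mul_le_left : conductor R y * differentIdeal R S ≤ conductor R y) this
    rcases hor with h1 | ⟨hb, hc, hc2⟩
    · exact ⟨_, hmem, fun hm => h1 (by rw [← hsq]; exact Ideal.pow_mem_of_mem Q hm 2 (by norm_num))⟩
    · have hd0 : b ^ 2 - 4 * c ≠ 0 := by
        intro h0
        rw [h0, map_zero, pow_eq_zero_iff two_ne_zero] at hsq
        apply hyK
        have : CharZero L := charZero_of_injective_algebraMap (algebraMap K L).injective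
        have h2 : (2 : L) * algebraMap S L y + algebraMap R L b = 0 := by
          have h3 := congrArg (algebraMap S L) hsq
          rw [map_add, map_mul, map_zero, ← IsScalarTower.algebraMap_apply, map_ofNat] at h3
          exact h3
        refine ⟨-(algebraMap R K b) / 2, ?_⟩
        simp only [map_div₀, map_neg, map_ofNat, ← IsScalarTower.algebraMap_apply]
        field_simp
        linear_combination -h2
      have hQp := hQ.isPrime
      have : (Q.comap (algebraMap R S)).IsPrime := Ideal.comap_isPrime _ _
      obtain ⟨r, hr, hrS⟩ := exists_notMem_mul_mem_adjoin hinj (Q := Q) rfl hy hb hc hc2 hd0 (by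
        intro z
        have : algebraMap R S (b ^ 2 - 4 * c) ∈ conductor R y := by
          rw [← hsq]
          exact Ideal.pow_mem_of_mem (conductor R y) hmem 2 (by norm_num)
        exact this z)
      exact ⟨algebraMap R S r, hrS, hr⟩
  apply le_antisymm
  · apply ideal_le_of_forall_maximal
    intro Q hQ
    have hQp := hQ.isPrime
    obtain ⟨y', I, u, u', hu, hu', hux, hI, r, hrI, hrQ⟩ := main Q hQ
    refine ⟨u * r ^ 2, ?_, fun z hz => ?_⟩
    · intro hmem
      rcases hQp.mem_or_mem hmem with h | h
      · exact hu h
      · exact hrQ (hQp.mem_of_pow_mem _ h)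
    · have : r ^ 2 * z ∈ (Ideal.span {y' ^ 2} : Ideal S) := by
        rw [← Ideal.span_singleton_pow, ← hI, mul_pow]
        exact Ideal.mul_mem_mul (Ideal.pow_mem_pow hrI 2) hz
      obtain ⟨a, ha⟩ := Ideal.mem_span_singleton'.mp this
      rw [mul_assoc, ← ha]
      refine Ideal.mem_span_singleton'.mpr ⟨a * u', ?_⟩
      linear_combination -a * hux
  · apply ideal_le_of_forall_maximal
    intro Q hQ
    obtain ⟨y', I, u, u', hu, hu', hux, hI, r, hrI, hrQ⟩ := main Q hQ
    refine ⟨u', hu', fun z hz => ?_⟩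
    obtain ⟨a, rfl⟩ := Ideal.mem_span_singleton'.mp hz
    have h1 : y' ^ 2 ∈ differentIdeal R S ^ 2 := by
      apply Ideal.pow_mem_pow
      have : y' ∈ I * differentIdeal R S :=
        hI.symm ▸ Ideal.mem_span_singleton_self _
      exact (Ideal.mul_le_right : I * differentIdeal R S ≤ differentIdeal R S) this
    have : u' * (a * x) = (a * u) * y' ^ 2 := by linear_combination -a * hux
    rw [this]
    exact Ideal.mul_mem_left _ _ h1

end Different

end C4Count

namespace C4Count

open NumberField

lemma squarefree_notMem_ideal_sq {n : ℤ} (hn : Squarefree n) {I : Ideal ℤ} (hI : I ≠ ⊤) :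
    n ∉ I ^ 2 := by
  obtain ⟨a, rfl⟩ := IsPrincipalIdealRing.principal I
  intro h
  change n ∈ (Ideal.span {a}) ^ 2 at h
  rw [Ideal.span_singleton_pow, Ideal.mem_span_singleton, pow_two] at h
  exact hI (Ideal.span_singleton_eq_top.mpr (hn a h))

section QuadraticField

variable {K : Type*} [Field K] [NumberField K]

lemma exists_prime_factor {n : ℤ} (hn : Squarefree n) {P : Ideal (𝓞 K)} [hP : P.IsPrime]
    (h : (n : 𝓞 K) ∈ P) : ∃ (p : ℕ) (m : ℤ), p.Prime ∧ n = p * m ∧ (p : 𝓞 K) ∈ P ∧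
      (m : 𝓞 K) ∉ P := by
  have hP0 : P ≠ ⊥ := by
    rintro rfl
    exact hn.ne_zero (by exact_mod_cast (Ideal.mem_bot.mp h))
  have hc : (P.comap (algebraMap ℤ (𝓞 K))).IsPrime := Ideal.comap_isPrime _ _
  obtain ⟨a, ha⟩ := IsPrincipalIdealRing.principal (P.comap (algebraMap ℤ (𝓞 K)))
  change _ = Ideal.span {a} at ha
  have mem : ∀ k : ℤ, (k : 𝓞 K) ∈ P ↔ a ∣ k := by
    intro k
    rw [← Ideal.mem_span_singleton, ← ha, Ideal.mem_comap, eq_intCast]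
  have ha0 : a ≠ 0 := by
    rintro rfl
    exact hn.ne_zero (zero_dvd_iff.mp ((mem n).mp h))
  rw [ha, Ideal.span_singleton_prime ha0] at hc
  obtain ⟨m, hm⟩ := (mem n).mp h
  have key : ∃ m' : ℤ, n = a.natAbs * m' ∧ (m' : 𝓞 K) ∉ P := by
    have hndvd : ¬ a ∣ m := by
      rintro ⟨k, rfl⟩
      exact hc.not_isUnit (hn a ⟨k, by rw [hm]; ring⟩)
    rcases Int.natAbs_eq a with h1 | h1
    · exact ⟨m, by rw [← h1, hm], fun hmem => hndvd ((mem m).mp hmem)⟩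
    · refine ⟨-m, by rw [hm]; nth_rewrite 1 [h1]; ring, fun hmem => hndvd ?_⟩
      simpa using (mem (-m)).mp hmem
  obtain ⟨m', hm', hmP⟩ := key
  refine ⟨a.natAbs, m', Int.prime_iff_natAbs_prime.mp hc, hm', ?_, hmP⟩
  have := (mem (a.natAbs : ℤ)).mpr (by simp)
  simpa using this

lemma intCast_notMem_sq_of_notMem {P : Ideal (𝓞 K)} [hP : P.IsMaximal] {d : 𝓞 K}
    (hd : differentIdeal ℤ (𝓞 K) ^ 2 = Ideal.span {d}) (hdP : d ∉ P) {n : ℤ}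
    (hn : Squarefree n) : (n : 𝓞 K) ∉ P ^ 2 := by
  intro h
  obtain ⟨p, m, hp, rfl, hpP, hmP⟩ := exists_prime_factor hn (P := P)
    (Ideal.pow_le_self two_ne_zero h)
  have hp2 : (p : 𝓞 K) ∈ P ^ 2 := by
    have h' : (m : 𝓞 K) * (p : 𝓞 K) ∈ P ^ 2 := by
      convert h using 1; push_cast; ring
    exact (Ideal.IsMaximal.mul_mem_pow P h').resolve_left hmP
  have hmax : (Ideal.span {(p : ℤ)}).IsMaximal :=
    PrincipalIdealRing.isMaximal_of_irreducible (Nat.prime_iff_prime_int.mp hp).irreducible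
  have hdvd := pow_sub_one_dvd_differentIdeal_aux ℤ ℚ K (B := 𝓞 K) (p := Ideal.span {(p : ℤ)})
    P (e := 2) two_ne_zero (by simpa using hp.ne_zero) (by
      rw [Ideal.map_span, Set.image_singleton]
      rw [Ideal.dvd_span_singleton]
      simpa using hp2)
  rw [pow_one, Ideal.dvd_iff_le] at hdvd
  apply hdP
  have : d ∈ differentIdeal ℤ (𝓞 K) ^ 2 := hd ▸ Ideal.mem_span_singleton_self d
  exact hdvd (Ideal.pow_le_self two_ne_zero this)

lemma notMem_sq_of_sq_eq {s : 𝓞 K} {D : ℤ} (hs : s ^ 2 = D) (hD : Squarefree D)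
    (hdeg : Module.finrank ℚ K = 2) {P : Ideal (𝓞 K)} [hP : P.IsMaximal] : s ∉ P ^ 2 := by
  intro h
  have h4 : (D : 𝓞 K) ∈ P ^ 4 := by
    rw [← hs, show 4 = 2 * 2 by norm_num, pow_mul]
    exact Ideal.pow_mem_pow h 2
  obtain ⟨p, m, hp, rfl, hpP, hmP⟩ := exists_prime_factor hD (P := P)
    (Ideal.pow_le_self (by norm_num) h4)
  have hp4 : (p : 𝓞 K) ∈ P ^ 4 := by
    have h' : (m : 𝓞 K) * (p : 𝓞 K) ∈ P ^ 4 := by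
      convert h4 using 1; push_cast; ring
    exact (Ideal.IsMaximal.mul_mem_pow P h').resolve_left hmP
  have hN : Ideal.absNorm P ^ 4 ∣ p ^ 2 := by
    rw [← map_pow]
    have := Ideal.absNorm_dvd_absNorm_of_le ((Ideal.span_singleton_le_iff_mem _).mpr hp4)
    rw [Ideal.absNorm_span_natCast, RingOfIntegers.rank, hdeg] at this
    exact this
  have hpN : p ∣ Ideal.absNorm P := by
    obtain ⟨k, hk, hk'⟩ := (Nat.dvd_prime_pow hp).mp ((dvd_pow_self _ four_ne_zero).trans hN)
    rw [hk']
    apply dvd_pow_self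
    rintro rfl
    rw [pow_zero, Ideal.absNorm_eq_one_iff] at hk'
    exact hP.ne_top hk'
  have := (Nat.pow_dvd_pow_iff_le_right hp.one_lt).mp ((pow_dvd_pow_of_dvd hpN 4).trans hN)
  omega

lemma differentIdeal_quadratic {s : 𝓞 K} {D e : ℤ} (hs : s ^ 2 = D) (hD : Squarefree D)
    (hdeg : Module.finrank ℚ K = 2) (hsK : (s : K) ∉ Set.range (algebraMap ℚ K))
    (he : (D % 4 = 1 ∧ e = 1) ∨ (D % 2 = 0 ∧ e = 4)) :
    differentIdeal ℤ (𝓞 K) ^ 2 = Ideal.span {((e * D : ℤ) : 𝓞 K)} := by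
  apply differentIdeal_sq_eq ℚ K hdeg
  intro Q hQ
  have hQp := hQ.isPrime
  have hs' : s ^ 2 + algebraMap ℤ (𝓞 K) 0 * s + algebraMap ℤ (𝓞 K) (-D) = 0 := by
    simp [hs]
  have hQ1 : (1 : 𝓞 K) ∉ Q := fun h => hQ.ne_top ((Ideal.eq_top_iff_one _).mpr h)
  have sqf : -D ∉ Q.comap (algebraMap ℤ (𝓞 K)) ^ 2 := by
    rw [neg_mem_iff]
    exact squarefree_notMem_ideal_sq hD (Ideal.comap_ne_top _ hQ.ne_top)
  rcases he with ⟨hD4, rfl⟩ | ⟨hD2, rfl⟩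
  · by_cases h2 : (2 : 𝓞 K) ∈ Q
    · obtain ⟨k, hk⟩ : ∃ k, D = 1 + 4 * k := ⟨D / 4, by omega⟩
      have hy : IsIntegral ℤ ((1 + (s : K)) / 2) := by
        refine ⟨Polynomial.X ^ 2 - Polynomial.X - Polynomial.C k, by monicity!, ?_⟩
        have : (s : K) ^ 2 = 1 + 4 * k := by
          have := congrArg (algebraMap (𝓞 K) K) hs
          rw [hk] at this
          simpa [map_ofNat (algebraMap (𝓞 K) K) 4] using this
        simp only [Polynomial.eval₂_sub, Polynomial.eval₂_X_pow, Polynomial.eval₂_X,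
          Polynomial.eval₂_C]
        rw [eq_intCast]
        linear_combination this / 4
      obtain ⟨y, hy⟩ : ∃ y : 𝓞 K, (y : K) = (1 + (s : K)) / 2 := ⟨⟨_, hy⟩, rfl⟩
      have hys : s = 2 * y - 1 := by
        apply RingOfIntegers.ext
        change (s : K) = algebraMap (𝓞 K) K (2 * y - 1)
        rw [map_sub, map_mul, map_ofNat (algebraMap (𝓞 K) K) 2, map_one]
        linear_combination -2 * hy
      have hyeq : y ^ 2 - y - k = 0 := by
        have h4 : (4 : 𝓞 K) * (y ^ 2 - y - k) = 0 := by
          rw [hys, hk] at hs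
          push_cast at hs
          linear_combination hs
        exact (mul_eq_zero.mp h4).resolve_left (by norm_num)
      have hDQ : (D : 𝓞 K) ∉ Q := by
        intro h
        apply hQ1
        rw [hk] at h
        have : (1 : 𝓞 K) = ((1 + 4 * k : ℤ) : 𝓞 K) - 2 * (2 * k) := by push_cast; ring
        rw [this]
        exact sub_mem h (Ideal.mul_mem_right _ _ h2)
      refine ⟨-1, -k, y, 1, 1, ?_, ?_, hQ1, hQ1, ?_, Or.inl ?_⟩
      · simp only [map_neg, map_one, eq_intCast]
        linear_combination hyeq
      · rintro ⟨r, hr⟩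
        apply hsK
        refine ⟨2 * r - 1, ?_⟩
        rw [map_sub, map_mul, hr, map_ofNat, map_one]
        change 2 * (y : K) - 1 = s
        rw [hy]; ring
      · simp [hk]
      · rw [eq_intCast]
        convert hDQ using 2
        rw [hk]; push_cast; ring
    · have h4 : (4 : 𝓞 K) ∉ Q := by
        intro h
        have : (2 : 𝓞 K) * 2 ∈ Q := by norm_num; exact h
        rcases hQp.mem_or_mem this with h | h <;> exact h2 h
      refine ⟨0, -D, s, 1, 4, hs', hsK, hQ1, h4, by simp, ?_⟩
      by_cases hDQ : (D : 𝓞 K) ∈ Q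
      · exact Or.inr ⟨by simp, by simpa using hDQ, sqf⟩
      · left
        intro h
        simp only [eq_intCast] at h
        push_cast at h
        have : (4 : 𝓞 K) * D ∈ Q := by convert h using 1; ring
        rcases hQp.mem_or_mem this with h | h
        · exact h4 h
        · exact hDQ h
  · refine ⟨0, -D, s, 1, 1, hs', hsK, hQ1, hQ1, by simp, ?_⟩
    by_cases hDQ : (D : 𝓞 K) ∈ Q
    · exact Or.inr ⟨by simp, by simpa using hDQ, sqf⟩
    · left
      intro h
      apply hDQ
      simp only [eq_intCast] at h
      push_cast at h
      have : (2 : 𝓞 K) * (2 * D) ∈ Q := by convert h using 1; ring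
      have h2D : (2 : 𝓞 K) ∈ Q → (D : 𝓞 K) ∈ Q := by
        intro h2
        obtain ⟨k, hk⟩ : ∃ k, D = 2 * k := ⟨D / 2, by omega⟩
        rw [hk]; push_cast
        exact Ideal.mul_mem_right _ _ h2
      rcases hQp.mem_or_mem this with h | h
      · exact h2D h
      · rcases hQp.mem_or_mem h with h | h
        · exact h2D h
        · exact h

lemma natAbs_discr_quadratic {s : 𝓞 K} {D e : ℤ} (hs : s ^ 2 = D) (hD : Squarefree D)
    (hdeg : Module.finrank ℚ K = 2) (hsK : (s : K) ∉ Set.range (algebraMap ℚ K))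
    (he : (D % 4 = 1 ∧ e = 1) ∨ (D % 2 = 0 ∧ e = 4)) :
    (discr K).natAbs = (e * D).natAbs := by
  rw [← absNorm_differentIdeal (K := K) (𝒪 := 𝓞 K)]
  have h := congrArg Ideal.absNorm (differentIdeal_quadratic hs hD hdeg hsK he)
  rw [map_pow, Ideal.absNorm_span_singleton, ← eq_intCast (algebraMap ℤ (𝓞 K)),
    Algebra.norm_algebraMap, RingOfIntegers.rank, hdeg, Int.natAbs_pow] at h
  exact Nat.pow_left_injective two_ne_zero h

end QuadraticField

lemma isCoprime_of_squarefree_sum_sq {D B C : ℤ} (hD : Squarefree D) (h : D = B ^ 2 + C ^ 2) :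
    IsCoprime B C := by
  apply IsRelPrime.isCoprime
  intro d hB hC
  apply hD d
  rw [h, ← pow_two]
  exact dvd_add (pow_dvd_pow_of_dvd hB 2) (pow_dvd_pow_of_dvd hC 2)

section

variable {K L : Type*} [Field K] [NumberField K] [Field L] [NumberField L] [Algebra K L]

omit [NumberField K] [NumberField L] in
lemma exists_local_of_pure {τ : 𝓞 K} {w : 𝓞 L} (hw : w ^ 2 = algebraMap (𝓞 K) (𝓞 L) τ)
    (hwK : (w : L) ∉ Set.range (algebraMap K L)) {Q : Ideal (𝓞 L)} {x : 𝓞 K}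
    (β : 𝓞 K) (κ : K) (hβ : κ ^ 2 * (τ : K) = β) (hβ0 : β ≠ 0) (u u' : 𝓞 K)
    (hu : u ∉ Q.comap (algebraMap (𝓞 K) (𝓞 L))) (hu' : u' ∉ Q.comap (algebraMap (𝓞 K) (𝓞 L)))
    (hux : u * (4 * β) = u' * x)
    (hor : 4 * β ∉ Q.comap (algebraMap (𝓞 K) (𝓞 L)) ∨
      (β ∈ Q.comap (algebraMap (𝓞 K) (𝓞 L)) ∧ β ∉ Q.comap (algebraMap (𝓞 K) (𝓞 L)) ^ 2)) :
    ∃ (b c : 𝓞 K) (y u u' : 𝓞 L),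
      y ^ 2 + algebraMap (𝓞 K) (𝓞 L) b * y + algebraMap (𝓞 K) (𝓞 L) c = 0 ∧
      algebraMap (𝓞 L) L y ∉ Set.range (algebraMap K L) ∧ u ∉ Q ∧ u' ∉ Q ∧
      u * algebraMap (𝓞 K) (𝓞 L) (b ^ 2 - 4 * c) = u' * algebraMap (𝓞 K) (𝓞 L) x ∧
      (algebraMap (𝓞 K) (𝓞 L) (b ^ 2 - 4 * c) ∉ Q ∨
        (algebraMap (𝓞 K) (𝓞 L) b ∈ Q ∧ algebraMap (𝓞 K) (𝓞 L) c ∈ Q ∧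
          c ∉ (Q.comap (algebraMap (𝓞 K) (𝓞 L))) ^ 2)) := by
  have hκ : κ ≠ 0 := by
    rintro rfl
    apply hβ0
    apply RingOfIntegers.ext
    rw [← hβ]; simp
  have hw' : (w : L) ^ 2 = algebraMap K L (τ : K) := congrArg (algebraMap (𝓞 L) L) hw
  have hz : (algebraMap K L κ * w) ^ 2 = algebraMap (𝓞 L) L (algebraMap (𝓞 K) (𝓞 L) β) := by
    rw [mul_pow, hw', ← map_pow, ← map_mul, hβ]
    rfl
  have hyint : IsIntegral ℤ (algebraMap K L κ * w) := by
    apply IsIntegral.of_pow (n := 2) two_pos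
    rw [hz]
    exact RingOfIntegers.isIntegral_coe _
  obtain ⟨y, hy⟩ : ∃ y : 𝓞 L, algebraMap (𝓞 L) L y = algebraMap K L κ * w :=
    ⟨⟨_, hyint⟩, rfl⟩
  have hy2 : y ^ 2 = algebraMap (𝓞 K) (𝓞 L) β := by
    apply RingOfIntegers.ext
    change algebraMap (𝓞 L) L (y ^ 2) = _
    rw [map_pow, hy, hz]
  have hδ : (0 : 𝓞 K) ^ 2 - 4 * (-β) = 4 * β := by ring
  refine ⟨0, -β, y, algebraMap _ _ u, algebraMap _ _ u', ?_, ?_, hu, hu', ?_, ?_⟩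
  · simp [hy2]
  · rintro ⟨r, hr⟩
    apply hwK
    refine ⟨r / κ, ?_⟩
    rw [map_div₀, hr, hy, mul_comm, mul_div_assoc, div_self (by simpa using hκ), mul_one]
  · rw [hδ, ← map_mul, ← map_mul, hux]
  · rw [hδ]
    refine hor.imp id fun h => ⟨by simp, ?_, ?_⟩
    · rw [map_neg, neg_mem_iff]
      exact h.1
    · rw [neg_mem_iff]
      exact h.2

/-- The square of the relative different of `K(√(t (D + B √D)))` over `K = ℚ(√D)`. -/
theorem differentIdeal_relative_sq {s : 𝓞 K} {w : 𝓞 L} {D B C g h ε v t₂ c : ℤ}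
    (hs : s ^ 2 = D) (hD : Squarefree D) (hdegK : Module.finrank ℚ K = 2)
    (hsK : (s : K) ∉ Set.range (algebraMap ℚ K)) (hBC : D = B ^ 2 + C ^ 2) (hgh : D = g * h)
    (hε : ε ^ 2 = 1) (hv : Squarefree v) (hv2 : v % 2 = 1) (hvD : IsCoprime v D)
    (hw : w ^ 2 = algebraMap (𝓞 K) (𝓞 L) ((ε * g * (t₂ * v) : ℤ) * (D + B * s)))
    (hwK : (w : L) ∉ Set.range (algebraMap K L)) (hdeg : Module.finrank K L = 2)
    (hcase : (D % 4 = 1 ∧ t₂ = 1 ∧ c = 1 ∧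
      ∃ γ : 𝓞 K, (ε * g * (t₂ * v) : ℤ) * (D + B * s) = 1 + 4 * γ) ∨
      (D % 4 = 1 ∧ t₂ = 1 ∧ c = 4 ∧ ∃ γ : 𝓞 K, (ε * g * (t₂ * v) : ℤ) * (D + B * s) = -1 + 4 * γ) ∨
      (D % 4 = 1 ∧ t₂ = 2 ∧ c = 8 ∧ B % 2 = 0) ∨ (D % 2 = 0 ∧ t₂ = 1 ∧ c = 4)) :
    differentIdeal (𝓞 K) (𝓞 L) ^ 2 =
      Ideal.span {algebraMap (𝓞 K) (𝓞 L) (c * s * v)} := by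
  apply differentIdeal_sq_eq K L hdeg
  intro Q hQ
  have hQp := hQ.isPrime
  obtain ⟨τ, hτ⟩ : ∃ τ : 𝓞 K, τ = (ε * g * (t₂ * v) : ℤ) * (D + B * s) := ⟨_, rfl⟩
  rw [← hτ] at hw
  have hτ0 : τ ≠ 0 := by
    rintro rfl
    apply hwK
    rw [map_zero, pow_eq_zero_iff two_ne_zero] at hw
    exact ⟨0, by simp [hw]⟩
  have hpure := fun x => exists_local_of_pure (K := K) hw hwK (Q := Q) (x := x)
  have memQ : ∀ x : 𝓞 K, x ∈ Q.comap (algebraMap (𝓞 K) (𝓞 L)) ↔ algebraMap (𝓞 K) (𝓞 L) x ∈ Q :=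
    fun x => Iff.rfl
  have hPmax : (Q.comap (algebraMap (𝓞 K) (𝓞 L))).IsMaximal :=
    Ideal.isMaximal_comap_of_isIntegral_of_isMaximal Q
  generalize hP : Q.comap (algebraMap (𝓞 K) (𝓞 L)) = P at *
  have hPp := hPmax.isPrime
  have nm : ∀ {a b : 𝓞 K}, a ∉ P → b ∉ P → a * b ∉ P := fun ha hb hab =>
    (hPp.mem_or_mem hab).elim ha hb
  have nm2 : ∀ {a b : 𝓞 K}, a ∉ P ^ 2 → b ∉ P → b * a ∉ P ^ 2 := fun ha hb hab =>
    (Ideal.IsMaximal.mul_mem_pow P hab).elim hb ha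
  have h1P : (1 : 𝓞 K) ∉ P := fun h => hPmax.ne_top ((Ideal.eq_top_iff_one _).mpr h)
  have cop : ∀ {a b : ℤ}, IsCoprime a b → (a : 𝓞 K) ∈ P → (b : 𝓞 K) ∉ P := by
    rintro a b ⟨m, n, hmn⟩ ha hb
    apply h1P
    have : (1 : 𝓞 K) = m * a + n * b := by exact_mod_cast hmn.symm
    rw [this]
    exact add_mem (Ideal.mul_mem_left _ _ ha) (Ideal.mul_mem_left _ _ hb)
  have odd2 : ∀ {a : ℤ}, a % 2 = 1 → (2 : 𝓞 K) ∈ P → (a : 𝓞 K) ∉ P := by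
    intro a ha h2
    refine cop (a := 2) ⟨-(a / 2), 1, by omega⟩ (by exact_mod_cast h2)
  have evenP : ∀ {a : ℤ}, a % 2 = 0 → (2 : 𝓞 K) ∈ P → (a : 𝓞 K) ∈ P := by
    intro a ha h2
    obtain ⟨k, rfl⟩ : ∃ k, a = 2 * k := ⟨a / 2, by omega⟩
    push_cast
    exact Ideal.mul_mem_right _ _ h2
  have hεP : (ε : 𝓞 K) ∉ P := by
    intro h
    apply h1P
    have : (1 : 𝓞 K) = ε * ε := by rw [← pow_two]; exact_mod_cast hε.symm
    rw [this]
    exact Ideal.mul_mem_right _ _ h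
  have hghP : (D : 𝓞 K) = g * h := by exact_mod_cast hgh
  have hBCP : (D : 𝓞 K) = B ^ 2 + C ^ 2 := by exact_mod_cast hBC
  have hs0 : s ≠ 0 := by
    rintro rfl
    exact hsK ⟨0, by simp⟩
  have hsK0 : (s : K) ≠ 0 := by simpa using hs0
  have hα : (D : 𝓞 K) + B * s = s * (s + B) := by rw [← hs]; ring
  rw [hα] at hτ
  have hτK : (τ : K) = ε * g * (t₂ * v) * (s * (s + B)) := by
    rw [hτ]; simp only [map_mul, map_add, map_intCast, Int.cast_mul]
  by_cases hDP : (D : 𝓞 K) ∈ P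
  · have hsP : s ∈ P := hPp.mem_of_pow_mem 2 (by rwa [hs])
    have hs2 : s ∉ P ^ 2 := notMem_sq_of_sq_eq hs hD hdegK
    have hvP : (v : 𝓞 K) ∉ P := cop hvD.symm hDP
    have hBP : s + (B : 𝓞 K) ∉ P := by
      intro h
      have hB : (B : 𝓞 K) ∈ P := by simpa using sub_mem h hsP
      refine cop (isCoprime_of_squarefree_sum_sq hD hBC) hB (hPp.mem_of_pow_mem 2 ?_)
      have : (C : 𝓞 K) ^ 2 = D - B * B := by rw [hBCP]; ring
      rw [this]
      exact sub_mem hDP (Ideal.mul_mem_right _ _ hB)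
    have ht2 : (t₂ : 𝓞 K) ∉ P := by
      rcases hcase with h | h | h | h
      · simpa [h.2.1] using h1P
      · simpa [h.2.1] using h1P
      · intro h2
        exact odd2 (a := D) (by omega) (by simpa [h.2.1] using h2) hDP
      · simpa [h.2.1] using h1P
    obtain ⟨m, κ, hmP, hκ⟩ : ∃ (m : 𝓞 K) (κ : K), m ∉ P ∧
        κ ^ 2 * (τ : K) = algebraMap (𝓞 K) K (m * (s + B) * s) := by
      by_cases hgP : (g : 𝓞 K) ∈ P
      · refine ⟨ε * (t₂ * v) * h, h / s, nm (nm hεP (nm ht2 hvP)) ?_, ?_⟩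
        · refine cop (IsRelPrime.isCoprime ?_) hgP
          exact (squarefree_mul_iff.mp (hgh ▸ hD)).1
        · have hsD : (s : K) ^ 2 = g * h := by
            rw [← map_pow, hs, hghP]; simp
          rw [hτK]
          simp only [map_mul, map_add, map_intCast]
          field_simp
          rw [hsD]; ring
      · refine ⟨ε * g * (t₂ * v), 1, nm (nm hεP hgP) (nm ht2 hvP), ?_⟩
        rw [hτK]
        simp only [map_mul, map_add, map_intCast]
        ring
    have hβ2 : m * (s + B) * s ∉ P ^ 2 := nm2 hs2 (nm hmP hBP)
    have hβ0 : m * (s + B) * s ≠ 0 := fun h => hβ2 (h ▸ zero_mem _)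
    have hβP : m * (s + B) * s ∈ P := Ideal.mul_mem_left _ _ hsP
    by_cases hD2 : D % 2 = 0
    · have hc : (c : 𝓞 K) = 4 := by
        have : c = 4 := by omega
        rw [this]; norm_num
      refine hpure _ (m * (s + B) * s) κ hκ hβ0 v (m * (s + B)) hvP (nm hmP hBP) ?_
        (Or.inr ⟨hβP, hβ2⟩)
      rw [hc]; ring
    · have h2P : (2 : 𝓞 K) ∉ P := fun h => odd2 (a := D) (by omega) h hDP
      have h4P : (4 : 𝓞 K) ∉ P := by
        have := nm h2P h2P
        norm_num at this
        exact this
      have hcP : (c : 𝓞 K) ∉ P := by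
        rcases hcase with h | h | h | h
        · simpa [h.2.2.1] using h1P
        · simpa [h.2.2.1] using h4P
        · have := nm h2P h4P
          norm_num at this
          simpa [h.2.2.1] using this
        · omega
      refine hpure _ (m * (s + B) * s) κ hκ hβ0 (c * v) (4 * (m * (s + B))) (nm hcP hvP)
        (nm h4P (nm hmP hBP)) ?_ (Or.inr ⟨hβP, hβ2⟩)
      ring
  · have hsP : s ∉ P := fun h => hDP (by rw [← hs, pow_two]; exact Ideal.mul_mem_left _ _ h)
    have hgP : (g : 𝓞 K) ∉ P := fun h => hDP (by rw [hghP]; exact Ideal.mul_mem_right _ _ h)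
    by_cases h2P : (2 : 𝓞 K) ∈ P
    · have hDodd : D % 2 = 1 := by
        by_contra h
        exact hDP (evenP (by omega) h2P)
      have hvP : (v : 𝓞 K) ∉ P := odd2 hv2 h2P
      have hdiff : D % 4 = 1 → differentIdeal ℤ (𝓞 K) ^ 2 = Ideal.span {(D : 𝓞 K)} := by
        intro h4
        simpa using differentIdeal_quadratic hs hD hdegK hsK (Or.inl ⟨h4, rfl⟩)
      have h22 : D % 4 = 1 → (2 : 𝓞 K) ∉ P ^ 2 := by
        intro h4
        have := intCast_notMem_sq_of_notMem (hdiff h4) hDP (n := 2) Int.prime_two.squarefree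
        simpa using this
      rcases hcase with ⟨h4, ht2, hc, γ, hγ⟩ | ⟨h4, ht2, hc, γ, hγ⟩ | ⟨h4, ht2, hc, hB⟩ | h
      · rw [hα, ← hτ] at hγ
        have hyint : IsIntegral ℤ ((1 + (w : L)) / 2) := by
          have h1 : IsIntegral (𝓞 K) ((1 + (w : L)) / 2) := by
            refine ⟨Polynomial.X ^ 2 - Polynomial.X - Polynomial.C γ, by monicity!, ?_⟩
            have : (w : L) ^ 2 = 1 + 4 * algebraMap (𝓞 K) L γ := by
              have := congrArg (algebraMap (𝓞 L) L) hw
              rw [hγ] at this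
              rw [← map_pow, this, ← IsScalarTower.algebraMap_apply, map_add, map_mul, map_one,
                map_ofNat]
            simp only [Polynomial.eval₂_sub, Polynomial.eval₂_X_pow, Polynomial.eval₂_X,
              Polynomial.eval₂_C]
            linear_combination this / 4
          exact isIntegral_trans _ h1
        obtain ⟨y, hy⟩ : ∃ y : 𝓞 L, (y : L) = (1 + (w : L)) / 2 := ⟨⟨_, hyint⟩, rfl⟩
        have hyw : w = 2 * y - 1 := by
          apply RingOfIntegers.ext
          change (w : L) = algebraMap (𝓞 L) L (2 * y - 1)
          rw [map_sub, map_mul, map_ofNat (algebraMap (𝓞 L) L) 2, map_one]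
          linear_combination -2 * hy
        have hyeq : y ^ 2 - y - algebraMap (𝓞 K) (𝓞 L) γ = 0 := by
          have h4 : (4 : 𝓞 L) * (y ^ 2 - y - algebraMap (𝓞 K) (𝓞 L) γ) = 0 := by
            rw [hyw, hγ, map_add, map_mul, map_one, map_ofNat] at hw
            linear_combination hw
          exact (mul_eq_zero.mp h4).resolve_left (by norm_num)
        have hδ : (-1 : 𝓞 K) ^ 2 - 4 * (-γ) ∉ P := by
          intro h
          apply h1P
          have : (1 : 𝓞 K) = ((-1 : 𝓞 K) ^ 2 - 4 * (-γ)) - 2 * (2 * γ) := by ring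
          rw [this]
          exact sub_mem h (Ideal.mul_mem_right _ _ h2P)
        have hx : (c * s * v : 𝓞 K) ∉ P := by
          rw [hc]
          simpa using nm hsP hvP
        refine ⟨-1, -γ, y, _, _, ?_, ?_, (memQ _).not.mp hx, (memQ _).not.mp hδ, mul_comm _ _,
          Or.inl ((memQ _).not.mp hδ)⟩
        · simp only [map_neg, map_one]
          linear_combination hyeq
        · rintro ⟨r, hr⟩
          apply hwK
          refine ⟨2 * r - 1, ?_⟩
          rw [map_sub, map_mul, hr, map_ofNat, map_one]
          change 2 * (y : L) - 1 = w
          rw [hy]; ring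
      · rw [hα, ← hτ] at hγ
        have hodd : ∀ x : 𝓞 K, (1 - 2 * x) ∉ P := by
          intro x h
          apply h1P
          have : (1 : 𝓞 K) = (1 - 2 * x) + 2 * x := by ring
          rw [this]
          exact add_mem h (Ideal.mul_mem_right _ _ h2P)
        have hτP : τ ∉ P := by
          rw [hγ, ← neg_mem_iff]
          convert hodd (2 * γ) using 2
          ring
        refine ⟨-2, 2 * (1 - 2 * γ), w + 1, algebraMap _ _ (s * v), algebraMap _ _ τ, ?_, ?_,
          (memQ _).not.mp (nm hsP hvP), (memQ _).not.mp hτP, ?_, Or.inr ⟨?_, ?_, ?_⟩⟩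
        · rw [hγ] at hw
          simp only [map_neg, map_one, map_mul, map_sub, map_add, map_ofNat] at hw ⊢
          linear_combination hw
        · rintro ⟨r, hr⟩
          apply hwK
          refine ⟨r - 1, ?_⟩
          rw [map_sub, hr, map_one, map_add, map_one]
          ring
        · rw [← map_mul, ← map_mul, hγ, hc]
          congr 1
          push_cast
          ring
        · rw [← memQ, neg_mem_iff]
          exact h2P
        · rw [← memQ]
          exact Ideal.mul_mem_right _ _ h2P
        · rw [mul_comm]
          exact nm2 (h22 h4) (hodd γ)
      · have hαP : s * (s + B) ∉ P := by
          intro h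
          apply hDP
          have : (D : 𝓞 K) = s * (s + B) - B * s := by rw [← hs]; ring
          rw [this]
          exact sub_mem h (Ideal.mul_mem_right _ _ (evenP hB h2P))
        have hτe : τ = (ε * g * v * (s * (s + B))) * 2 := by
          rw [hτ, ht2]; push_cast; ring
        have hτ2 : τ ∉ P ^ 2 := by
          rw [hτe]
          exact nm2 (h22 h4) (nm (nm (nm hεP hgP) hvP) hαP)
        have hτP : τ ∈ P := by
          rw [hτe]; exact Ideal.mul_mem_left _ _ h2P
        refine hpure _ τ 1 (by simp) hτ0 s (ε * g * (s * (s + B))) hsP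
          (nm (nm hεP hgP) hαP) ?_ (Or.inr ⟨hτP, hτ2⟩)
        rw [hτe, hc]; push_cast; ring
      · omega
    · have h4P : (4 : 𝓞 K) ∉ P := by
        have := nm h2P h2P
        norm_num at this
        exact this
      have hcP : (c : 𝓞 K) ∉ P := by
        rcases hcase with h | h | h | h
        · simpa [h.2.2.1] using h1P
        · simpa [h.2.2.1] using h4P
        · have := nm h2P h4P
          norm_num at this
          simpa [h.2.2.1] using this
        · simpa [h.2.2] using h4P
      have ht2 : (t₂ : 𝓞 K) ∉ P := by
        rcases hcase with h | h | h | h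
        · simpa [h.2.1] using h1P
        · simpa [h.2.1] using h1P
        · simpa [h.2.1] using h2P
        · simpa [h.2.1] using h1P
      have hv2P : (v : 𝓞 K) ∉ P ^ 2 := by
        by_cases hD4 : D % 4 = 1
        · exact intCast_notMem_sq_of_notMem
            (differentIdeal_quadratic hs hD hdegK hsK (Or.inl ⟨hD4, rfl⟩)) (by simpa using hDP) hv
        · refine intCast_notMem_sq_of_notMem
            (differentIdeal_quadratic hs hD hdegK hsK (Or.inr ⟨by omega, rfl⟩)) ?_ hv
          push_cast
          exact nm h4P hDP
      obtain ⟨a, κ, haP, hκ⟩ : ∃ (a : 𝓞 K) (κ : K), a ∉ P ∧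
          κ ^ 2 * (τ : K) = algebraMap (𝓞 K) K (ε * g * t₂ * a * v) := by
        by_cases hαP : s * (s + B) ∈ P
        · refine ⟨2 * (s * (s + C)), s * (B + C + s) / (s * (s + B)), ?_, ?_⟩
          · have hB : s + (B : 𝓞 K) ∈ P := (hPp.mem_or_mem hαP).resolve_left hsP
            have hC : (C : 𝓞 K) ∈ P := by
              apply hPp.mem_of_pow_mem 2
              have : (C : 𝓞 K) ^ 2 = (s + B) * (s - B) := by
                linear_combination -hs - hBCP
              rw [this]
              exact Ideal.mul_mem_right _ _ hB
            refine nm h2P (nm hsP fun h => hsP ?_)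
            simpa using sub_mem h hC
          · have hsB : (s : K) + B ≠ 0 := by
              intro h
              apply hτ0
              apply RingOfIntegers.ext
              rw [hτK, h]; simp
            have hBCK : (s : K) ^ 2 = B ^ 2 + C ^ 2 := by
              rw [← map_pow, hs, hBCP]; simp
            rw [hτK]
            simp only [map_mul, map_add, map_intCast, map_ofNat (algebraMap (𝓞 K) K) 2]
            field_simp
            linear_combination (-ε * g * t₂ * v : K) * hBCK
        · refine ⟨s * (s + B), 1, hαP, ?_⟩
          rw [hτK]
          simp only [map_mul, map_add, map_intCast]
          ring
      have hmP : (ε * g * t₂ * a : 𝓞 K) ∉ P := nm (nm (nm hεP hgP) ht2) haP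
      have hβ2 : (ε * g * t₂ * a * v : 𝓞 K) ∉ P ^ 2 := nm2 hv2P hmP
      refine hpure _ _ κ hκ (fun h => hβ2 (h ▸ zero_mem _)) (c * s) (4 * (ε * g * t₂ * a))
        (nm hcP hsP) (nm h4P hmP) (by ring) ?_
      by_cases hvP : (v : 𝓞 K) ∈ P
      · exact Or.inr ⟨Ideal.mul_mem_left _ _ hvP, hβ2⟩
      · exact Or.inl (nm h4P (nm hmP hvP))

/-- The absolute discriminant of `ℚ(√(t (D + B √D)))`. -/
theorem natAbs_discr_eq {s : 𝓞 K} {w : 𝓞 L} {D B C g h ε v t₂ c e : ℤ}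
    (hs : s ^ 2 = D) (hD : Squarefree D) (hdegK : Module.finrank ℚ K = 2)
    (hsK : (s : K) ∉ Set.range (algebraMap ℚ K)) (hBC : D = B ^ 2 + C ^ 2) (hgh : D = g * h)
    (hε : ε ^ 2 = 1) (hv : Squarefree v) (hv2 : v % 2 = 1) (hvD : IsCoprime v D)
    (hw : w ^ 2 = algebraMap (𝓞 K) (𝓞 L) ((ε * g * (t₂ * v) : ℤ) * (D + B * s)))
    (hwK : (w : L) ∉ Set.range (algebraMap K L)) (hdeg : Module.finrank K L = 2)
    (hcase : (D % 4 = 1 ∧ t₂ = 1 ∧ c = 1 ∧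
      ∃ γ : 𝓞 K, (ε * g * (t₂ * v) : ℤ) * (D + B * s) = 1 + 4 * γ) ∨
      (D % 4 = 1 ∧ t₂ = 1 ∧ c = 4 ∧ ∃ γ : 𝓞 K, (ε * g * (t₂ * v) : ℤ) * (D + B * s) = -1 + 4 * γ) ∨
      (D % 4 = 1 ∧ t₂ = 2 ∧ c = 8 ∧ B % 2 = 0) ∨ (D % 2 = 0 ∧ t₂ = 1 ∧ c = 4))
    (he : (D % 4 = 1 ∧ e = 1) ∨ (D % 2 = 0 ∧ e = 4)) :
    ((discr L).natAbs : ℤ) = |c ^ 2 * e ^ 2 * D ^ 3 * v ^ 2| := by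
  have h1 := congrArg Ideal.absNorm (differentIdeal_relative_sq hs hD hdegK hsK hBC hgh hε hv hv2
    hvD hw hwK hdeg hcase)
  have hdeg4 : Module.finrank ℚ L = 4 := by
    rw [← Module.finrank_mul_finrank ℚ K L, hdegK, hdeg]
  have h2 : (Ideal.absNorm (differentIdeal (𝓞 K) (𝓞 L)) ^ 2) ^ 2 =
      ((c ^ 2 * D * v ^ 2).natAbs ^ 2) ^ 2 := by
    rw [map_pow] at h1
    rw [h1, ← map_pow, Ideal.span_singleton_pow, ← map_pow,
      show (c * s * v : 𝓞 K) ^ 2 = ((c ^ 2 * D * v ^ 2 : ℤ) : 𝓞 K) by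
        push_cast; rw [← hs]; ring,
      map_intCast, ← eq_intCast (algebraMap ℤ (𝓞 L)), Ideal.absNorm_span_singleton,
      Algebra.norm_algebraMap, RingOfIntegers.rank, hdeg4, Int.natAbs_pow]
    ring
  have h3 := Nat.pow_left_injective two_ne_zero (Nat.pow_left_injective two_ne_zero h2)
  rw [natAbs_discr_eq_absNorm_differentIdeal_mul_natAbs_discr_pow K (𝓞 K) L (𝓞 L), h3, hdeg,
    natAbs_discr_quadratic hs hD hdegK hsK he, ← Int.natAbs_pow, ← Int.natAbs_mul,
    Int.natCast_natAbs]
  congr 1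
  ring

end

end C4Count

namespace C4Count

open NumberField IntermediateField

lemma finrank_adjoin_sqrt {F E : Type*} [Field F] [Field E] [Algebra F E] {x : E} {a : F}
    (hx : x ^ 2 = algebraMap F E a) (hxF : x ∉ Set.range (algebraMap F E)) :
    Module.finrank F F⟮x⟯ = 2 := by
  have hmonic : (Polynomial.X ^ 2 - Polynomial.C a : Polynomial F).Monic := by monicity!
  have hroot : Polynomial.aeval x (Polynomial.X ^ 2 - Polynomial.C a : Polynomial F) = 0 := by
    simp [hx]
  have hyint : IsIntegral F x := ⟨_, hmonic, by simpa [Polynomial.aeval_def] using hroot⟩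
  rw [adjoin.finrank hyint]
  apply le_antisymm
  · calc _ ≤ (Polynomial.X ^ 2 - Polynomial.C a : Polynomial F).natDegree :=
        Polynomial.natDegree_le_of_dvd (minpoly.dvd F x hroot) hmonic.ne_zero
      _ ≤ 2 := by compute_degree
  · rw [minpoly.two_le_natDegree_iff hyint]
    exact hxF

lemma mem_adjoin_sqrt {F E : Type*} [Field F] [Field E] [Algebra F E] {s : E} {d : F}
    (hs : s ^ 2 = algebraMap F E d) {x : E} (hx : x ∈ F⟮s⟯) :
    ∃ a b : F, x = algebraMap F E a + algebraMap F E b * s := by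
  have halg : IsAlgebraic F s :=
    IsIntegral.isAlgebraic (IsIntegral.of_pow two_pos (hs ▸ isIntegral_algebraMap))
  rw [← mem_toSubalgebra, adjoin_simple_toSubalgebra_of_isAlgebraic halg] at hx
  exact (mem_adjoin_quadratic_iff (b := 0) (c := -d) (by simp [hs]) x).mp hx

section

variable {L : Type*} [Field L] [CharZero L]

lemma eq_zero_of_add_mul_eq_zero {s : L} {d : ℤ} (hs : s ^ 2 = d) (hd : ∀ r : ℚ, r ^ 2 ≠ d)
    {a b : ℚ} (h : (a : L) + b * s = 0) : a = 0 ∧ b = 0 := by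
  have hb : b = 0 := by
    by_contra hb
    have hb' : (b : L) ≠ 0 := by exact_mod_cast hb
    have h1 : s = ((-a / b : ℚ) : L) := by
      push_cast
      field_simp
      linear_combination h
    rw [h1] at hs
    exact hd (-a / b) (by exact_mod_cast hs)
  subst hb
  simpa using h

lemma sqrt_notMem_range {s : L} {d : ℤ} (hs : s ^ 2 = d) (hd : ∀ r : ℚ, r ^ 2 ≠ d) :
    s ∉ Set.range (algebraMap ℚ L) := by
  rintro ⟨r, rfl⟩
  have h := eq_zero_of_add_mul_eq_zero hs hd (a := r) (b := -1) (by simp)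
  norm_num at h

lemma sqrt_notMem_adjoin {s w : L} {D B C t : ℤ} (hs : s ^ 2 = D) (hD : ∀ r : ℚ, r ^ 2 ≠ D)
    (hBC : D = B ^ 2 + C ^ 2) (hw : w ^ 2 = t * (D + B * s)) (ht : t ≠ 0) : w ∉ ℚ⟮s⟯ := by
  intro hmem
  have hC : C ≠ 0 := by
    rintro rfl
    exact hD B (by rw [hBC]; push_cast; ring)
  obtain ⟨a, b, rfl⟩ := mem_adjoin_sqrt (F := ℚ) (d := D) (by simpa using hs) hmem
  simp only [eq_ratCast] at hw
  have h := eq_zero_of_add_mul_eq_zero hs hD (a := a ^ 2 + b ^ 2 * D - t * D)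
    (b := 2 * a * b - t * B) (by push_cast; linear_combination hw - (b : L) ^ 2 * hs)
  apply hD ((a ^ 2 - b ^ 2 * D) / (t * C))
  have htq : (t : ℚ) ≠ 0 := by exact_mod_cast ht
  have hCq : (C : ℚ) ≠ 0 := by exact_mod_cast hC
  have hBCq : (D : ℚ) = B ^ 2 + C ^ 2 := by exact_mod_cast hBC
  field_simp
  linear_combination (a ^ 2 + b ^ 2 * D + t * D) * h.1 - D * (2 * a * b + t * B) * h.2 +
    t ^ 2 * D * hBCq

lemma finrank_tower {s w : L} {D B C t : ℤ} (hs : s ^ 2 = D) (hD : ∀ r : ℚ, r ^ 2 ≠ D)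
    (hBC : D = B ^ 2 + C ^ 2) (hw : w ^ 2 = t * (D + B * s)) (ht : t ≠ 0)
    (htop : ℚ⟮w⟯ = ⊤) : Module.finrank ℚ ℚ⟮s⟯ = 2 ∧ Module.finrank ℚ⟮s⟯ L = 2 := by
  refine ⟨finrank_adjoin_sqrt (a := (D : ℚ)) (by simpa using hs) (sqrt_notMem_range hs hD), ?_⟩
  have hwK : w ∉ Set.range (algebraMap ℚ⟮s⟯ L) := by
    rintro ⟨x, rfl⟩
    exact sqrt_notMem_adjoin hs hD hBC hw ht x.2
  have hfin := finrank_adjoin_sqrt (F := ℚ⟮s⟯) (x := w)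
    (a := ((t : ℚ⟮s⟯) * (D + B * AdjoinSimple.gen ℚ s))) (by simpa using hw) hwK
  have htop' : ℚ⟮s⟯⟮w⟯ = ⊤ := by
    rw [eq_top_iff]
    intro x _
    have hle : ℚ⟮w⟯ ≤ restrictScalars ℚ ℚ⟮s⟯⟮w⟯ := by
      rw [adjoin_simple_le_iff, mem_restrictScalars]
      exact mem_adjoin_simple_self _ _
    have hx : x ∈ ℚ⟮w⟯ := by
      rw [htop]
      exact mem_top
    have h := hle hx
    rwa [mem_restrictScalars] at h
  rw [← hfin, htop', finrank_top']

/-- A Galois quartic field containing `√(t (D + B √D))` is cyclic. -/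
lemma nonempty_mulEquiv_zmod_four [FiniteDimensional ℚ L] [IsGalois ℚ L]
    {s w : L} {D B C t : ℤ} (hs : s ^ 2 = D)
    (hD : ∀ r : ℚ, r ^ 2 ≠ D) (hBC : D = B ^ 2 + C ^ 2) (hw : w ^ 2 = t * (D + B * s))
    (ht : t ≠ 0) (hdeg : Module.finrank ℚ L = 4) :
    Nonempty ((L ≃ₐ[ℚ] L) ≃* Multiplicative (ZMod 4)) := by
  have hC : C ≠ 0 := by
    rintro rfl
    exact hD B (by rw [hBC]; push_cast; ring)
  have hs0 : s ≠ 0 := by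
    rintro rfl
    exact hD 0 (by
      have : (D : L) = 0 := by rw [← hs]; ring
      have : D = 0 := by exact_mod_cast this
      simp [this])
  obtain ⟨σ, hσ⟩ : ∃ σ : L ≃ₐ[ℚ] L, σ s ≠ s := by
    by_contra! h
    exact sqrt_notMem_range hs hD (mem_bot.mp ((IsGalois.mem_bot_iff_fixed s).mpr h))
  have hσs : σ s = -s := by
    have h : (σ s - s) * (σ s + s) = 0 := by
      have : (σ s) ^ 2 = s ^ 2 := by rw [← map_pow, hs]; simp
      linear_combination this
    rcases mul_eq_zero.mp h with h | h
    · exact absurd (sub_eq_zero.mp h) hσ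
    · linear_combination h
  have hw0 : w ≠ 0 := by
    rintro rfl
    exact sqrt_notMem_adjoin hs hD hBC hw ht (zero_mem _)
  have hσw2 : σ w ^ 2 = t * (D - B * s) := by
    rw [← map_pow, hw]
    simp only [map_mul, map_add, map_intCast, hσs]
    ring
  have hBCL : (D : L) = B ^ 2 + C ^ 2 := by exact_mod_cast hBC
  have hprod : (σ w * w - t * C * s) * (σ w * w + t * C * s) = 0 := by
    linear_combination w ^ 2 * hσw2 + t * (D - B * s) * hw - t ^ 2 * (B ^ 2 + C ^ 2) * hs +
      t ^ 2 * D * hBCL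
  have hσσ : σ (σ w) = -w := by
    have hσw0 : σ w ≠ 0 := by simpa using hw0
    apply mul_right_cancel₀ hσw0
    rcases mul_eq_zero.mp hprod with h | h <;>
    · have h' := congrArg σ h
      simp [hσs] at h'
      linear_combination h' + h
  have hcard : Nat.card (L ≃ₐ[ℚ] L) = 4 := by
    rw [IsGalois.card_aut_eq_finrank, hdeg]
  have hord : orderOf σ = 2 ^ (1 + 1) := by
    apply orderOf_eq_prime_pow
    · intro h
      have h1 := DFunLike.congr_fun h w
      rw [pow_one, pow_two, AlgEquiv.mul_apply, hσσ, AlgEquiv.one_apply] at h1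
      exact hw0 (self_eq_neg.mp h1.symm)
    · have := pow_card_eq_one' (x := σ)
      rwa [hcard] at this
  have hcyc : IsCyclic (L ≃ₐ[ℚ] L) := isCyclic_of_orderOf_eq_card σ (by rw [hord, hcard]; norm_num)
  exact ⟨mulEquivOfCyclicCardEq (by rw [hcard]; simp)⟩

end

/-- The absolute discriminant of the field `ℚ(√(ε g u (D + B √D)))`, where `D` is a sum of two
squares `B ^ 2 + C ^ 2`. -/
def quarticDisc (D B g ε u : ℤ) : ℤ :=
  if D % 2 = 1 then
    if u % 2 = 1 then
      if (ε * g * u * (D - B)) % 4 = 1 then D ^ 3 * u ^ 2 else 16 * D ^ 3 * u ^ 2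
    else 16 * D ^ 3 * u ^ 2
  else 256 * D ^ 3 * u ^ 2

lemma natAbs_discr_quartic {L : Type*} [Field L] [NumberField L] {s w : L}
    {D B C g h ε u : ℤ} (hs : s ^ 2 = D) (hDsq : ∀ r : ℚ, r ^ 2 ≠ D) (hD : Squarefree D)
    (hDpos : 0 < D) (hBC : D = B ^ 2 + C ^ 2) (hB : D % 2 = 1 → B % 2 = 0) (hgh : D = g * h)
    (hε : ε ^ 2 = 1) (hu : Squarefree u) (huD : IsCoprime u D)
    (hw : w ^ 2 = (ε * g * u : ℤ) * (D + B * s)) (htop : ℚ⟮w⟯ = ⊤) :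
    ((discr L).natAbs : ℤ) = quarticDisc D B g ε u := by
  have hD4 : D % 4 = 1 ∨ D % 4 = 2 := by
    have h4 : D % 4 ≠ 0 := by
      intro h
      have := hD 2 (by omega)
      norm_num [Int.isUnit_iff] at this
    rcases Int.even_or_odd' B with ⟨b, rfl | rfl⟩ <;>
    rcases Int.even_or_odd' C with ⟨c, rfl | rfl⟩ <;> ring_nf at hBC <;> omega
  have hD0 : D ≠ 0 := hDpos.ne'
  have hg0 : g ≠ 0 := by rintro rfl; simp at hgh; exact hD0 hgh
  have hu0 : u ≠ 0 := hu.ne_zero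
  have hε0 : ε ≠ 0 := by rintro rfl; norm_num at hε
  have ht : ε * g * u ≠ 0 := by positivity
  obtain ⟨hfK, hfL⟩ := finrank_tower hs hDsq hBC hw ht htop
  have hsint : IsIntegral ℤ (AdjoinSimple.gen ℚ s) := by
    refine IsIntegral.of_pow two_pos ?_
    have : (AdjoinSimple.gen ℚ s) ^ 2 = ((D : ℤ) : ℚ⟮s⟯) := by
      apply Subtype.ext
      simpa using hs
    rw [this]
    exact isIntegral_algebraMap (R := ℤ)
  set S : 𝓞 ℚ⟮s⟯ := ⟨AdjoinSimple.gen ℚ s, hsint⟩ with hS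
  have hScoe : (S : ℚ⟮s⟯) = AdjoinSimple.gen ℚ s := rfl
  have hS2 : S ^ 2 = (D : 𝓞 ℚ⟮s⟯) := by
    apply RingOfIntegers.ext
    apply Subtype.ext
    push_cast
    simpa [hScoe] using hs
  have hsint' : IsIntegral ℤ s := by
    refine IsIntegral.of_pow two_pos ?_
    rw [hs]
    exact isIntegral_algebraMap (R := ℤ)
  have hwint : IsIntegral ℤ w := by
    refine IsIntegral.of_pow two_pos ?_
    rw [hw]
    exact (isIntegral_algebraMap (R := ℤ)).mul ((isIntegral_algebraMap (R := ℤ)).add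
      ((isIntegral_algebraMap (R := ℤ)).mul hsint'))
  set W : 𝓞 L := ⟨w, hwint⟩ with hW
  have hSL : algebraMap (𝓞 L) L (algebraMap (𝓞 ℚ⟮s⟯) (𝓞 L) S) = s := rfl
  have hW2 : W ^ 2 = algebraMap (𝓞 ℚ⟮s⟯) (𝓞 L)
      ((ε * g * u : ℤ) * ((D : 𝓞 ℚ⟮s⟯) + B * S)) := by
    apply FaithfulSMul.algebraMap_injective (𝓞 L) L
    rw [map_pow]
    change w ^ 2 = _
    rw [hw]
    simp only [map_mul, map_add, map_intCast, hSL]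
  have hSK : (S : ℚ⟮s⟯) ∉ Set.range (algebraMap ℚ ℚ⟮s⟯) :=
    sqrt_notMem_range (d := D) (by rw [← map_pow, hS2, map_intCast]) hDsq
  have hWK : (W : L) ∉ Set.range (algebraMap ℚ⟮s⟯ L) := by
    rintro ⟨x, hx⟩
    exact sqrt_notMem_adjoin hs hDsq hBC hw ht ((show w = _ from hx.symm) ▸ x.2)
  have key : ∀ {v t₂ c e : ℤ}, u = t₂ * v → Squarefree v → v % 2 = 1 → IsCoprime v D →
      ((D % 4 = 1 ∧ t₂ = 1 ∧ c = 1 ∧ ∃ γ : 𝓞 ℚ⟮s⟯, (ε*g*(t₂*v) : ℤ) * (D + B * S) = 1 + 4 * γ) ∨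
      (D % 4 = 1 ∧ t₂ = 1 ∧ c = 4 ∧ ∃ γ : 𝓞 ℚ⟮s⟯, (ε*g*(t₂*v) : ℤ) * (D + B * S) = -1 + 4 * γ) ∨
      (D % 4 = 1 ∧ t₂ = 2 ∧ c = 8 ∧ B % 2 = 0) ∨ (D % 2 = 0 ∧ t₂ = 1 ∧ c = 4)) →
      ((D % 4 = 1 ∧ e = 1) ∨ (D % 2 = 0 ∧ e = 4)) →
      ((discr L).natAbs : ℤ) = c ^ 2 * e ^ 2 * D ^ 3 * v ^ 2 := by
    intro v t₂ c e huv hv hv2 hvD hcase he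
    rw [natAbs_discr_eq hS2 hD hfK hSK hBC hgh hε hv hv2 hvD (huv ▸ hW2) hWK hfL hcase he,
      abs_of_nonneg (by positivity)]
  unfold quarticDisc
  rcases hD4 with hD4 | hD4
  · rw [if_pos (by omega)]
    rcases Int.emod_two_eq_zero_or_one u with hu2 | hu2
    · rw [if_neg (by omega)]
      obtain ⟨v, rfl⟩ := Int.dvd_of_emod_eq_zero hu2
      have hv2 : v % 2 = 1 := by
        by_contra h
        obtain ⟨k, rfl⟩ : (2 : ℤ) ∣ v := by omega
        have := hu 2 ⟨k, by ring⟩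
        norm_num [Int.isUnit_iff] at this
      rw [key rfl (hu.squarefree_of_dvd (Dvd.intro_left 2 rfl)) hv2
        (huD.of_isCoprime_of_dvd_left (Dvd.intro_left 2 rfl))
        (Or.inr (Or.inr (Or.inl ⟨hD4, rfl, rfl, hB (by omega)⟩))) (Or.inl ⟨hD4, rfl⟩)]
      ring
    · rw [if_pos hu2]
      obtain ⟨k, hk⟩ : (4 : ℤ) ∣ D - 1 := by omega
      obtain ⟨b, hb⟩ : (2 : ℤ) ∣ B := by have := hB (by omega); omega
      have hyint : IsIntegral ℤ ((1 + (S : ℚ⟮s⟯)) / 2) := by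
        refine ⟨Polynomial.X ^ 2 - Polynomial.X - Polynomial.C k, by monicity!, ?_⟩
        have : (S : ℚ⟮s⟯) ^ 2 = D := by rw [← map_pow, hS2, map_intCast]
        have hk' : (D : ℚ⟮s⟯) - 1 = 4 * k := by exact_mod_cast hk
        simp only [Polynomial.eval₂_sub, Polynomial.eval₂_pow, Polynomial.eval₂_X,
          Polynomial.eval₂_C, algebraMap_int_eq, Int.coe_castRingHom]
        linear_combination this / 4 + hk' / 4
      set y : 𝓞 ℚ⟮s⟯ := ⟨_, hyint⟩ with hy
      have hSy : S = 2 * y - 1 := by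
        apply FaithfulSMul.algebraMap_injective (𝓞 ℚ⟮s⟯) ℚ⟮s⟯
        have : algebraMap (𝓞 ℚ⟮s⟯) ℚ⟮s⟯ y = (1 + algebraMap (𝓞 ℚ⟮s⟯) ℚ⟮s⟯ S) / 2 := rfl
        rw [map_sub, map_mul, this]
        simp only [map_ofNat, map_one]
        ring
      have hmod : ((ε * g * u : ℤ) : 𝓞 ℚ⟮s⟯) * (D + B * S) =
          ((ε * g * u * (D - B) : ℤ) : 𝓞 ℚ⟮s⟯) + 4 * ((ε * g * u * b : ℤ) * y) := by
        rw [hSy, hb]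
        push_cast
        ring
      have hoddg : g % 2 = 1 := by
        by_contra h
        obtain ⟨j, rfl⟩ : (2 : ℤ) ∣ g := by omega
        rw [mul_assoc] at hgh
        omega
      have hoddε : ε % 2 = 1 := by
        rcases mul_self_eq_one_iff.mp (sq ε ▸ hε) with h | h <;> omega
      have hodd : (ε * g * u * (D - B)) % 2 = 1 := by
        have hDB : (D - B) % 2 = 1 := by omega
        rw [Int.mul_emod, Int.mul_emod (ε * g), Int.mul_emod ε, hoddg, hoddε, hu2, hDB]
        norm_num
      split_ifs with h4
      · obtain ⟨j, hj⟩ : (4 : ℤ) ∣ ε * g * u * (D - B) - 1 := by omega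
        rw [key (v := u) (t₂ := 1) (c := 1) (e := 1) (by ring) hu hu2 huD
          (Or.inl ⟨hD4, rfl, rfl, j + (ε * g * u * b : ℤ) * y, ?_⟩) (Or.inl ⟨hD4, rfl⟩)]
        · ring
        · rw [one_mul, hmod, eq_add_of_sub_eq hj]
          push_cast
          ring
      · obtain ⟨j, hj⟩ : (4 : ℤ) ∣ ε * g * u * (D - B) - (-1) := by omega
        rw [key (v := u) (t₂ := 1) (c := 4) (e := 1) (by ring) hu hu2 huD
          (Or.inr (Or.inl ⟨hD4, rfl, rfl, j + (ε * g * u * b : ℤ) * y, ?_⟩)) (Or.inl ⟨hD4, rfl⟩)]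
        · ring
        · rw [one_mul, hmod, eq_add_of_sub_eq hj]
          push_cast
          ring
  · rw [if_neg (by omega)]
    have hu2 : u % 2 = 1 := by
      by_contra h
      have h2 := huD.isUnit_of_dvd' (x := 2) (by omega) (by omega)
      norm_num [Int.isUnit_iff] at h2
    rw [key (v := u) (t₂ := 1) (c := 4) (e := 4) (by ring) hu hu2 huD
      (Or.inr (Or.inr (Or.inr ⟨by omega, rfl, rfl⟩))) (Or.inr ⟨by omega, rfl⟩)]
    ring

section

variable {E : Type*} [Field E] [CharZero E] {s w : E} {D B C t : ℤ}

lemma ne_zero_of_not_square (hD : ∀ r : ℚ, r ^ 2 ≠ D) (hBC : D = B ^ 2 + C ^ 2) :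
    B ≠ 0 ∧ C ≠ 0 := by
  constructor
  · rintro rfl
    exact hD C (by rw [hBC]; push_cast; ring)
  · rintro rfl
    exact hD B (by rw [hBC]; push_cast; ring)

lemma sqrt_mem_adjoin (hD : ∀ r : ℚ, r ^ 2 ≠ D) (hBC : D = B ^ 2 + C ^ 2)
    (hw : w ^ 2 = t * (D + B * s)) (ht : t ≠ 0) : s ∈ ℚ⟮w⟯ := by
  have hB : (B : E) ≠ 0 := by exact_mod_cast (ne_zero_of_not_square hD hBC).1
  have ht' : (t : E) ≠ 0 := by exact_mod_cast ht
  have : s = (w ^ 2 / t - D) / B := by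
    rw [hw]
    field_simp
    ring
  rw [this]
  exact div_mem (sub_mem (div_mem (pow_mem (mem_adjoin_simple_self _ _) 2) (intCast_mem _ _))
    (intCast_mem _ _)) (intCast_mem _ _)

lemma mem_adjoin_of_conj (hs : s ^ 2 = D) (hD : ∀ r : ℚ, r ^ 2 ≠ D) (hBC : D = B ^ 2 + C ^ 2)
    (hw : w ^ 2 = t * (D + B * s)) (ht : t ≠ 0) {s' w' : E} (hs' : s' ^ 2 = D)
    (hw' : w' ^ 2 = t * (D + B * s')) : w' ∈ ℚ⟮w⟯ := by
  have hwmem : w ∈ ℚ⟮w⟯ := mem_adjoin_simple_self _ _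
  have hsmem := sqrt_mem_adjoin hD hBC hw ht
  have hw0 : w ≠ 0 := by
    rintro rfl
    exact sqrt_notMem_adjoin hs hD hBC hw ht (zero_mem _)
  have hσs : (s' - s) * (s' + s) = 0 := by linear_combination hs' - hs
  rcases mul_eq_zero.mp hσs with h | h
  · have h1 : (w' - w) * (w' + w) = 0 := by linear_combination hw' - hw + t * B * h
    rcases mul_eq_zero.mp h1 with h | h
    · rwa [sub_eq_zero.mp h]
    · rw [eq_neg_of_add_eq_zero_left h]
      exact neg_mem hwmem
  · have hBCL : (D : E) = B ^ 2 + C ^ 2 := by exact_mod_cast hBC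
    have h1 : (w' * w - t * C * s) * (w' * w + t * C * s) = 0 := by
      linear_combination w ^ 2 * hw' + t * (D - B * s) * hw - t ^ 2 * (B ^ 2 + C ^ 2) * hs +
        t ^ 2 * D * hBCL + t * B * w ^ 2 * h
    have hmem : t * C * s ∈ ℚ⟮w⟯ := mul_mem (mul_mem (intCast_mem _ _) (intCast_mem _ _)) hsmem
    rcases mul_eq_zero.mp h1 with h | h
    · rw [eq_div_of_mul_eq hw0 (sub_eq_zero.mp h)]
      exact div_mem hmem hwmem
    · rw [eq_div_of_mul_eq hw0 (eq_neg_of_add_eq_zero_left h)]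
      exact div_mem (neg_mem hmem) hwmem

lemma adjoin_eq_of_conj (hs : s ^ 2 = D) (hD : ∀ r : ℚ, r ^ 2 ≠ D) (hBC : D = B ^ 2 + C ^ 2)
    (hw : w ^ 2 = t * (D + B * s)) (ht : t ≠ 0) {s' w' : E} (hs' : s' ^ 2 = D)
    (hw' : w' ^ 2 = t * (D + B * s')) : ℚ⟮w⟯ = ℚ⟮w'⟯ := by
  apply le_antisymm <;> rw [adjoin_simple_le_iff]
  · exact mem_adjoin_of_conj hs' hD hBC hw' ht hs hw
  · exact mem_adjoin_of_conj hs hD hBC hw ht hs' hw'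

lemma finiteDimensional_adjoin_sqrt (hs : s ^ 2 = D) (hw : w ^ 2 = t * (D + B * s)) :
    FiniteDimensional ℚ ℚ⟮w⟯ := by
  have hsint : IsIntegral ℚ s := by
    refine IsIntegral.of_pow two_pos ?_
    rw [hs]
    simpa using isIntegral_algebraMap (R := ℚ) (A := E) (x := (D : ℚ))
  have hyint : ∀ n : ℤ, IsIntegral ℚ (n : E) := fun n ↦ by
    simpa using isIntegral_algebraMap (R := ℚ) (A := E) (x := (n : ℚ))
  refine adjoin.finiteDimensional (IsIntegral.of_pow two_pos ?_)
  rw [hw]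
  exact (hyint _).mul ((hyint _).add ((hyint _).mul hsint))

omit [CharZero E] in
lemma adjoin_simple_gen_eq_top {F : Type*} [Field F] [Algebra F E] (w : E) :
    F⟮AdjoinSimple.gen F w⟯ = ⊤ := by
  apply map_injective F⟮w⟯.val
  rw [adjoin_map, ← AlgHom.fieldRange_eq_map, fieldRange_val]
  simp

lemma finrank_adjoin_eq_four (hs : s ^ 2 = D) (hD : ∀ r : ℚ, r ^ 2 ≠ D)
    (hBC : D = B ^ 2 + C ^ 2) (hw : w ^ 2 = t * (D + B * s)) (ht : t ≠ 0) :
    Module.finrank ℚ ℚ⟮w⟯ = 4 := by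
  have hsmem := sqrt_mem_adjoin hD hBC hw ht
  obtain ⟨h1, h2⟩ := finrank_tower (L := ℚ⟮w⟯) (s := ⟨s, hsmem⟩) (w := AdjoinSimple.gen ℚ w)
    (Subtype.ext (by simpa using hs)) hD hBC (Subtype.ext (by simpa using hw)) ht
    (adjoin_simple_gen_eq_top w)
  rw [← Module.finrank_mul_finrank ℚ ℚ⟮(⟨s, hsmem⟩ : ℚ⟮w⟯)⟯ ℚ⟮w⟯, h1, h2]

end

lemma normal_algebraicClosure : Normal ℚ (AlgebraicClosure ℚ) := by
  convert @IsAlgClosure.normal ℚ (AlgebraicClosure ℚ) _ _ (AlgebraicClosure.instAlgebra ℚ)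
    (@IsAlgClosure.mk _ _ _ _ (AlgebraicClosure.instAlgebra ℚ) _
      (AlgebraicClosure.isAlgClosed ℚ)
      (AlgebraicClosure.isAlgebraic ℚ)) using 1
  exact Subsingleton.elim _ _

lemma quartic_properties {s w : AlgebraicClosure ℚ}
    {D B C g h ε u : ℤ} (hs : s ^ 2 = D) (hDsq : ∀ r : ℚ, r ^ 2 ≠ D) (hD : Squarefree D)
    (hDpos : 0 < D) (hBC : D = B ^ 2 + C ^ 2) (hB : D % 2 = 1 → B % 2 = 0) (hgh : D = g * h)
    (hε : ε ^ 2 = 1) (hu : Squarefree u) (huD : IsCoprime u D)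
    (hw : w ^ 2 = (ε * g * u : ℤ) * (D + B * s)) :
    FiniteDimensional ℚ ℚ⟮w⟯ ∧ IsGalois ℚ ℚ⟮w⟯ ∧
      Nonempty ((ℚ⟮w⟯ ≃ₐ[ℚ] ℚ⟮w⟯) ≃* Multiplicative (ZMod 4)) ∧
      (absDisc ℚ⟮w⟯ : ℤ) = quarticDisc D B g ε u := by
  have ht : ε * g * u ≠ 0 := by
    have hg0 : g ≠ 0 := by rintro rfl; simp at hgh; exact hDpos.ne' hgh
    have hu0 : u ≠ 0 := hu.ne_zero
    have hε0 : ε ≠ 0 := by rintro rfl; norm_num at hε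
    positivity
  have hfd := finiteDimensional_adjoin_sqrt hs hw
  have hnormal : @Normal ℚ ℚ⟮w⟯ _ _ (algebra' _) := by
    have := normal_algebraicClosure
    rw [normal_iff_forall_map_le]
    intro σ
    rw [adjoin_map, Set.image_singleton, adjoin_simple_le_iff]
    exact mem_adjoin_of_conj hs hDsq hBC hw ht (s' := σ s) (by rw [← map_pow, hs, map_intCast])
      (by rw [← map_pow, hw]; simp only [map_mul, map_add, map_intCast])
  have hgal : IsGalois ℚ ℚ⟮w⟯ := by
    have : Normal ℚ ℚ⟮w⟯ := by
      convert hnormal using 1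
      exact Subsingleton.elim _ _
    exact {}
  have hsmem := sqrt_mem_adjoin hDsq hBC hw ht
  have hs' : (⟨s, hsmem⟩ : ℚ⟮w⟯) ^ 2 = D := Subtype.ext (by simpa using hs)
  have hw' : (AdjoinSimple.gen ℚ w) ^ 2 =
      (ε * g * u : ℤ) * ((D : ℚ⟮w⟯) + B * (⟨s, hsmem⟩ : ℚ⟮w⟯)) := Subtype.ext (by simpa using hw)
  refine ⟨hfd, hgal, nonempty_mulEquiv_zmod_four hs' hDsq hBC hw' ht
    (finrank_adjoin_eq_four hs hDsq hBC hw ht), ?_⟩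
  unfold absDisc
  rw [dif_pos hfd]
  let _ : NumberField ℚ⟮w⟯ := ⟨⟩
  exact natAbs_discr_quartic hs' hDsq hD hDpos hBC hB hgh hε hu huD hw'
    (adjoin_simple_gen_eq_top w)

lemma eq_of_squarefree_of_mul_eq_sq {a b k : ℕ} (ha : Squarefree a) (hb : Squarefree b)
    (h : a * b = k ^ 2) : a = b := by
  obtain ⟨c, rfl⟩ := (ha.dvd_pow_iff_dvd two_ne_zero).mp
    (Dvd.intro b h)
  have hbc : b = a * (c * c) := by
    apply mul_left_cancel₀ ha.ne_zero
    rw [h]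
    ring
  have hc := hb c (Dvd.intro_left a hbc.symm)
  rw [Nat.isUnit_iff] at hc
  simp [hbc, hc]

lemma exists_nat_sq_eq_of_rat_sq {n : ℕ} {r : ℚ} (h : r ^ 2 = n) : ∃ k : ℕ, n = k ^ 2 := by
  have h1 : IsSquare (n : ℚ) := ⟨r, by rw [← h, sq]⟩
  rw [Rat.isSquare_natCast_iff] at h1
  obtain ⟨k, hk⟩ := h1
  exact ⟨k, by rw [hk, sq]⟩

lemma rat_sq_ne_of_squarefree {D : ℕ} (hD : Squarefree D) (h1 : 1 < D) (r : ℚ) : r ^ 2 ≠ D := by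
  intro h
  obtain ⟨k, rfl⟩ := exists_nat_sq_eq_of_rat_sq h
  have hk := hD k ⟨1, by ring⟩
  rw [Nat.isUnit_iff] at hk
  simp [hk] at h1

lemma exists_squarefree_mul_sq {q : ℚ} (hq : 0 < q) :
    ∃ (n : ℕ) (r : ℚ), Squarefree n ∧ 0 < r ∧ q = n * r ^ 2 := by
  obtain ⟨a, b, hab, ha⟩ := Nat.sq_mul_squarefree (q.num.natAbs * q.den)
  have hnum : (q.num.natAbs : ℚ) = q.num := by
    have : (q.num.natAbs : ℤ) = q.num := Int.natAbs_of_nonneg (Rat.num_nonneg.mpr hq.le)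
    rw [← this, Int.cast_natCast, Int.natAbs_natCast]
  have hden : (q.den : ℚ) ≠ 0 := by exact_mod_cast q.den_nz
  have hb : b ≠ 0 := by
    rintro rfl
    have : q.num.natAbs * q.den = 0 := by rw [← hab]; ring
    rcases mul_eq_zero.mp this with h | h
    · rw [Int.natAbs_eq_zero, Rat.num_eq_zero] at h
      exact hq.ne' h
    · exact q.den_nz h
  refine ⟨a, b / q.den, ha, by positivity, ?_⟩
  have hab' : (b : ℚ) ^ 2 * a = q.num * q.den := by rw [← hnum]; exact_mod_cast hab
  field_simp
  linear_combination -hab' + q.den * q.mul_den_eq_num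

/-- `D > 1` is squarefree and a sum of two squares. -/
structure IsQuadIndex (D : ℕ) : Prop where
  one_lt : 1 < D
  squarefree : Squarefree D
  mod_four : ∀ p, p.Prime → p ∣ D → p % 4 ≠ 3

lemma IsQuadIndex.exists_sq_add_sq {D : ℕ} (hD : IsQuadIndex D) :
    ∃ B C : ℤ, (D : ℤ) = B ^ 2 + C ^ 2 ∧ ((D : ℤ) % 2 = 1 → B % 2 = 0) := by
  obtain ⟨x, y, hxy⟩ := Nat.eq_sq_add_sq_iff.mpr fun {q} hq h3 ↦
    absurd h3 (hD.mod_four q (Nat.prime_of_mem_primeFactors hq) (Nat.dvd_of_mem_primeFactors hq))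
  rcases Nat.even_or_odd' x with ⟨a, ha | ha⟩
  · exact ⟨x, y, by rw [hxy]; push_cast; ring, fun _ ↦ by omega⟩
  · refine ⟨y, x, by rw [hxy]; push_cast; ring, fun h ↦ ?_⟩
    rcases Nat.even_or_odd' y with ⟨b, hb | hb⟩
    · omega
    · exfalso
      rw [ha, hb] at hxy
      ring_nf at hxy
      omega

lemma isQuadIndex_of_rat {D : ℕ} (hD : Squarefree D) (h1 : 1 < D) {a b : ℚ}
    (h : (D : ℚ) = a ^ 2 + b ^ 2) : IsQuadIndex D := by
  refine ⟨h1, hD, fun p hp hpD hp3 ↦ ?_⟩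
  have := Fact.mk hp
  have hk : a.den * b.den ≠ 0 := by simp
  have hN : D * (a.den * b.den) ^ 2 =
      (a.num.natAbs * b.den) ^ 2 + (b.num.natAbs * a.den) ^ 2 := by
    zify
    simp only [mul_pow, sq_abs]
    have ha := a.mul_den_eq_num
    have hb := b.mul_den_eq_num
    have : (D : ℚ) * (a.den ^ 2 * b.den ^ 2) =
        a.num ^ 2 * b.den ^ 2 + b.num ^ 2 * a.den ^ 2 := by
      rw [← ha, ← hb, h]
      ring
    exact_mod_cast this
  have hmem : p ∈ (D * (a.den * b.den) ^ 2).primeFactors :=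
    Nat.mem_primeFactors.mpr ⟨hp, hpD.mul_right _, by
      exact mul_ne_zero hD.ne_zero (pow_ne_zero 2 hk)⟩
  have h2 := Nat.eq_sq_add_sq_iff.mp ⟨_, _, hN⟩ p hmem hp3
  rw [padicValNat.mul hD.ne_zero (pow_ne_zero 2 hk), padicValNat.pow] at h2
  have h3 : padicValNat p D = 1 := by
    rw [← Nat.factorization_def _ hp]
    exact le_antisymm (hD.natFactorization_le_one p)
      ((hp.dvd_iff_one_le_factorization hD.ne_zero).mp hpD)
  rw [h3] at h2
  obtain ⟨k, hk⟩ := h2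
  omega

/-- Indices of cyclic quartic fields. -/
structure IsQuarticIndex (D g u : ℕ) (ε : ℤ) : Prop where
  quad : IsQuadIndex D
  dvd : g ∣ D
  minFac : ¬ D.minFac ∣ g
  squarefree : Squarefree u
  coprime : u.Coprime D
  sq_sign : ε ^ 2 = 1

/-- A choice of `B` such that `D - B ^ 2` is a square. -/
noncomputable def sqPart (D : ℕ) : ℤ :=
  if h : IsQuadIndex D then h.exists_sq_add_sq.choose else 0

lemma IsQuadIndex.sqPart_spec {D : ℕ} (hD : IsQuadIndex D) :
    ∃ C : ℤ, (D : ℤ) = sqPart D ^ 2 + C ^ 2 ∧ ((D : ℤ) % 2 = 1 → sqPart D % 2 = 0) := by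
  rw [sqPart, dif_pos hD]
  exact hD.exists_sq_add_sq.choose_spec

/-- A square root in the algebraic closure of `ℚ`. -/
noncomputable def csqrt (x : AlgebraicClosure ℚ) : AlgebraicClosure ℚ :=
  (IsAlgClosed.exists_pow_nat_eq x two_pos).choose

lemma csqrt_sq (x : AlgebraicClosure ℚ) : csqrt x ^ 2 = x :=
  (IsAlgClosed.exists_pow_nat_eq x two_pos).choose_spec

/-- The generator `√(ε g u (D + B √D))` of a cyclic quartic field. -/
noncomputable def quarticGen (D g u : ℕ) (ε : ℤ) : AlgebraicClosure ℚ :=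
  csqrt ((ε * g * u : ℤ) * ((D : ℤ) + sqPart D * csqrt (D : ℤ)))

lemma quarticGen_sq (D g u : ℕ) (ε : ℤ) : quarticGen D g u ε ^ 2 =
    (ε * g * u : ℤ) * ((D : ℤ) + sqPart D * csqrt (D : ℤ)) := csqrt_sq _

lemma IsQuadIndex.rat_sq_ne {D : ℕ} (hD : IsQuadIndex D) (r : ℚ) : r ^ 2 ≠ ((D : ℤ) : ℚ) := by
  simpa using rat_sq_ne_of_squarefree hD.squarefree hD.one_lt r

lemma IsQuarticIndex.mul_ne_zero {D g u : ℕ} {ε : ℤ} (h : IsQuarticIndex D g u ε) :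
    ε * g * u ≠ 0 := by
  have h1 : g ≠ 0 := by
    rintro rfl
    exact h.minFac (dvd_zero _)
  have h2 : u ≠ 0 := h.squarefree.ne_zero
  have h3 : ε ≠ 0 := by
    rintro rfl
    have := h.sq_sign
    norm_num at this
  positivity

lemma IsQuarticIndex.properties {D g u : ℕ} {ε : ℤ} (h : IsQuarticIndex D g u ε) :
    FiniteDimensional ℚ ℚ⟮quarticGen D g u ε⟯ ∧ IsGalois ℚ ℚ⟮quarticGen D g u ε⟯ ∧
      Nonempty ((ℚ⟮quarticGen D g u ε⟯ ≃ₐ[ℚ] ℚ⟮quarticGen D g u ε⟯) ≃*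
        Multiplicative (ZMod 4)) ∧
      (absDisc ℚ⟮quarticGen D g u ε⟯ : ℤ) = quarticDisc D (sqPart D) g ε u := by
  obtain ⟨C, hBC, hB⟩ := h.quad.sqPart_spec
  obtain ⟨k, hk⟩ := h.dvd
  refine quartic_properties (C := C) (h := k) (csqrt_sq _) h.quad.rat_sq_ne
    (Int.squarefree_natCast.mpr h.quad.squarefree) (by exact_mod_cast h.quad.one_lt.le) hBC hB
    (by exact_mod_cast hk) h.sq_sign (Int.squarefree_natCast.mpr h.squarefree)
    (Nat.isCoprime_iff_coprime.mpr h.coprime) (csqrt_sq _)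

lemma exists_generator {L : Type*} [Field L] [CharZero L] [FiniteDimensional ℚ L] [IsGalois ℚ L]
    (e : (L ≃ₐ[ℚ] L) ≃* Multiplicative (ZMod 4)) :
    ∃ σ : L ≃ₐ[ℚ] L, orderOf σ = 4 ∧ ∀ x, σ x = x → ∃ q : ℚ, x = q := by
  refine ⟨e.symm (Multiplicative.ofAdd 1), ?_, fun x hx ↦ ?_⟩
  · rw [MulEquiv.orderOf_eq, orderOf_ofAdd_eq_addOrderOf, ZMod.addOrderOf_one]
  · have hall : ∀ τ : L ≃ₐ[ℚ] L, τ x = x := by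
      intro τ
      have hτ : τ = e.symm (Multiplicative.ofAdd 1) ^ (Multiplicative.toAdd (e τ)).val := by
        rw [← map_pow, ← ofAdd_nsmul, nsmul_one, ZMod.natCast_zmod_val, ofAdd_toAdd,
          MulEquiv.symm_apply_apply]
      rw [hτ]
      generalize (Multiplicative.toAdd (e τ)).val = n
      induction n with
      | zero => simp
      | succ n ih => rw [pow_succ, AlgEquiv.mul_apply, hx, ih]
    obtain ⟨q, hq⟩ := mem_bot.mp ((IsGalois.mem_bot_iff_fixed x).mpr hall)
    exact ⟨q, by rw [← hq]; simp⟩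

section

variable {L : Type*} [Field L] [CharZero L] {σ : L ≃ₐ[ℚ] L}

lemma apply_sqrt (hσ : ∀ x, σ x = x → ∃ q : ℚ, x = q) {D : ℕ} (hD : IsQuadIndex D) {s : L}
    (hs : s ^ 2 = (D : ℤ)) : σ s = -s := by
  have h : (σ s - s) * (σ s + s) = 0 := by
    have : (σ s) ^ 2 = s ^ 2 := by rw [← map_pow, hs]; simp
    linear_combination this
  rcases mul_eq_zero.mp h with h | h
  · obtain ⟨q, rfl⟩ := hσ s (sub_eq_zero.mp h)
    exact absurd (by exact_mod_cast hs) (hD.rat_sq_ne q)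
  · linear_combination h

lemma eq_of_sqrt_of_sqrt (hσ : ∀ x, σ x = x → ∃ q : ℚ, x = q) {D D₁ : ℕ} (hD : IsQuadIndex D)
    (hD₁ : IsQuadIndex D₁) {s s₁ : L} (hs : s ^ 2 = (D : ℤ)) (hs₁ : s₁ ^ 2 = (D₁ : ℤ)) :
    D = D₁ := by
  obtain ⟨q, hq⟩ := hσ (s * s₁) (by
    rw [map_mul, apply_sqrt hσ hD hs, apply_sqrt hσ hD₁ hs₁, neg_mul_neg])
  have h : q ^ 2 = (D * D₁ : ℕ) := by
    have : (q : L) ^ 2 = (D * D₁ : ℕ) := by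
      rw [← hq, mul_pow, hs, hs₁]
      push_cast
      ring
    exact_mod_cast this
  obtain ⟨k, hk⟩ := exists_nat_sq_eq_of_rat_sq h
  exact eq_of_squarefree_of_mul_eq_sq hD.squarefree hD₁.squarefree hk

lemma IsQuarticIndex.eq_of_gen (hσ : ∀ x, σ x = x → ∃ q : ℚ, x = q) {D g u g₁ u₁ : ℕ} {ε ε₁ : ℤ}
    (h : IsQuarticIndex D g u ε) (h₁ : IsQuarticIndex D g₁ u₁ ε₁) {s w w₁ : L}
    (hs : s ^ 2 = (D : ℤ)) (hw : w ^ 2 = (ε * g * u : ℤ) * ((D : ℤ) + sqPart D * s))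
    (hw₁ : w₁ ^ 2 = (ε₁ * g₁ * u₁ : ℤ) * ((D : ℤ) + sqPart D * s)) :
    g = g₁ ∧ u = u₁ ∧ ε = ε₁ := by
  have hD := h.quad
  have hσs := apply_sqrt hσ hD hs
  obtain ⟨C, hBC, -⟩ := hD.sqPart_spec
  have hw0 : w ≠ 0 := by
    rintro rfl
    exact sqrt_notMem_adjoin hs hD.rat_sq_ne hBC hw h.mul_ne_zero (zero_mem _)
  have ht : ((ε * g * u : ℤ) : L) ≠ 0 := by exact_mod_cast h.mul_ne_zero
  have hρ : (w₁ / w) ^ 2 = (ε₁ * g₁ * u₁ : ℤ) / (ε * g * u : ℤ) := by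
    have hα : ((D : ℤ) : L) + sqPart D * s ≠ 0 := by
      intro h0
      rw [h0, mul_zero] at hw
      exact hw0 (pow_eq_zero_iff two_ne_zero |>.mp hw)
    rw [div_pow, hw, hw₁]
    field_simp
  have hε := h.sq_sign
  have hε₁ := h₁.sq_sign
  have hsqf : ∀ {g u : ℕ} {ε : ℤ}, IsQuarticIndex D g u ε → Squarefree (g * u) := fun h ↦
    (Nat.squarefree_mul (h.coprime.symm.coprime_dvd_left h.dvd)).mpr
      ⟨hD.squarefree.squarefree_of_dvd h.dvd, h.squarefree⟩
  have hgcd : ∀ {g u : ℕ} {ε : ℤ}, IsQuarticIndex D g u ε → Nat.gcd (g * u) D = g := fun h ↦ by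
    rw [Nat.Coprime.gcd_mul_right_cancel _ h.coprime, Nat.gcd_eq_left h.dvd]
  have hcases : (w₁ / w) ^ 2 = σ (w₁ / w) ^ 2 := by
    rw [← map_pow, hρ]
    simp only [map_div₀, map_intCast]
  have hfac : (σ (w₁ / w) - w₁ / w) * (σ (w₁ / w) + w₁ / w) = 0 := by
    linear_combination -hcases
  have hpos : ∀ {g u : ℕ} {ε : ℤ}, IsQuarticIndex D g u ε → 0 < (g * u : ℕ) := fun h ↦
    Nat.pos_of_ne_zero (hsqf h).ne_zero
  have hp := hpos h
  have hp₁ := hpos h₁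
  have hsign : ∀ (q : ℚ) (N : ℕ), 0 < N →
      q ^ 2 * (ε * g * u : ℤ) ^ 2 = (ε₁ * g₁ * u₁ : ℤ) * (ε * g * u : ℤ) * N →
      ε = ε₁ ∧ ∃ k : ℕ, (g₁ * u₁) * (g * u) * N = k ^ 2 := by
    intro q N hN hq
    have hεε : ε * ε₁ = 1 := by
      have : (ε * ε₁) ^ 2 = 1 := by rw [mul_pow, hε, hε₁, one_mul]
      rcases mul_self_eq_one_iff.mp (sq (ε * ε₁) ▸ this) with h | h
      · exact h
      · exfalso
        have h1 : 0 ≤ q ^ 2 * ((ε * g * u : ℤ) : ℚ) ^ 2 := by positivity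
        rw [hq] at h1
        have h2 : (((ε₁ * g₁ * u₁ : ℤ) : ℚ) * (ε * g * u : ℤ) * N) =
            -(((g * u : ℕ) : ℚ) * (g₁ * u₁ : ℕ) * N) := by
          have h' : (ε : ℚ) * ε₁ = -1 := by exact_mod_cast h
          push_cast
          linear_combination (g * u * g₁ * u₁ * N : ℚ) * h'
        rw [h2] at h1
        have : (0 : ℚ) < ((g * u : ℕ) : ℚ) * (g₁ * u₁ : ℕ) * N := by positivity
        linarith
    refine ⟨by linear_combination ε₁ * hεε - ε * hε₁, ?_⟩
    refine exists_nat_sq_eq_of_rat_sq (r := q * (ε * g * u : ℤ)) ?_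
    rw [mul_pow, hq]
    have h' : (ε : ℚ) * ε₁ = 1 := by exact_mod_cast hεε
    push_cast
    linear_combination (g * u * g₁ * u₁ * N : ℚ) * h'
  rcases mul_eq_zero.mp hfac with h0 | h0
  · obtain ⟨q, hq⟩ := hσ _ (sub_eq_zero.mp h0)
    rw [hq] at hρ
    have hqq : q ^ 2 = ((ε₁ * g₁ * u₁ : ℤ) : ℚ) / (ε * g * u : ℤ) := by exact_mod_cast hρ
    have ht' : ((ε * g * u : ℤ) : ℚ) ≠ 0 := by exact_mod_cast h.mul_ne_zero
    obtain ⟨hεeq, k, hk⟩ := hsign q 1 one_pos (by rw [hqq]; field_simp; simp)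
    have hgu := eq_of_squarefree_of_mul_eq_sq (hsqf h₁) (hsqf h) (by simpa using hk)
    have hg : g = g₁ := by rw [← hgcd h, ← hgu, hgcd h₁]
    refine ⟨hg, ?_, hεeq⟩
    rw [← hg] at hgu
    exact (Nat.eq_of_mul_eq_mul_left (Nat.pos_of_ne_zero fun h0 ↦ by simp [h0] at hp) hgu).symm
  · exfalso
    obtain ⟨q, hq⟩ := hσ (w₁ / w * s) (by
      rw [map_mul, hσs, eq_neg_of_add_eq_zero_left h0, neg_mul_neg])
    have hqq : q ^ 2 = ((ε₁ * g₁ * u₁ : ℤ) : ℚ) / (ε * g * u : ℤ) * D := by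
      have : (q : L) ^ 2 = ((ε₁ * g₁ * u₁ : ℤ) : L) / (ε * g * u : ℤ) * D := by
        rw [← hq, mul_pow, hρ, hs, Int.cast_natCast]
      exact_mod_cast this
    have ht' : ((ε * g * u : ℤ) : ℚ) ≠ 0 := by exact_mod_cast h.mul_ne_zero
    obtain ⟨-, k, hk⟩ := hsign q D hD.squarefree.ne_zero.bot_lt (by rw [hqq]; field_simp)
    have hprime := Nat.minFac_prime hD.one_lt.ne'
    obtain ⟨m, hm⟩ := D.minFac_dvd
    have hpk : D.minFac ∣ k := hprime.dvd_of_dvd_pow (hk ▸ (D.minFac_dvd.mul_left _))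
    obtain ⟨j, rfl⟩ := hpk
    have hpm : ¬ D.minFac ∣ m := by
      rintro ⟨i, hi⟩
      have := hD.squarefree D.minFac ⟨i, by rw [mul_assoc, ← hi, ← hm]⟩
      exact hprime.one_lt.ne' (Nat.isUnit_iff.mp this)
    have hpu : ∀ {g u : ℕ} {ε : ℤ}, IsQuarticIndex D g u ε → ¬ D.minFac ∣ g * u := fun h hd ↦ by
      rcases hprime.dvd_mul.mp hd with h1 | h1
      · exact h.minFac h1
      · exact hprime.one_lt.ne' (Nat.eq_one_of_dvd_coprimes h.coprime h1 D.minFac_dvd)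
    have hfin : D.minFac ∣ (g₁ * u₁) * (g * u) * m := by
      refine ⟨j ^ 2, ?_⟩
      apply Nat.eq_of_mul_eq_mul_left hprime.pos
      calc _ = (g₁ * u₁) * (g * u) * (D.minFac * m) := by ring
        _ = _ := by rw [← hm, hk]; ring
    rcases hprime.dvd_mul.mp hfin with h1 | h1
    · rcases hprime.dvd_mul.mp h1 with h1 | h1
      · exact hpu h₁ h1
      · exact hpu h h1
    · exact hpm h1

end

lemma IsQuarticIndex.quarticGen_injective {D g u D₁ g₁ u₁ : ℕ} {ε ε₁ : ℤ}
    (h : IsQuarticIndex D g u ε) (h₁ : IsQuarticIndex D₁ g₁ u₁ ε₁)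
    (hF : ℚ⟮quarticGen D g u ε⟯ = ℚ⟮quarticGen D₁ g₁ u₁ ε₁⟯) :
    D = D₁ ∧ g = g₁ ∧ u = u₁ ∧ ε = ε₁ := by
  obtain ⟨C, hBC, -⟩ := h.quad.sqPart_spec
  obtain ⟨C₁, hBC₁, -⟩ := h₁.quad.sqPart_spec
  obtain ⟨hfd, hgal, ⟨e⟩, -⟩ := h.properties
  obtain ⟨σ, -, hσ⟩ := exists_generator e
  have hsmem : csqrt (D : ℤ) ∈ ℚ⟮quarticGen D g u ε⟯ :=
    sqrt_mem_adjoin h.quad.rat_sq_ne hBC (csqrt_sq _) h.mul_ne_zero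
  have hsmem₁ : csqrt (D₁ : ℤ) ∈ ℚ⟮quarticGen D g u ε⟯ := by
    rw [hF]
    exact sqrt_mem_adjoin h₁.quad.rat_sq_ne hBC₁ (csqrt_sq _) h₁.mul_ne_zero
  have hwmem : quarticGen D g u ε ∈ ℚ⟮quarticGen D g u ε⟯ := mem_adjoin_simple_self _ _
  have hwmem₁ : quarticGen D₁ g₁ u₁ ε₁ ∈ ℚ⟮quarticGen D g u ε⟯ := by
    rw [hF]
    exact mem_adjoin_simple_self _ _
  obtain rfl : D = D₁ := by
    have := eq_of_sqrt_of_sqrt hσ h.quad h₁.quad (s := ⟨_, hsmem⟩) (s₁ := ⟨_, hsmem₁⟩)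
      (Subtype.ext (by simpa using csqrt_sq (D : ℤ)))
      (Subtype.ext (by simpa using csqrt_sq (D₁ : ℤ)))
    exact this
  refine ⟨rfl, ?_⟩
  exact h.eq_of_gen hσ h₁ (s := ⟨_, hsmem⟩) (w := ⟨_, hwmem⟩) (w₁ := ⟨_, hwmem₁⟩)
    (Subtype.ext (by simpa using csqrt_sq (D : ℤ)))
    (Subtype.ext (by simpa using quarticGen_sq _ _ _ _))
    (Subtype.ext (by simpa using quarticGen_sq _ _ _ _))

lemma exists_signed_squarefree_mul_sq {T : ℚ} (hT : T ≠ 0) :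
    ∃ (n : ℕ) (ε : ℤ) (m : ℚ), Squarefree n ∧ ε ^ 2 = 1 ∧ m ≠ 0 ∧ T = ε * n * m ^ 2 := by
  rcases lt_or_gt_of_ne hT with h | h
  · obtain ⟨n, m, hn, hm, h⟩ := exists_squarefree_mul_sq (neg_pos.mpr h)
    exact ⟨n, -1, m, hn, by norm_num, hm.ne', by push_cast; linear_combination -h⟩
  · obtain ⟨n, m, hn, hm, h⟩ := exists_squarefree_mul_sq h
    exact ⟨n, 1, m, hn, by norm_num, hm.ne', by push_cast; linear_combination h⟩

lemma IsQuadIndex.exists_index {L : Type*} [Field L] [CharZero L] {D : ℕ} (hD : IsQuadIndex D)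
    {s w α : L} (hs : s ^ 2 = (D : ℤ)) {T : ℚ} (hT : T ≠ 0) (hw : w ^ 2 = T * α) :
    ∃ (g u : ℕ) (ε : ℤ) (w' : L), IsQuarticIndex D g u ε ∧ w' ^ 2 = (ε * g * u : ℤ) * α := by
  obtain ⟨n, ε, m, hn, hε, hm, rfl⟩ := exists_signed_squarefree_mul_sq hT
  obtain ⟨u, hu⟩ := Nat.gcd_dvd_left n D
  obtain ⟨k, hk⟩ := Nat.gcd_dvd_right n D
  set g := n.gcd D with hg
  have hmL : (m : L) ≠ 0 := by exact_mod_cast hm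
  have husq : Squarefree u := hn.squarefree_of_dvd ⟨g, by rw [hu, mul_comm]⟩
  have hcop : u.Coprime D := by
    have hug : Nat.Coprime u g := by
      rw [hu, Nat.squarefree_mul_iff] at hn
      exact hn.1.symm
    have : Nat.gcd u D ∣ g := Nat.dvd_gcd ((Nat.gcd_dvd_left u D).trans ⟨g, by rw [hu, mul_comm]⟩)
      (Nat.gcd_dvd_right u D)
    exact Nat.eq_one_of_dvd_coprimes hug (Nat.gcd_dvd_left u D) this
  have hw1 : (w / m) ^ 2 = (ε * g * u : ℤ) * α := by
    rw [div_pow, hw, hu]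
    push_cast
    field_simp
  have hprime := Nat.minFac_prime hD.one_lt.ne'
  by_cases hmin : D.minFac ∣ g
  · have hk0 : ¬ D.minFac ∣ k := by
      rintro ⟨i, hi⟩
      obtain ⟨j, hj⟩ := hmin
      have := hD.squarefree D.minFac ⟨j * i, by nth_rw 1 [hk, hj, hi]; ring⟩
      exact hprime.one_lt.ne' (Nat.isUnit_iff.mp this)
    refine ⟨k, u, ε, w / m * k / s, ⟨hD, ⟨g, by rw [mul_comm]; exact hk⟩, hk0, husq, hcop, hε⟩, ?_⟩
    have hg0 : (g : L) ≠ 0 := by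
      have : g ≠ 0 := by
        rintro h0
        rw [h0, zero_mul] at hk
        exact hD.squarefree.ne_zero hk
      exact_mod_cast this
    have hk0' : (k : L) ≠ 0 := by
      have : k ≠ 0 := by
        rintro h0
        rw [h0, mul_zero] at hk
        exact hD.squarefree.ne_zero hk
      exact_mod_cast this
    have hDL : ((D : ℤ) : L) = g * k := by
      have : ((D : ℕ) : L) = ((g * k : ℕ) : L) := by rw [← hk]
      push_cast at this ⊢
      exact this
    rw [div_pow, mul_pow, hw1, hs, hDL]
    push_cast
    field_simp
  · exact ⟨g, u, ε, w / m, ⟨hD, ⟨k, hk⟩, hmin, husq, hcop, hε⟩, hw1⟩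

lemma exists_index_of_cyclic {L : Type*} [Field L] [CharZero L] [FiniteDimensional ℚ L]
    [IsGalois ℚ L] (e : (L ≃ₐ[ℚ] L) ≃* Multiplicative (ZMod 4)) :
    ∃ (D g u : ℕ) (ε : ℤ) (s w : L), IsQuarticIndex D g u ε ∧ s ^ 2 = (D : ℤ) ∧
      w ^ 2 = (ε * g * u : ℤ) * ((D : ℤ) + sqPart D * s) := by
  obtain ⟨σ, hord, hσ⟩ := exists_generator e
  have h4 : ∀ x, σ (σ (σ (σ x))) = x := by
    intro x
    have := DFunLike.congr_fun (hord ▸ pow_orderOf_eq_one σ) x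
    simpa [pow_succ] using this
  obtain ⟨z, hz⟩ : ∃ z, σ (σ z) ≠ z := by
    by_contra! h
    have h2 : σ ^ 2 = 1 := AlgEquiv.ext fun x ↦ by simpa [pow_succ] using h x
    have := orderOf_dvd_of_pow_eq_one h2
    rw [hord] at this
    norm_num at this
  set x := z - σ (σ z) with hxdef
  have hx0 : x ≠ 0 := sub_ne_zero.mpr hz.symm
  have hσx : σ (σ x) = -x := by
    rw [hxdef, map_sub, map_sub, h4]
    ring
  have hσx0 : σ x ≠ 0 := by simpa using hx0
  set y := x * σ x with hydef
  have hy0 : y ≠ 0 := mul_ne_zero hx0 hσx0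
  have hσy : σ y = -y := by
    rw [hydef, map_mul, hσx]
    ring
  have hynot : ∀ r : ℚ, y ≠ r := by
    rintro r hr
    have := hσy
    rw [hr, map_ratCast, ← hr] at this
    exact hy0 (self_eq_neg.mp this)
  obtain ⟨q, hq⟩ := hσ (y ^ 2) (by rw [map_pow, hσy, neg_sq])
  obtain ⟨a, ha⟩ := hσ ((x ^ 2 + σ x ^ 2) / 2) (by
    simp only [map_div₀, map_add, map_pow, hσx, map_ofNat, neg_sq]
    ring)
  obtain ⟨b, hb⟩ := hσ ((x ^ 2 - σ x ^ 2) / (2 * y)) (by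
    simp only [map_div₀, map_sub, map_mul, map_pow, hσx, hσy, map_ofNat, neg_sq]
    field_simp
    ring)
  have hβ : x ^ 2 = a + b * y := by
    rw [← ha, ← hb]
    field_simp
    ring
  have hσβ : σ x ^ 2 = a - b * y := by
    rw [← ha, ← hb]
    field_simp
    ring
  have hqab : q * (1 + b ^ 2) = a ^ 2 := by
    have : (q : L) * (1 + b ^ 2) = a ^ 2 := by
      have h1 : x ^ 2 * σ x ^ 2 = y ^ 2 := by rw [hydef]; ring
      rw [hβ, hσβ] at h1
      linear_combination (-1 - (b : L) ^ 2) * hq - h1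
    exact_mod_cast this
  have hq0 : q ≠ 0 := by
    rintro rfl
    rw [Rat.cast_zero] at hq
    exact hy0 (pow_eq_zero_iff two_ne_zero |>.mp hq)
  have hqpos : 0 < q := by
    by_contra! hneg
    have h1 : 0 ≤ a ^ 2 := sq_nonneg a
    have h2 : q < 0 := lt_of_le_of_ne hneg hq0
    nlinarith [sq_nonneg b]
  obtain ⟨D, r, hDsq, hr, hqD⟩ := exists_squarefree_mul_sq hqpos
  have hD1 : 1 < D := by
    by_contra! h
    have hD1 : D = 1 := by have := hDsq.ne_zero; omega
    rw [hD1, Nat.cast_one, one_mul] at hqD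
    have h1 : (y - r) * (y + r) = 0 := by
      have : y ^ 2 = (r : L) ^ 2 := by rw [hq, hqD]; push_cast; ring
      linear_combination this
    rcases mul_eq_zero.mp h1 with h | h
    · exact hynot r (sub_eq_zero.mp h)
    · exact hynot (-r) (by push_cast; exact eq_neg_of_add_eq_zero_left h)
  have hb1 : (1 + b ^ 2) ≠ 0 := by positivity
  have hD : IsQuadIndex D := by
    refine isQuadIndex_of_rat hDsq hD1 (a := a / (r * (1 + b ^ 2)))
      (b := a / (r * (1 + b ^ 2)) * b) ?_
    have : (D : ℚ) * r ^ 2 * (1 + b ^ 2) = a ^ 2 := by rw [← hqD, hqab]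
    field_simp
    linear_combination this
  have hrL : (r : L) ≠ 0 := by exact_mod_cast hr.ne'
  obtain ⟨C, hBC, -⟩ := hD.sqPart_spec
  have hC := (ne_zero_of_not_square hD.rat_sq_ne hBC).2
  set s := y / r with hsdef
  have hys : y = r * s := by rw [hsdef]; field_simp
  have hs : s ^ 2 = (D : ℤ) := by
    rw [hsdef, div_pow, hq, hqD]
    push_cast
    field_simp
  have hσs : σ s = -s := by
    rw [hsdef, map_div₀, hσy, map_ratCast, neg_div]
  set α := ((D : ℤ) : L) + sqPart D * s with hα
  have hσα : σ α = (D : ℤ) - sqPart D * s := by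
    rw [hα, map_add, map_mul, hσs, map_intCast, map_intCast]
    ring
  have hBCL : ((D : ℤ) : L) = sqPart D ^ 2 + C ^ 2 := by exact_mod_cast hBC
  have hαα : α * σ α = (D : ℤ) * C ^ 2 := by
    rw [hσα, hα]
    linear_combination -(sqPart D : L) ^ 2 * hs + (D : ℤ) * hBCL
  have hqL : y ^ 2 = ((D : ℤ) : L) * r ^ 2 := by rw [hys, mul_pow, hs]; ring
  obtain ⟨ρ, hρ, hρ0⟩ : ∃ ρ : ℚ, (ρ : L) ^ 2 = (r * (D : ℤ) * C) ^ 2 ∧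
      x ^ 2 * α + σ x ^ 2 * σ α + 2 * ρ ≠ 0 := by
    have hne : (r * (D : ℤ) * C : ℚ) ≠ 0 := by
      have : ((D : ℤ) : ℚ) ≠ 0 := by exact_mod_cast hDsq.ne_zero
      have : (C : ℚ) ≠ 0 := by exact_mod_cast hC
      positivity
    by_cases h : x ^ 2 * α + σ x ^ 2 * σ α + 2 * ((r * (D : ℤ) * C : ℚ) : L) = 0
    · refine ⟨-(r * (D : ℤ) * C), by push_cast; ring, fun h' ↦ ?_⟩
      have : 4 * ((r * (D : ℤ) * C : ℚ) : L) = 0 := by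
        push_cast at h h' ⊢
        linear_combination h - h'
      have : (4 * (r * (D : ℤ) * C) : ℚ) = 0 := by exact_mod_cast this
      exact hne (by linarith)
    · exact ⟨r * (D : ℤ) * C, by push_cast; ring, h⟩
  obtain ⟨T, hT⟩ := hσ (x ^ 2 * α + σ x ^ 2 * σ α + 2 * ρ) (by
    have : σ (σ α) = α := by
      rw [hσα, map_sub, map_mul, hσs, map_intCast, map_intCast, hα]
      ring
    simp only [map_add, map_mul, map_pow, hσx, map_ofNat, neg_sq, map_ratCast, this]
    ring)
  have hT0 : T ≠ 0 := by
    rintro rfl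
    exact hρ0 (by rw [hT, Rat.cast_zero])
  have hγγ : x ^ 2 * α * (σ x ^ 2 * σ α) = (ρ : L) ^ 2 := by
    rw [hρ]
    have h1 : x ^ 2 * σ x ^ 2 = y ^ 2 := by rw [hydef]; ring
    linear_combination (α * σ α) * h1 + y ^ 2 * hαα + (D : ℤ) * C ^ 2 * hqL
  obtain ⟨g, u, ε, w, hidx, hw⟩ := hD.exists_index (α := α) hs hT0
    (w := (x ^ 2 * α + ρ) / x) (by
      rw [← hT, div_pow]
      field_simp
      linear_combination -hγγ)
  exact ⟨D, g, u, ε, s, w, hidx, hs, hw⟩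

lemma exists_quarticGen (F : IntermediateField ℚ (AlgebraicClosure ℚ)) [FiniteDimensional ℚ F]
    [IsGalois ℚ F] (e : (F ≃ₐ[ℚ] F) ≃* Multiplicative (ZMod 4)) :
    ∃ (D g u : ℕ) (ε : ℤ), IsQuarticIndex D g u ε ∧ F = ℚ⟮quarticGen D g u ε⟯ := by
  obtain ⟨D, g, u, ε, s, w, h, hs, hw⟩ := exists_index_of_cyclic e
  refine ⟨D, g, u, ε, h, ?_⟩
  obtain ⟨C, hBC, -⟩ := h.quad.sqPart_spec
  have hs' : (s : AlgebraicClosure ℚ) ^ 2 = (D : ℤ) := by simpa using congrArg Subtype.val hs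
  have hw' : (w : AlgebraicClosure ℚ) ^ 2 = (ε * g * u : ℤ) * ((D : ℤ) + sqPart D * s) := by
    simpa using congrArg Subtype.val hw
  rw [← adjoin_eq_of_conj hs' h.quad.rat_sq_ne hBC hw' h.mul_ne_zero (csqrt_sq _)
    (quarticGen_sq D g u ε)]
  symm
  apply eq_of_le_of_finrank_eq
  · rw [adjoin_simple_le_iff]
    exact w.2
  · rw [finrank_adjoin_eq_four hs' h.quad.rat_sq_ne hBC hw' h.mul_ne_zero,
      ← IsGalois.card_aut_eq_finrank, Nat.card_congr e.toEquiv]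
    simp

lemma galoisCount_eq_card_index (X : ℝ) :
    galoisCount (Multiplicative (ZMod 4)) X = Nat.card {i : ℕ × ℕ × ℕ × ℤ //
      IsQuarticIndex i.1 i.2.1 i.2.2.1 i.2.2.2 ∧
        (quarticDisc i.1 (sqPart i.1) i.2.1 i.2.2.2 i.2.2.1 : ℝ) ≤ X} := by
  symm
  refine Nat.card_congr (Equiv.ofBijective (fun i ↦
    ⟨ℚ⟮quarticGen i.1.1 i.1.2.1 i.1.2.2.1 i.1.2.2.2⟯, ?_⟩) ⟨?_, ?_⟩)
  · obtain ⟨h1, h2, h3, h4⟩ := i.2.1.properties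
    refine ⟨h1, h2, h3, ?_⟩
    have h5 := i.2.2
    rw [← h4, Int.cast_natCast] at h5
    exact h5
  · rintro ⟨⟨D, g, u, ε⟩, h, _⟩ ⟨⟨D₁, g₁, u₁, ε₁⟩, h₁, _⟩ h_eq
    obtain ⟨rfl, rfl, rfl, rfl⟩ := h.quarticGen_injective h₁ (Subtype.ext_iff.mp h_eq)
    rfl
  · rintro ⟨F, h1, h2, ⟨e⟩, h4⟩
    obtain ⟨D, g, u, ε, h, rfl⟩ := exists_quarticGen F e
    refine ⟨⟨⟨D, g, u, ε⟩, h, ?_⟩, rfl⟩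
    rw [← h.properties.2.2.2, Int.cast_natCast]
    exact h4

end C4Count

namespace C4Count

open Filter Topology Finset

lemma exists_abs_sub_le_of_telescoping {u b : ℕ → ℝ}
    (h : ∀ n, 1 ≤ n → |u (n + 1) - u n| ≤ b n - b (n + 1)) (hb : Tendsto b atTop (𝓝 0)) :
    ∃ z, ∀ n, 1 ≤ n → |u n - z| ≤ b n := by
  have hanti : ∀ n m, 1 ≤ n → n ≤ m → |u m - u n| ≤ b n - b m := by
    intro n m hn hnm
    induction m, hnm using Nat.le_induction with
    | base => simp
    | succ m hm ih =>
      have := h m (hn.trans hm)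
      have h3 := abs_sub_le (u (m + 1)) (u m) (u n)
      linarith
  have hb0 : ∀ n, 1 ≤ n → 0 ≤ b n := by
    intro n hn
    refine le_of_tendsto hb (eventually_atTop.mpr ⟨n, fun m hm ↦ ?_⟩)
    have := (abs_nonneg _).trans (hanti n m hn hm)
    linarith
  have hcauchy : CauchySeq fun n ↦ u (n + 1) := by
    refine cauchySeq_of_le_tendsto_0 (fun n ↦ b (n + 1)) (fun n m N hn hm ↦ ?_)
      (hb.comp (tendsto_add_atTop_nat 1))
    wlog hnm : n ≤ m generalizing n m
    · rw [dist_comm]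
      exact this m n hm hn (by omega)
    rw [dist_comm, Real.dist_eq]
    have h1 := hanti (n + 1) (m + 1) (by omega) (by omega)
    have h2 := hb0 (m + 1) (by omega)
    have h3 := (abs_nonneg _).trans (hanti (N + 1) (n + 1) (by omega) (by omega))
    linarith
  obtain ⟨z, hz⟩ := cauchySeq_tendsto_of_complete hcauchy
  have hz' : Tendsto u atTop (𝓝 z) := (tendsto_add_atTop_iff_nat 1).mp hz
  refine ⟨z, fun n hn ↦ ?_⟩
  rw [abs_sub_comm]
  refine le_of_tendsto ((hz'.sub_const (u n)).abs) (eventually_atTop.mpr ⟨n, fun m hm ↦ ?_⟩)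
  have := hanti n m hn hm
  have := hb0 m (hn.trans hm)
  linarith

lemma rpow_sub_bounds {s a b : ℝ} (hs : 0 < s) (hs1 : s ≠ 1) (ha : 0 < a) (hab : a ≤ b) :
    b ^ (-s) * (b - a) ≤ b ^ (1 - s) / (1 - s) - a ^ (1 - s) / (1 - s) ∧
      b ^ (1 - s) / (1 - s) - a ^ (1 - s) / (1 - s) ≤ a ^ (-s) * (b - a) := by
  rcases hab.eq_or_lt with rfl | hlt
  · simp
  have hs1' : 1 - s ≠ 0 := sub_ne_zero.mpr hs1.symm
  have hderiv : ∀ t : ℝ, 0 < t → HasDerivAt (fun t : ℝ ↦ t ^ (1 - s) / (1 - s)) (t ^ (-s)) t := by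
    intro t ht
    have := (Real.hasDerivAt_rpow_const (x := t) (p := 1 - s) (Or.inl ht.ne')).div_const (1 - s)
    rwa [show 1 - s - 1 = -s by ring, mul_div_cancel_left₀ _ hs1'] at this
  obtain ⟨c, hc, hcs⟩ := exists_hasDerivAt_eq_slope (fun t : ℝ ↦ t ^ (1 - s) / (1 - s))
    (fun t ↦ t ^ (-s)) hlt
    (fun t ht ↦ (hderiv t (ha.trans_le ht.1)).continuousAt.continuousWithinAt)
    (fun t ht ↦ hderiv t (ha.trans ht.1))
  have hba : 0 < b - a := sub_pos.mpr hlt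
  rw [eq_div_iff hba.ne'] at hcs
  rw [← hcs]
  constructor
  · exact mul_le_mul_of_nonneg_right
      (Real.rpow_le_rpow_of_nonpos (ha.trans hc.1) hc.2.le (by linarith)) hba.le
  · exact mul_le_mul_of_nonneg_right
      (Real.rpow_le_rpow_of_nonpos ha hc.1.le (by linarith)) hba.le

lemma half_le_floor {x : ℝ} (hx : 1 ≤ x) : x / 2 ≤ (⌊x⌋₊ : ℝ) := by
  have h1 := Nat.lt_floor_add_one x
  have h2 : (1 : ℝ) ≤ ⌊x⌋₊ := by exact_mod_cast Nat.le_floor (by simpa using hx)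
  linarith

lemma floor_rpow_neg_le {s x : ℝ} (hs : 0 < s) (hx : 1 ≤ x) :
    (⌊x⌋₊ : ℝ) ^ (-s) ≤ 2 ^ s * x ^ (-s) := by
  calc (⌊x⌋₊ : ℝ) ^ (-s) ≤ (x / 2) ^ (-s) :=
        Real.rpow_le_rpow_of_nonpos (by linarith) (half_le_floor hx) (by linarith)
    _ = 2 ^ s * x ^ (-s) := by
      rw [Real.div_rpow (by linarith) (by norm_num), Real.rpow_neg (by norm_num : (0:ℝ) ≤ 2),
        div_inv_eq_mul, mul_comm]

lemma sum_rpow_neg {s : ℝ} (hs : 0 < s) (hs1 : s ≠ 1) :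
    ∃ z C : ℝ, 0 ≤ C ∧ ∀ x : ℝ, 1 ≤ x →
      |∑ n ∈ Ioc 0 ⌊x⌋₊, (n : ℝ) ^ (-s) - x ^ (1 - s) / (1 - s) - z| ≤ C * x ^ (-s) := by
  obtain ⟨z, hz⟩ := exists_abs_sub_le_of_telescoping
    (u := fun N ↦ ∑ n ∈ Ioc 0 N, (n : ℝ) ^ (-s) - (N : ℝ) ^ (1 - s) / (1 - s))
    (b := fun N ↦ (N : ℝ) ^ (-s)) (fun n hn ↦ by
      have hn' : (0 : ℝ) < n := by exact_mod_cast hn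
      obtain ⟨h1, h2⟩ := rpow_sub_bounds hs hs1 hn' (b := (n + 1 : ℕ)) (by push_cast; linarith)
      rw [sum_Ioc_succ_top (by omega), abs_le]
      push_cast at h1 h2 ⊢
      constructor <;> linarith)
    ((tendsto_rpow_neg_atTop hs).comp tendsto_natCast_atTop_atTop)
  refine ⟨z, 2 * 2 ^ s, by positivity, fun x hx ↦ ?_⟩
  have hN : 1 ≤ ⌊x⌋₊ := Nat.le_floor (by simpa using hx)
  have hN' : (0 : ℝ) < ⌊x⌋₊ := by exact_mod_cast hN
  have h1 := hz _ hN
  obtain ⟨h2, h3⟩ := rpow_sub_bounds hs hs1 hN' (Nat.floor_le (by linarith))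
  have h4 := floor_rpow_neg_le hs hx
  have h5 := Nat.lt_floor_add_one x
  have h6 := Nat.floor_le (show 0 ≤ x by linarith)
  have h7 : 0 ≤ x ^ (-s) * (x - ⌊x⌋₊) := mul_nonneg (by positivity) (by linarith)
  have h8 : (⌊x⌋₊ : ℝ) ^ (-s) * (x - ⌊x⌋₊) ≤ (⌊x⌋₊ : ℝ) ^ (-s) * 1 :=
    mul_le_mul_of_nonneg_left (by linarith) (by positivity)
  rw [abs_le] at h1 ⊢
  constructor <;> linarith

lemma sum_mul_rpow_neg {e : ℕ → ℝ} {A θ s : ℝ} (hθ : 0 ≤ θ) (hs : θ < s)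
    (hE : ∀ N : ℕ, 1 ≤ N → |∑ n ∈ Ioc 0 N, e n| ≤ A * (N : ℝ) ^ θ) :
    ∃ z C : ℝ, 0 ≤ C ∧ ∀ x : ℝ, 1 ≤ x →
      |∑ n ∈ Ioc 0 ⌊x⌋₊, e n * (n : ℝ) ^ (-s) - z| ≤ C * x ^ (θ - s) := by
  have hs0 : 0 < s := hθ.trans_lt hs
  have hA : 0 ≤ A := by
    have := (abs_nonneg _).trans (hE 1 le_rfl)
    simpa using this
  set B : ℝ := A * s / (s - θ) with hB
  have hB0 : 0 ≤ B := div_nonneg (mul_nonneg hA hs0.le) (by linarith)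
  obtain ⟨z, hz⟩ := exists_abs_sub_le_of_telescoping
    (u := fun N ↦ ∑ n ∈ Ioc 0 N, e n * (n : ℝ) ^ (-s)
      - (∑ n ∈ Ioc 0 N, e n) * ((N + 1 : ℕ) : ℝ) ^ (-s))
    (b := fun N ↦ B * (N : ℝ) ^ (θ - s)) (fun n hn ↦ by
      have hn' : (0 : ℝ) < n := by exact_mod_cast hn
      obtain ⟨-, h2⟩ := rpow_sub_bounds (s := s + 1) (by linarith) (by linarith)
        (show (0 : ℝ) < ((n + 1 : ℕ) : ℝ) by positivity) (b := (n + 2 : ℕ)) (by push_cast; linarith)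
      obtain ⟨h3, -⟩ := rpow_sub_bounds (s := s - θ + 1) (by linarith) (by linarith)
        hn' (b := (n + 1 : ℕ)) (by push_cast; linarith)
      rw [show 1 - (s + 1) = -s by ring] at h2
      rw [show 1 - (s - θ + 1) = -(s - θ) by ring, show -(s - θ + 1) = θ + -(s + 1) by ring,
        Real.rpow_add (by positivity)] at h3
      have h4 := hE (n + 1) (by omega)
      have hmono : ((n + 2 : ℕ) : ℝ) ^ (-s) ≤ ((n + 1 : ℕ) : ℝ) ^ (-s) :=
        Real.rpow_le_rpow_of_nonpos (by positivity) (by push_cast; linarith) (by linarith)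
      have h5 : ((n + 1 : ℕ) : ℝ) ^ (-s) - ((n + 2 : ℕ) : ℝ) ^ (-s)
          ≤ s * ((n + 1 : ℕ) : ℝ) ^ (-(s + 1)) := by
        have h6 : ((n + 2 : ℕ) : ℝ) - ((n + 1 : ℕ) : ℝ) = 1 := by push_cast; ring
        rw [h6, mul_one, div_neg, div_neg, ← neg_sub_neg, neg_neg, neg_neg, ← sub_div,
          div_le_iff₀ hs0] at h2
        linarith
      have h6 : ((n + 1 : ℕ) : ℝ) ^ θ * ((n + 1 : ℕ) : ℝ) ^ (-(s + 1)) * (s - θ)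
          ≤ (n : ℝ) ^ (θ - s) - ((n + 1 : ℕ) : ℝ) ^ (θ - s) := by
        have h6 : ((n + 1 : ℕ) : ℝ) - (n : ℝ) = 1 := by push_cast; ring
        rw [h6, mul_one, div_neg, div_neg, ← neg_sub_neg, neg_neg, neg_neg, ← sub_div,
          le_div_iff₀ (by linarith)] at h3
        simpa [neg_sub] using h3
      rw [sum_Ioc_succ_top (by omega), sum_Ioc_succ_top (by omega)]
      rw [sum_Ioc_succ_top (by omega)] at h4
      calc _ = |(∑ k ∈ Ioc 0 n, e k + e (n + 1)) *
            (((n + 1 : ℕ) : ℝ) ^ (-s) - ((n + 2 : ℕ) : ℝ) ^ (-s))| := by congr 1; ring_nf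
        _ ≤ (A * ((n + 1 : ℕ) : ℝ) ^ θ) * (s * ((n + 1 : ℕ) : ℝ) ^ (-(s + 1))) := by
          rw [abs_mul, abs_of_nonneg (sub_nonneg.mpr hmono)]
          exact mul_le_mul h4 h5 (sub_nonneg.mpr hmono) (by positivity)
        _ = B * (((n + 1 : ℕ) : ℝ) ^ θ * ((n + 1 : ℕ) : ℝ) ^ (-(s + 1)) * (s - θ)) := by
          rw [hB]
          have : s - θ ≠ 0 := by linarith
          field_simp
        _ ≤ B * ((n : ℝ) ^ (θ - s) - ((n + 1 : ℕ) : ℝ) ^ (θ - s)) :=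
          mul_le_mul_of_nonneg_left h6 hB0
        _ = _ := by ring)
    (by
      have := ((tendsto_rpow_neg_atTop (y := s - θ) (by linarith)).comp
        tendsto_natCast_atTop_atTop).const_mul B
      simpa [neg_sub, Function.comp_def] using this)
  refine ⟨z, (A + B) * 2 ^ (s - θ), by positivity, fun x hx ↦ ?_⟩
  have hN : 1 ≤ ⌊x⌋₊ := Nat.le_floor (by simpa using hx)
  have hN' : (0 : ℝ) < ⌊x⌋₊ := by exact_mod_cast hN
  have h1 := hz _ hN
  have h4 := floor_rpow_neg_le (s := s - θ) (by linarith) hx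
  have h5 : |(∑ n ∈ Ioc 0 ⌊x⌋₊, e n) * ((⌊x⌋₊ + 1 : ℕ) : ℝ) ^ (-s)|
      ≤ A * (⌊x⌋₊ : ℝ) ^ (θ - s) := by
    rw [abs_mul, abs_of_nonneg (by positivity : (0:ℝ) ≤ ((⌊x⌋₊ + 1 : ℕ) : ℝ) ^ (-s)),
      sub_eq_add_neg, Real.rpow_add hN', ← mul_assoc]
    exact mul_le_mul (hE _ hN) (Real.rpow_le_rpow_of_nonpos hN' (by push_cast; linarith)
      (by linarith)) (by positivity) (by positivity)
  rw [neg_sub] at h4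
  calc _ = |(∑ n ∈ Ioc 0 ⌊x⌋₊, e n * (n : ℝ) ^ (-s)
      - (∑ n ∈ Ioc 0 ⌊x⌋₊, e n) * ((⌊x⌋₊ + 1 : ℕ) : ℝ) ^ (-s) - z)
      + (∑ n ∈ Ioc 0 ⌊x⌋₊, e n) * ((⌊x⌋₊ + 1 : ℕ) : ℝ) ^ (-s)| := by congr 1; ring
    _ ≤ B * (⌊x⌋₊ : ℝ) ^ (θ - s) + A * (⌊x⌋₊ : ℝ) ^ (θ - s) :=
      (abs_add_le _ _).trans (add_le_add h1 h5)
    _ = (A + B) * (⌊x⌋₊ : ℝ) ^ (θ - s) := by ring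
    _ ≤ (A + B) * (2 ^ (s - θ) * x ^ (θ - s)) :=
      mul_le_mul_of_nonneg_left h4 (by positivity)
    _ = _ := by ring

/-- The Dirichlet hyperbola method for a relation `P`. -/
lemma sum_hyperbola (α β : ℕ → ℝ) (P : ℕ → ℕ → Prop)
    [∀ a b, Decidable (P a b)] {N A M : ℕ} (hA : A ≤ N) (hM : M ≤ N)
    (h1 : ∀ a b, 0 < a → 0 < b → P a b → a ≤ A ∨ b ≤ M)
    (h2 : ∀ a b, 0 < a → 0 < b → a ≤ A → b ≤ M → P a b) :
    ∑ x ∈ Ioc 0 N ×ˢ Ioc 0 N with P x.1 x.2, α x.1 * β x.2 =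
      ∑ a ∈ Ioc 0 A, α a * ∑ b ∈ Ioc 0 N with P a b, β b
      + ∑ b ∈ Ioc 0 M, β b * ∑ a ∈ Ioc 0 N with P a b, α a
      - (∑ a ∈ Ioc 0 A, α a) * ∑ b ∈ Ioc 0 M, β b := by
  have e1 : ∑ a ∈ Ioc 0 A, α a * ∑ b ∈ Ioc 0 N with P a b, β b
      = ∑ x ∈ Ioc 0 N ×ˢ Ioc 0 N, if P x.1 x.2 ∧ x.1 ≤ A then α x.1 * β x.2 else 0 := by
    rw [sum_product, ← sum_subset (Ioc_subset_Ioc_right hA)]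
    · refine sum_congr rfl fun a ha ↦ ?_
      simp [mul_sum, sum_filter, (mem_Ioc.mp ha).2]
    · intro a ha ha'
      have : ¬ a ≤ A := by simp at ha ha'; omega
      simp [this]
  have e2 : ∑ b ∈ Ioc 0 M, β b * ∑ a ∈ Ioc 0 N with P a b, α a
      = ∑ x ∈ Ioc 0 N ×ˢ Ioc 0 N, if P x.1 x.2 ∧ x.2 ≤ M then α x.1 * β x.2 else 0 := by
    rw [sum_product_right, ← sum_subset (Ioc_subset_Ioc_right hM)]
    · refine sum_congr rfl fun a ha ↦ ?_
      simp [mul_sum, sum_filter, (mem_Ioc.mp ha).2, mul_comm]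
    · intro a ha ha'
      have : ¬ a ≤ M := by simp at ha ha'; omega
      simp [this]
  have e3 : (∑ a ∈ Ioc 0 A, α a) * ∑ b ∈ Ioc 0 M, β b
      = ∑ x ∈ Ioc 0 N ×ˢ Ioc 0 N, if x.1 ≤ A ∧ x.2 ≤ M then α x.1 * β x.2 else 0 := by
    rw [sum_mul_sum, ← sum_product', ← sum_filter]
    refine sum_congr ?_ fun _ _ ↦ rfl
    ext x
    simp only [mem_product, mem_Ioc, mem_filter]
    omega
  rw [e1, e2, e3, sum_filter, ← sum_add_distrib, ← sum_sub_distrib]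
  refine sum_congr rfl fun x hx ↦ ?_
  simp only [mem_product, mem_Ioc] at hx
  have h1 := h1 x.1 x.2 hx.1.1 hx.2.1
  have h2 := h2 x.1 x.2 hx.1.1 hx.2.1
  by_cases hP : P x.1 x.2 <;> by_cases ha : x.1 ≤ A <;> by_cases hb : x.2 ≤ M <;>
    simp_all

/-- The nontrivial Dirichlet character modulo `4`, as an arithmetic function. -/
noncomputable def chi : ArithmeticFunction ℝ := ⟨fun n ↦ (ZMod.χ₄ (n : ZMod 4) : ℝ), by simp⟩

/-- The constant function `1`, as an arithmetic function. -/
noncomputable def zt : ArithmeticFunction ℝ := ((ArithmeticFunction.zeta : ArithmeticFunction ℕ) :)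

lemma chi_apply (n : ℕ) : chi n = (ZMod.χ₄ (n : ZMod 4) : ℝ) := rfl

lemma chi_eq (n : ℕ) :
    chi n = if n % 2 = 0 then 0 else if n % 4 = 1 then 1 else -1 := by
  rw [chi_apply, ZMod.χ₄_nat_eq_if_mod_four]
  split_ifs <;> simp

lemma chi_isMultiplicative : chi.IsMultiplicative := by
  refine ⟨by simp [chi_apply], fun {m n} _ ↦ ?_⟩
  rw [chi_apply, Nat.cast_mul, map_mul, Int.cast_mul, chi_apply, chi_apply]

lemma chi_pow (p k : ℕ) : chi (p ^ k) = chi p ^ k := by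
  rw [chi_apply, Nat.cast_pow, map_pow, Int.cast_pow, chi_apply]

lemma zt_apply {n : ℕ} (hn : n ≠ 0) : zt n = 1 := by simp [zt, hn]

lemma zt_isMultiplicative : zt.IsMultiplicative :=
  ArithmeticFunction.isMultiplicative_zeta.natCast

lemma sum_chi (N : ℕ) :
    ∑ n ∈ Ioc 0 N, chi n = if N % 4 = 1 ∨ N % 4 = 2 then 1 else 0 := by
  induction N with
  | zero => simp
  | succ N ih =>
    rw [sum_Ioc_succ_top (by omega), ih, chi_eq]
    have : N % 4 = 0 ∨ N % 4 = 1 ∨ N % 4 = 2 ∨ N % 4 = 3 := by omega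
    rcases this with h | h | h | h
    · have h1 : (N + 1) % 4 = 1 := by omega
      have h2 : (N + 1) % 2 = 1 := by omega
      simp [h, h1, h2]
    · have h1 : (N + 1) % 4 = 2 := by omega
      have h2 : (N + 1) % 2 = 0 := by omega
      simp [h, h1, h2]
    · have h1 : (N + 1) % 4 = 3 := by omega
      have h2 : (N + 1) % 2 = 1 := by omega
      simp [h, h1, h2]
    · have h1 : (N + 1) % 4 = 0 := by omega
      have h2 : (N + 1) % 2 = 0 := by omega
      simp [h, h1, h2]

lemma abs_sum_chi_le (N : ℕ) : |∑ n ∈ Ioc 0 N, chi n| ≤ 1 := by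
  rw [sum_chi]
  split_ifs <;> simp

lemma abs_chi_le (n : ℕ) : |chi n| ≤ 1 := by
  rw [chi_eq]
  split_ifs <;> simp

lemma nonneg_of_isMultiplicative {f : ArithmeticFunction ℝ} (hf : f.IsMultiplicative)
    (h : ∀ p k : ℕ, p.Prime → 0 ≤ f (p ^ k)) (n : ℕ) : 0 ≤ f n := by
  rcases eq_or_ne n 0 with rfl | hn
  · simp
  rw [hf.multiplicative_factorization f hn]
  exact prod_nonneg fun p hp ↦ h _ _ (Nat.prime_of_mem_primeFactors hp)

/-- The number of representations of `n` as a sum of two squares, divided by `4`. -/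
noncomputable def rr : ArithmeticFunction ℝ := chi * zt

lemma rr_isMultiplicative : rr.IsMultiplicative := chi_isMultiplicative.mul zt_isMultiplicative

lemma rr_nonneg (n : ℕ) : 0 ≤ rr n := by
  refine nonneg_of_isMultiplicative rr_isMultiplicative (fun p k hp ↦ ?_) n
  rw [rr, zt, ArithmeticFunction.coe_mul_zeta_apply, Nat.sum_divisors_prime_pow hp]
  simp only [chi_pow]
  have : chi p = 0 ∨ chi p = 1 ∨ chi p = -1 := by
    rw [chi_eq]
    split_ifs <;> simp
  rcases this with h | h | h
  · exact sum_nonneg fun i _ ↦ by rw [h]; positivity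
  · exact sum_nonneg fun i _ ↦ by rw [h]; positivity
  · rw [h, neg_one_geom_sum]
    split_ifs <;> simp

lemma filter_mul_le {N a : ℕ} (ha : 0 < a) :
    (Ioc 0 N).filter (fun b ↦ a * b ≤ N) = Ioc 0 (N / a) := by
  ext b
  simp only [mem_filter, mem_Ioc, Nat.le_div_iff_mul_le ha, mul_comm b a]
  constructor
  · tauto
  · exact fun h ↦ ⟨⟨h.1, (Nat.le_mul_of_pos_left b ha).trans h.2⟩, h.2⟩

lemma sum_zt (N : ℕ) : ∑ n ∈ Ioc 0 N, zt n = N := by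
  rw [sum_congr rfl fun n hn ↦ zt_apply (by simp at hn; omega)]
  simp

lemma rpow_half_eq_sqrt (x : ℝ) : x ^ ((1 : ℝ) / 2) = √x := (Real.sqrt_eq_rpow x).symm

lemma sum_rr : ∃ l C : ℝ, 0 ≤ C ∧ ∀ x : ℝ, 1 ≤ x →
    |∑ n ∈ Ioc 0 ⌊x⌋₊, rr n - l * x| ≤ C * x ^ ((1 : ℝ) / 2) := by
  obtain ⟨l, C, hC, h⟩ := sum_mul_rpow_neg (e := chi) (A := 1) (θ := 0) (s := 1) le_rfl one_pos
    (fun N _ ↦ by simpa using abs_sum_chi_le N)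
  refine ⟨l, 3 * C + 3 + |l|, by positivity, fun x hx ↦ ?_⟩
  set N := ⌊x⌋₊ with hN
  set S := N.sqrt with hS
  have hN1 : 1 ≤ N := Nat.le_floor (by simpa using hx)
  have hS1 : 1 ≤ S := Nat.le_sqrt'.mpr (by simpa using hN1)
  have hSN : S ≤ N := Nat.sqrt_le_self N
  have hS2 : S * S ≤ N := Nat.sqrt_le N
  have hS3 : N ≤ S * S + S + S := Nat.sqrt_le_add N
  rw [rr, ArithmeticFunction.sum_Ioc_mul_eq_sum_prod_filter,
    sum_hyperbola chi zt (fun a b ↦ a * b ≤ N) hSN hSN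
    (fun a b _ _ hab ↦ by
      by_contra! hlt
      have := Nat.mul_le_mul (Nat.succ_le_of_lt hlt.1) (Nat.succ_le_of_lt hlt.2)
      have h6 : N < (S + 1) * (S + 1) := Nat.sqrt_lt.mp (Nat.lt_succ_self _)
      simp only [Nat.succ_eq_add_one] at *
      omega)
    (fun a b _ _ ha hb ↦ (Nat.mul_le_mul ha hb).trans hS2)]
  have e1 : |∑ a ∈ Ioc 0 S, chi a * ∑ b ∈ Ioc 0 N with a * b ≤ N, zt b
      - N * ∑ a ∈ Ioc 0 S, chi a * (a : ℝ) ^ (-1 : ℝ)| ≤ S := by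
    rw [mul_sum, ← sum_sub_distrib]
    refine (abs_sum_le_sum_abs _ _).trans ((sum_le_card_nsmul _ _ 1 fun a ha ↦ ?_).trans (by simp))
    have ha0 : 0 < a := (mem_Ioc.mp ha).1
    rw [filter_mul_le ha0, sum_zt]
    have h1 : ((N / a : ℕ) : ℝ) ≤ N / a := Nat.cast_div_le
    have h2 : (N : ℝ) / a < (N / a : ℕ) + 1 := by
      rw [div_lt_iff₀ (by exact_mod_cast ha0)]
      exact_mod_cast Nat.lt_mul_of_div_lt (Nat.lt_add_one (N / a)) ha0
    rw [Real.rpow_neg_one, show chi a * ((N / a : ℕ) : ℝ) - N * (chi a * (a : ℝ)⁻¹)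
      = chi a * ((N / a : ℕ) - N / a) by ring, abs_mul]
    refine mul_le_one₀ (abs_chi_le a) (abs_nonneg _) ?_
    rw [abs_le]
    constructor <;> linarith
  have e2 : |∑ b ∈ Ioc 0 S, zt b * ∑ a ∈ Ioc 0 N with a * b ≤ N, chi a| ≤ S := by
    refine (abs_sum_le_sum_abs _ _).trans ((sum_le_card_nsmul _ _ 1 fun a ha ↦ ?_).trans (by simp))
    have ha0 : 0 < a := (mem_Ioc.mp ha).1
    simp_rw [mul_comm _ a]
    rw [filter_mul_le ha0, zt_apply ha0.ne', one_mul]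
    exact abs_sum_chi_le _
  have e3 : |(∑ a ∈ Ioc 0 S, chi a) * ∑ b ∈ Ioc 0 S, zt b| ≤ S := by
    rw [sum_zt, abs_mul, Nat.abs_cast]
    exact mul_le_of_le_one_left (by positivity) (abs_sum_chi_le _)
  have hSr : (1 : ℝ) ≤ S := by exact_mod_cast hS1
  have e4 : |N * ∑ a ∈ Ioc 0 S, chi a * (a : ℝ) ^ (-1 : ℝ) - l * N| ≤ 3 * C * S := by
    have := h S hSr
    rw [Nat.floor_natCast, zero_sub, Real.rpow_neg_one] at this
    rw [mul_comm l, ← mul_sub, abs_mul, Nat.abs_cast]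
    calc (N : ℝ) * |_| ≤ N * (C * (S : ℝ)⁻¹) := mul_le_mul_of_nonneg_left this (by positivity)
      _ ≤ (3 * S * S) * (C * (S : ℝ)⁻¹) := by
        refine mul_le_mul_of_nonneg_right ?_ (by positivity)
        have : N ≤ 3 * S * S := by nlinarith
        exact_mod_cast this
      _ = 3 * C * S := by field_simp
  have e5 : |l * N - l * x| ≤ |l| := by
    rw [← mul_sub, abs_mul]
    refine mul_le_of_le_one_right (abs_nonneg _) ?_
    have h1 := Nat.lt_floor_add_one x
    have h2 := Nat.floor_le (show 0 ≤ x by linarith)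
    rw [abs_le]
    constructor <;> linarith
  have e6 : (S : ℝ) ≤ x ^ ((1 : ℝ) / 2) := by
    rw [rpow_half_eq_sqrt]
    refine Real.le_sqrt_of_sq_le ((?_ : _ ≤ (N : ℝ)).trans (Nat.floor_le (by linarith)))
    rw [sq]
    exact_mod_cast hS2
  have e7 : (1 : ℝ) ≤ x ^ ((1 : ℝ) / 2) := hSr.trans e6
  have e8 : |l| * 1 ≤ |l| * x ^ ((1 : ℝ) / 2) := mul_le_mul_of_nonneg_left e7 (abs_nonneg _)
  have e9 : (3 * C + 3) * (S : ℝ) ≤ (3 * C + 3) * x ^ ((1 : ℝ) / 2) :=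
    mul_le_mul_of_nonneg_left e6 (by positivity)
  rw [abs_le] at *
  constructor <;> nlinarith

lemma sum_rr_mul_rpow (l C : ℝ) (h : ∀ x : ℝ, 1 ≤ x →
    |∑ n ∈ Ioc 0 ⌊x⌋₊, rr n - l * x| ≤ C * x ^ ((1 : ℝ) / 2)) :
    ∃ K C' : ℝ, 0 ≤ C' ∧ ∀ x : ℝ, 1 ≤ x →
    |∑ n ∈ Ioc 0 ⌊x⌋₊, rr n * (n : ℝ) ^ (-(3 / 2) : ℝ) - K + 2 * l * x ^ (-(1 / 2) : ℝ)|
      ≤ C' * x ^ (-1 : ℝ) := by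
  obtain ⟨z₁, C₁, hC₁, h₁⟩ := sum_mul_rpow_neg (e := fun n ↦ rr n - l) (A := C) (θ := 1 / 2)
    (s := 3 / 2) (by norm_num) (by norm_num) (fun N hN ↦ by
      have := h N (by exact_mod_cast hN)
      rw [Nat.floor_natCast] at this
      simpa [mul_comm] using this)
  obtain ⟨z₂, C₂, hC₂, h₂⟩ := sum_rpow_neg (s := 3 / 2) (by norm_num) (by norm_num)
  refine ⟨z₁ + l * z₂, C₁ + |l| * C₂, by positivity, fun x hx ↦ ?_⟩
  have h₁ := h₁ x hx
  have h₂ := mul_le_mul_of_nonneg_left (h₂ x hx) (abs_nonneg l)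
  rw [show (1 : ℝ) / 2 - 3 / 2 = -1 by norm_num] at h₁
  rw [← abs_mul, show (1 : ℝ) - 3 / 2 = -(1 / 2) by norm_num] at h₂
  have h3 : x ^ (-(3 / 2) : ℝ) ≤ x ^ (-1 : ℝ) :=
    Real.rpow_le_rpow_of_exponent_le hx (by norm_num)
  calc _ = |(∑ n ∈ Ioc 0 ⌊x⌋₊, (rr n - l) * (n : ℝ) ^ (-(3 / 2) : ℝ) - z₁)
      + l * (∑ n ∈ Ioc 0 ⌊x⌋₊, (n : ℝ) ^ (-(3 / 2) : ℝ) - x ^ (-(1 / 2) : ℝ) / (-(1 / 2)) - z₂)| := by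
        congr 1
        simp only [sub_mul, sum_sub_distrib, mul_sum, mul_sub]
        ring
    _ ≤ _ := (abs_add_le _ _).trans (add_le_add h₁ h₂)
    _ ≤ C₁ * x ^ (-1 : ℝ) + |l| * (C₂ * x ^ (-1 : ℝ)) := by gcongr
    _ = _ := by ring

/-- The arithmetic function supported on `k`-th powers, with value `h m` at `m ^ k`. -/
noncomputable def pw (k : ℕ) (h : ArithmeticFunction ℝ) : ArithmeticFunction ℝ :=
  ⟨fun n ↦ ∑ m ∈ n.divisors with m ^ k = n, h m, by simp⟩

lemma pw_pow {k : ℕ} (hk : k ≠ 0) (h : ArithmeticFunction ℝ) (m : ℕ) : pw k h (m ^ k) = h m := by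
  rcases eq_or_ne m 0 with rfl | hm
  · simp [hk]
  have : (m ^ k).divisors.filter (fun j ↦ j ^ k = m ^ k) = {m} := by
    ext j
    simp only [mem_filter, Nat.mem_divisors, mem_singleton]
    refine ⟨fun hj ↦ Nat.pow_left_injective hk hj.2, ?_⟩
    rintro rfl
    exact ⟨⟨dvd_pow_self _ hk, pow_ne_zero _ hm⟩, rfl⟩
  change ∑ j ∈ (m ^ k).divisors with j ^ k = m ^ k, h j = h m
  rw [this, sum_singleton]

lemma pw_eq_zero {k n : ℕ} (h : ArithmeticFunction ℝ) (hn : ∀ m : ℕ, m ^ k ≠ n) :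
    pw k h n = 0 := by
  change ∑ j ∈ n.divisors with j ^ k = n, h j = 0
  rw [filter_false_of_mem fun j _ ↦ hn j, sum_empty]

lemma pw_one {k : ℕ} (hk : k ≠ 0) : pw k 1 = 1 := by
  ext n
  by_cases hn : ∃ m : ℕ, m ^ k = n
  · obtain ⟨m, rfl⟩ := hn
    rw [pw_pow hk, ArithmeticFunction.one_apply, ArithmeticFunction.one_apply]
    simp [hk]
  · push Not at hn
    rw [pw_eq_zero _ hn, ArithmeticFunction.one_apply_ne]
    rintro rfl
    exact hn 1 (one_pow k)

lemma pw_mul {k : ℕ} (hk : k ≠ 0) (a b : ArithmeticFunction ℝ) :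
    pw k (a * b) = pw k a * pw k b := by
  ext n
  rw [ArithmeticFunction.mul_apply]
  by_cases hn : ∃ m : ℕ, m ^ k = n
  · obtain ⟨m, rfl⟩ := hn
    rw [pw_pow hk, ArithmeticFunction.mul_apply]
    refine sum_of_injOn (fun x ↦ (x.1 ^ k, x.2 ^ k)) ?_ ?_ ?_ ?_
    · intro x _ y _ hxy
      simp only [Prod.mk.injEq] at hxy
      exact Prod.ext (Nat.pow_left_injective hk hxy.1) (Nat.pow_left_injective hk hxy.2)
    · intro x hx
      simp only [mem_coe, Nat.mem_divisorsAntidiagonal] at hx ⊢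
      rw [← mul_pow, hx.1]
      exact ⟨rfl, pow_ne_zero _ hx.2⟩
    · rintro ⟨x, y⟩ hx hx'
      simp only [Nat.mem_divisorsAntidiagonal] at hx
      by_cases h1 : ∃ i : ℕ, i ^ k = x
      · by_cases h2 : ∃ j : ℕ, j ^ k = y
        · obtain ⟨i, rfl⟩ := h1
          obtain ⟨j, rfl⟩ := h2
          refine absurd ⟨(i, j), ?_, rfl⟩ hx'
          rw [← mul_pow] at hx
          simp only [mem_coe, Nat.mem_divisorsAntidiagonal]
          exact ⟨Nat.pow_left_injective hk hx.1, fun h ↦ hx.2 (by simp [h, hk])⟩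
        · push Not at h2
          rw [pw_eq_zero b h2, mul_zero]
      · push Not at h1
        rw [pw_eq_zero a h1, zero_mul]
    · intro x _
      rw [pw_pow hk, pw_pow hk]
  · push Not at hn
    rw [pw_eq_zero _ hn, eq_comm]
    refine sum_eq_zero fun x hx ↦ ?_
    by_cases h1 : ∃ i : ℕ, i ^ k = x.1
    · by_cases h2 : ∃ j : ℕ, j ^ k = x.2
      · obtain ⟨i, hi⟩ := h1
        obtain ⟨j, hj⟩ := h2
        refine absurd ?_ (hn (i * j))
        rw [mul_pow, hi, hj, (Nat.mem_divisorsAntidiagonal.mp hx).1]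
      · push Not at h2
        rw [pw_eq_zero b h2, mul_zero]
    · push Not at h1
      rw [pw_eq_zero a h1, zero_mul]

lemma pw_isMultiplicative {k : ℕ} (hk : k ≠ 0) {h : ArithmeticFunction ℝ}
    (hh : h.IsMultiplicative) : (pw k h).IsMultiplicative := by
  refine ⟨?_, fun {m n} hmn ↦ ?_⟩
  · have := pw_pow hk h 1
    rwa [one_pow, hh.1] at this
  by_cases hc : ∃ c : ℕ, c ^ k = m * n
  · obtain ⟨c, hc⟩ := hc
    obtain ⟨i, rfl⟩ := exists_eq_pow_of_mul_eq_pow (a := m) (b := n)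
      (Nat.isUnit_iff.mpr hmn) hc.symm
    obtain ⟨j, rfl⟩ := exists_eq_pow_of_mul_eq_pow (a := n) (b := i ^ k)
      (Nat.isUnit_iff.mpr hmn.symm) (by rw [mul_comm, hc])
    rw [← mul_pow, pw_pow hk, pw_pow hk, pw_pow hk]
    exact hh.2 (by simpa [Nat.coprime_pow_left_iff (Nat.pos_of_ne_zero hk),
      Nat.coprime_pow_right_iff (Nat.pos_of_ne_zero hk)] using hmn)
  · push Not at hc
    rw [pw_eq_zero _ hc]
    by_cases h1 : ∃ i : ℕ, i ^ k = m
    · by_cases h2 : ∃ j : ℕ, j ^ k = n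
      · obtain ⟨i, rfl⟩ := h1
        obtain ⟨j, rfl⟩ := h2
        exact absurd (mul_pow i j k) (hc _)
      · push Not at h2
        rw [pw_eq_zero h h2, mul_zero]
    · push Not at h1
      rw [pw_eq_zero h h1, zero_mul]

lemma sum_pw_mul {k : ℕ} (hk : k ≠ 0) (h : ArithmeticFunction ℝ) (φ : ℕ → ℝ) (N : ℕ) :
    ∑ n ∈ Ioc 0 N, pw k h n * φ n = ∑ m ∈ Ioc 0 N with m ^ k ≤ N, h m * φ (m ^ k) := by
  symm
  refine sum_of_injOn (fun x ↦ x ^ k) (Nat.pow_left_injective hk).injOn ?_ ?_ ?_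
  · intro x hx
    simp only [coe_filter, mem_Ioc, Set.mem_ofPred_eq, mem_coe] at hx ⊢
    exact ⟨pow_pos hx.1.1 k, hx.2⟩
  · intro n hn hn'
    rw [pw_eq_zero, zero_mul]
    rintro m rfl
    refine hn' ⟨m, ?_, rfl⟩
    simp only [coe_filter, mem_Ioc, Set.mem_ofPred_eq] at hn ⊢
    have hm : 0 < m := Nat.pos_of_ne_zero fun h ↦ by simp [h, hk] at hn
    exact ⟨⟨hm, (Nat.le_self_pow hk m).trans hn.2⟩, hn.2⟩
  · intro m _
    rw [pw_pow hk]

lemma sum_pw {k : ℕ} (hk : k ≠ 0) (h : ArithmeticFunction ℝ) (N : ℕ) :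
    ∑ n ∈ Ioc 0 N, pw k h n = ∑ m ∈ Ioc 0 N with m ^ k ≤ N, h m := by
  simpa using sum_pw_mul hk h 1 N

/-- The convolution of the indicator function of squares and `rr` at cubes. -/
noncomputable def vv : ArithmeticFunction ℝ := pw 2 zt * pw 3 rr

lemma sum_vv (N : ℕ) : ∑ n ∈ Ioc 0 N, vv n =
    ∑ x ∈ Ioc 0 N ×ˢ Ioc 0 N with x.1 ^ 2 * x.2 ^ 3 ≤ N, zt x.1 * rr x.2 := by
  rw [vv, ArithmeticFunction.sum_Ioc_mul_eq_sum_sum, sum_pw_mul two_ne_zero, sum_filter, sum_filter,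
    sum_product]
  refine sum_congr rfl fun a ha ↦ ?_
  have ha0 : 0 < a := (mem_Ioc.mp ha).1
  have ha2 : 0 < a ^ 2 := pow_pos ha0 2
  rw [sum_pw three_ne_zero]
  have : (Ioc 0 (N / a ^ 2)).filter (fun m ↦ m ^ 3 ≤ N / a ^ 2)
      = (Ioc 0 N).filter (fun m ↦ a ^ 2 * m ^ 3 ≤ N) := by
    ext m
    simp only [mem_filter, mem_Ioc, Nat.le_div_iff_mul_le ha2, mul_comm _ (a ^ 2)]
    constructor
    · exact fun h ↦ ⟨⟨h.1.1, (Nat.le_mul_of_pos_left m ha2).trans h.1.2⟩, h.2⟩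
    · exact fun h ↦ ⟨⟨h.1.1, (Nat.mul_le_mul_left _ (Nat.le_self_pow three_ne_zero m)).trans h.2⟩,
        h.2⟩
  rw [this, mul_sum, ← sum_filter]
  split_ifs with h
  · rfl
  · symm
    rw [filter_false_of_mem, sum_empty]
    intro m hm h'
    exact h ((Nat.le_mul_of_pos_right _ (pow_pos (mem_Ioc.mp hm).1 3)).trans h')

lemma pow_rpow_div {t : ℝ} (ht : 0 ≤ t) (a : ℕ) (b : ℝ) : (t ^ a) ^ b = t ^ (a * b) := by
  rw [← Real.rpow_natCast, ← Real.rpow_mul ht]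

lemma filter_cube {t : ℝ} {a : ℕ} (ha : 0 < a) :
    (Ioc 0 ⌊t ^ 24⌋₊).filter (fun m : ℕ ↦ a ^ 2 * m ^ 3 ≤ ⌊t ^ 24⌋₊) =
      Ioc 0 ⌊t ^ 8 * (a : ℝ) ^ (-(2 / 3) : ℝ)⌋₊ := by
  have ha' : (0 : ℝ) < a := by exact_mod_cast ha
  have key : ∀ m : ℕ, a ^ 2 * m ^ 3 ≤ ⌊t ^ 24⌋₊ ↔ m ≤ ⌊t ^ 8 * (a : ℝ) ^ (-(2 / 3) : ℝ)⌋₊ := by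
    intro m
    have h2 : ((a : ℝ) ^ (-(2 / 3) : ℝ)) ^ 3 * a ^ 2 = 1 := by
      rw [← Real.rpow_natCast, ← Real.rpow_mul ha'.le, ← Real.rpow_natCast, ← Real.rpow_add ha']
      norm_num
    rw [Nat.le_floor_iff (by positivity), Nat.le_floor_iff (by positivity),
      ← pow_le_pow_iff_left₀ (a := (m : ℝ)) (by positivity) (by positivity) (three_ne_zero),
      ← mul_le_mul_iff_left₀ (b := (m : ℝ) ^ 3) (show (0 : ℝ) < a ^ 2 by positivity)]
    have : (t ^ 8 * (a : ℝ) ^ (-(2 / 3) : ℝ)) ^ 3 * a ^ 2 = t ^ 24 := by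
      rw [mul_pow, mul_assoc, h2]; ring
    rw [this]
    push_cast
    rw [mul_comm]
  ext m
  simp only [mem_filter, mem_Ioc, ← key]
  refine ⟨fun h ↦ ⟨h.1.1, h.2⟩, fun h ↦ ⟨⟨h.1, ?_⟩, h.2⟩⟩
  exact ((Nat.le_self_pow three_ne_zero m).trans (Nat.le_mul_of_pos_left _ (pow_pos ha 2))).trans h.2

lemma filter_sq {t : ℝ} {m : ℕ} (hm : 0 < m) :
    (Ioc 0 ⌊t ^ 24⌋₊).filter (fun a : ℕ ↦ a ^ 2 * m ^ 3 ≤ ⌊t ^ 24⌋₊) =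
      Ioc 0 ⌊t ^ 12 * (m : ℝ) ^ (-(3 / 2) : ℝ)⌋₊ := by
  have hm' : (0 : ℝ) < m := by exact_mod_cast hm
  have key : ∀ a : ℕ, a ^ 2 * m ^ 3 ≤ ⌊t ^ 24⌋₊ ↔ a ≤ ⌊t ^ 12 * (m : ℝ) ^ (-(3 / 2) : ℝ)⌋₊ := by
    intro a
    have h2 : ((m : ℝ) ^ (-(3 / 2) : ℝ)) ^ 2 * m ^ 3 = 1 := by
      rw [← Real.rpow_natCast, ← Real.rpow_mul hm'.le, ← Real.rpow_natCast, ← Real.rpow_add hm']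
      norm_num
    rw [Nat.le_floor_iff (by positivity), Nat.le_floor_iff (by positivity),
      ← pow_le_pow_iff_left₀ (a := (a : ℝ)) (by positivity) (by positivity) (two_ne_zero),
      ← mul_le_mul_iff_left₀ (b := (a : ℝ) ^ 2) (show (0 : ℝ) < m ^ 3 by positivity)]
    have : (t ^ 12 * (m : ℝ) ^ (-(3 / 2) : ℝ)) ^ 2 * m ^ 3 = t ^ 24 := by
      rw [mul_pow, mul_assoc, h2]; ring
    rw [this]
    push_cast
    rfl
  ext a
  simp only [mem_filter, mem_Ioc, ← key]
  refine ⟨fun h ↦ ⟨h.1.1, h.2⟩, fun h ↦ ⟨⟨h.1, ?_⟩, h.2⟩⟩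
  exact ((Nat.le_self_pow two_ne_zero a).trans (Nat.le_mul_of_pos_right _ (pow_pos hm 3))).trans h.2

lemma sum_vv_eq {t : ℝ} (ht : 1 ≤ t) : ∑ n ∈ Ioc 0 ⌊t ^ 24⌋₊, vv n =
    ∑ a ∈ Ioc 0 ⌊t ^ 3⌋₊, ∑ m ∈ Ioc 0 ⌊t ^ 8 * (a : ℝ) ^ (-(2 / 3) : ℝ)⌋₊, rr m
    + ∑ m ∈ Ioc 0 ⌊t ^ 6⌋₊, rr m * (⌊t ^ 12 * (m : ℝ) ^ (-(3 / 2) : ℝ)⌋₊ : ℝ)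
    - ⌊t ^ 3⌋₊ * ∑ m ∈ Ioc 0 ⌊t ^ 6⌋₊, rr m := by
  have ht0 : 0 ≤ t := by linarith
  rw [sum_vv, sum_hyperbola zt rr (fun a m ↦ a ^ 2 * m ^ 3 ≤ ⌊t ^ 24⌋₊) (A := ⌊t ^ 3⌋₊)
    (M := ⌊t ^ 6⌋₊) (Nat.floor_le_floor (pow_le_pow_right₀ ht (by norm_num)))
    (Nat.floor_le_floor (pow_le_pow_right₀ ht (by norm_num)))
    (fun a b _ _ hab ↦ by
      by_contra! hlt
      have h1 := (Nat.floor_lt (by positivity)).mp hlt.1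
      have h2 := (Nat.floor_lt (by positivity)).mp hlt.2
      rw [Nat.le_floor_iff (by positivity)] at hab
      have h3 : (t ^ 3) ^ 2 * (t ^ 6) ^ 3 < (a : ℝ) ^ 2 * (b : ℝ) ^ 3 :=
        mul_lt_mul'' (pow_lt_pow_left₀ h1 (by positivity) two_ne_zero)
          (pow_lt_pow_left₀ h2 (by positivity) three_ne_zero) (by positivity) (by positivity)
      push_cast at hab
      ring_nf at h3 hab
      linarith)
    (fun a b _ _ ha hb ↦ by
      rw [Nat.le_floor_iff (by positivity)] at ha hb ⊢
      calc ((a ^ 2 * b ^ 3 : ℕ) : ℝ) = (a : ℝ) ^ 2 * (b : ℝ) ^ 3 := by push_cast; rfl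
        _ ≤ (t ^ 3) ^ 2 * (t ^ 6) ^ 3 := by gcongr
        _ = t ^ 24 := by ring), sum_zt]
  congr 2
  · refine sum_congr rfl fun a ha ↦ ?_
    have ha0 := (mem_Ioc.mp ha).1
    rw [filter_cube ha0, zt_apply ha0.ne', one_mul]
  · refine sum_congr rfl fun m hm ↦ ?_
    rw [filter_sq (mem_Ioc.mp hm).1, sum_zt]

lemma sum_vv_asymp : ∃ a b C : ℝ, 0 ≤ C ∧ ∀ t : ℝ, 1 ≤ t →
    |∑ n ∈ Ioc 0 ⌊t ^ 24⌋₊, vv n - a * t ^ 12 - b * t ^ 8| ≤ C * t ^ 6 := by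
  obtain ⟨l, C₁, hC₁, h₁⟩ := sum_rr
  obtain ⟨K, C₂, hC₂, h₂⟩ := sum_rr_mul_rpow l C₁ h₁
  obtain ⟨z, C₃, hC₃, h₃⟩ := sum_rpow_neg (s := 2 / 3) (by norm_num) (by norm_num)
  obtain ⟨w, C₄, hC₄, h₄⟩ := sum_rpow_neg (s := 1 / 3) (by norm_num) (by norm_num)
  refine ⟨K, l * z, (|l| + C₁) + C₂ + |l| * C₃ + C₁ * (3 / 2 + |w| + C₄) + (C₁ + |l|), by positivity,
    fun t ht ↦ ?_⟩
  have ht0 : 0 < t := by linarith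
  have ht3 : (1 : ℝ) ≤ t ^ 3 := one_le_pow₀ ht
  have ht6 : (1 : ℝ) ≤ t ^ 6 := one_le_pow₀ ht
  have hA := Nat.lt_floor_add_one (t ^ 3)
  have hA' := Nat.floor_le (show 0 ≤ t ^ 3 by positivity)
  rw [sum_vv_eq ht]
  set R := ∑ m ∈ Ioc 0 ⌊t ^ 6⌋₊, rr m with hR
  set A : ℝ := (⌊t ^ 3⌋₊ : ℝ) with hAdef
  have hR1 : |R - l * t ^ 6| ≤ C₁ * t ^ 3 := by
    have := h₁ (t ^ 6) ht6
    rwa [pow_rpow_div ht0.le, show ((6 : ℕ) : ℝ) * (1 / 2) = (3 : ℕ) by norm_num,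
      Real.rpow_natCast] at this
  have hR0 : 0 ≤ R := sum_nonneg fun m _ ↦ rr_nonneg m
  have hR2 : R ≤ (|l| + C₁) * t ^ 6 := by
    have h1 : t ^ 3 ≤ t ^ 6 := pow_le_pow_right₀ ht (by norm_num)
    have h2 := mul_le_mul_of_nonneg_right (le_abs_self l) (show 0 ≤ t ^ 6 by positivity)
    have h3 := mul_le_mul_of_nonneg_left h1 hC₁
    have h4 := (abs_le.mp hR1).2
    linarith
  have e1 : |∑ m ∈ Ioc 0 ⌊t ^ 6⌋₊, rr m * (⌊t ^ 12 * (m : ℝ) ^ (-(3 / 2) : ℝ)⌋₊ : ℝ)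
      - t ^ 12 * ∑ m ∈ Ioc 0 ⌊t ^ 6⌋₊, rr m * (m : ℝ) ^ (-(3 / 2) : ℝ)| ≤ (|l| + C₁) * t ^ 6 := by
    refine le_trans ?_ hR2
    rw [mul_sum, ← sum_sub_distrib]
    refine (abs_sum_le_sum_abs _ _).trans (sum_le_sum fun m _ ↦ ?_)
    rw [show ∀ x y z w : ℝ, x * y - z * (x * w) = x * (y - z * w) by intros; ring, abs_mul,
      abs_of_nonneg (rr_nonneg m)]
    refine mul_le_of_le_one_right (rr_nonneg m) ?_
    have h1 := Nat.lt_floor_add_one (t ^ 12 * (m : ℝ) ^ (-(3 / 2) : ℝ))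
    have h2 := Nat.floor_le (show 0 ≤ t ^ 12 * (m : ℝ) ^ (-(3 / 2) : ℝ) by positivity)
    rw [abs_le]
    constructor <;> linarith
  have e2 : |t ^ 12 * ∑ m ∈ Ioc 0 ⌊t ^ 6⌋₊, rr m * (m : ℝ) ^ (-(3 / 2) : ℝ) - t ^ 12 * K
      + 2 * l * t ^ 9| ≤ C₂ * t ^ 6 := by
    have := h₂ (t ^ 6) ht6
    rw [pow_rpow_div ht0.le, pow_rpow_div ht0.le,
      show ((6 : ℕ) : ℝ) * (-(1 / 2)) = -((3 : ℕ) : ℝ) by norm_num,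
      show ((6 : ℕ) : ℝ) * (-1) = -((6 : ℕ) : ℝ) by norm_num, Real.rpow_neg ht0.le,
      Real.rpow_neg ht0.le, Real.rpow_natCast, Real.rpow_natCast] at this
    have h12 : (0 : ℝ) ≤ t ^ 12 := by positivity
    have := mul_le_mul_of_nonneg_left this h12
    rw [← abs_of_nonneg h12, ← abs_mul, abs_of_nonneg h12] at this
    calc _ = _ := by
          congr 1
          field_simp
      _ ≤ _ := this
      _ = _ := by field_simp
  have e3 : |∑ a ∈ Ioc 0 ⌊t ^ 3⌋₊, ∑ m ∈ Ioc 0 ⌊t ^ 8 * (a : ℝ) ^ (-(2 / 3) : ℝ)⌋₊, rr m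
      - l * t ^ 8 * ∑ a ∈ Ioc 0 ⌊t ^ 3⌋₊, (a : ℝ) ^ (-(2 / 3) : ℝ)|
      ≤ C₁ * (3 / 2 + |w| + C₄) * t ^ 6 := by
    have hstep : ∀ a ∈ Ioc 0 ⌊t ^ 3⌋₊,
        |∑ m ∈ Ioc 0 ⌊t ^ 8 * (a : ℝ) ^ (-(2 / 3) : ℝ)⌋₊, rr m
          - l * (t ^ 8 * (a : ℝ) ^ (-(2 / 3) : ℝ))| ≤ C₁ * (t ^ 4 * (a : ℝ) ^ (-(1 / 3) : ℝ)) := by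
      intro a ha
      have ha0 : (0 : ℝ) < a := by exact_mod_cast (mem_Ioc.mp ha).1
      have ha1 : (a : ℝ) ≤ t ^ 3 := (Nat.le_floor_iff (by positivity)).mp (mem_Ioc.mp ha).2
      have h5 : 1 ≤ t ^ 8 * (a : ℝ) ^ (-(2 / 3) : ℝ) := by
        have h6 := Real.rpow_le_rpow_of_nonpos ha0 ha1 (show (-(2 / 3) : ℝ) ≤ 0 by norm_num)
        rw [pow_rpow_div ht0.le, show ((3 : ℕ) : ℝ) * (-(2 / 3)) = -((2 : ℕ) : ℝ) by norm_num,
          Real.rpow_neg ht0.le, Real.rpow_natCast] at h6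
        calc (1 : ℝ) ≤ t ^ 6 := ht6
          _ = t ^ 8 * (t ^ 2)⁻¹ := by field_simp
          _ ≤ _ := mul_le_mul_of_nonneg_left h6 (by positivity)
      have := h₁ _ h5
      rwa [Real.mul_rpow (by positivity) (by positivity), pow_rpow_div ht0.le,
        show ((8 : ℕ) : ℝ) * (1 / 2) = ((4 : ℕ) : ℝ) by norm_num, Real.rpow_natCast,
        ← Real.rpow_mul ha0.le, show (-(2 / 3) : ℝ) * (1 / 2) = -(1 / 3) by norm_num] at this
    rw [mul_sum, ← sum_sub_distrib]
    refine (abs_sum_le_sum_abs _ _).trans ((sum_le_sum fun a ha ↦ ?_).trans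
      (b := ∑ a ∈ Ioc 0 ⌊t ^ 3⌋₊, C₁ * (t ^ 4 * (a : ℝ) ^ (-(1 / 3) : ℝ))) ?_)
    · rw [mul_assoc]
      exact hstep a ha
    rw [← mul_sum, ← mul_sum, mul_assoc]
    refine mul_le_mul_of_nonneg_left ?_ hC₁
    have := h₄ (t ^ 3) ht3
    rw [pow_rpow_div ht0.le, pow_rpow_div ht0.le,
      show ((3 : ℕ) : ℝ) * (1 - 1 / 3) = ((2 : ℕ) : ℝ) by norm_num,
      show ((3 : ℕ) : ℝ) * (-(1 / 3)) = -((1 : ℕ) : ℝ) by norm_num,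
      Real.rpow_neg ht0.le, Real.rpow_natCast, Real.rpow_natCast] at this
    have h6 := (abs_le.mp this).2
    rw [show t ^ 2 / (1 - 1 / 3) = 3 / 2 * t ^ 2 by ring] at h6
    have h7 : C₄ * (t ^ 1)⁻¹ ≤ C₄ * t ^ 2 := mul_le_mul_of_nonneg_left
      ((inv_le_one_of_one_le₀ (by linarith)).trans (one_le_pow₀ ht)) hC₄
    have h8 : w ≤ |w| * t ^ 2 := (le_abs_self w).trans
      (le_mul_of_one_le_right (abs_nonneg _) (one_le_pow₀ ht))
    have h9 : ∑ a ∈ Ioc 0 ⌊t ^ 3⌋₊, (a : ℝ) ^ (-(1 / 3) : ℝ) ≤ (3 / 2 + |w| + C₄) * t ^ 2 := by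
      linarith
    calc _ ≤ t ^ 4 * ((3 / 2 + |w| + C₄) * t ^ 2) := mul_le_mul_of_nonneg_left h9 (by positivity)
      _ = _ := by ring
  have e4 : |l * t ^ 8 * ∑ a ∈ Ioc 0 ⌊t ^ 3⌋₊, (a : ℝ) ^ (-(2 / 3) : ℝ) - 3 * l * t ^ 9
      - l * z * t ^ 8| ≤ |l| * C₃ * t ^ 6 := by
    have := h₃ (t ^ 3) ht3
    rw [pow_rpow_div ht0.le, pow_rpow_div ht0.le,
      show ((3 : ℕ) : ℝ) * (1 - 2 / 3) = ((1 : ℕ) : ℝ) by norm_num,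
      show ((3 : ℕ) : ℝ) * (-(2 / 3)) = -((2 : ℕ) : ℝ) by norm_num,
      Real.rpow_neg ht0.le, Real.rpow_natCast, Real.rpow_natCast] at this
    have := mul_le_mul_of_nonneg_left this (abs_nonneg (l * t ^ 8))
    rw [← abs_mul, abs_mul l, abs_of_nonneg (show 0 ≤ t ^ 8 by positivity)] at this
    calc _ = _ := by
          congr 1
          ring
      _ ≤ _ := this
      _ = _ := by field_simp
  have e5 : |A * R - l * t ^ 9| ≤ (C₁ + |l|) * t ^ 6 := by
    calc _ = |A * (R - l * t ^ 6) + l * t ^ 6 * (A - t ^ 3)| := by congr 1; ring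
      _ ≤ |A * (R - l * t ^ 6)| + |l * t ^ 6 * (A - t ^ 3)| := abs_add_le _ _
      _ ≤ t ^ 3 * (C₁ * t ^ 3) + |l| * t ^ 6 * 1 := by
        rw [abs_mul, abs_mul, abs_mul l, abs_of_nonneg (show 0 ≤ A by positivity),
          abs_of_nonneg (show 0 ≤ t ^ 6 by positivity)]
        gcongr
        rw [abs_le]
        constructor <;> linarith
      _ = _ := by ring
  rw [abs_le] at *
  constructor <;> linarith [e1.1, e1.2]

/-- The summatory function of `F` is `a Y^{1/2} + b Y^{1/3} + O(Y^{1/4} (1 + log Y)^k)`. -/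
def HasAsymp (F : ArithmeticFunction ℝ) (a b : ℝ) (k : ℕ) : Prop :=
  ∃ C : ℝ, 0 ≤ C ∧ ∀ Y : ℝ, 1 ≤ Y →
    |∑ n ∈ Ioc 0 ⌊Y⌋₊, F n - a * Y ^ ((1 : ℝ) / 2) - b * Y ^ ((1 : ℝ) / 3)|
      ≤ C * (Y ^ ((1 : ℝ) / 4) * (1 + Real.log Y) ^ k)

/-- Convolution with `g` preserves asymptotic expansions, multiplying the constants by `G₁` and
`G₂`. -/
def IsConvAdmissible (g : ArithmeticFunction ℝ) (G₁ G₂ : ℝ) : Prop :=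
  ∃ C : ℝ, 0 ≤ C ∧ ∀ y : ℝ, 1 ≤ y →
    ∑ e ∈ Ioc 0 ⌊y⌋₊, |g e| * (e : ℝ) ^ (-(1 / 4) : ℝ) ≤ C * (1 + Real.log y) ∧
    |∑ e ∈ Ioc 0 ⌊y⌋₊, g e * (e : ℝ) ^ (-(1 / 2) : ℝ) - G₁| ≤ C * y ^ (-(1 / 4) : ℝ) ∧
    |∑ e ∈ Ioc 0 ⌊y⌋₊, g e * (e : ℝ) ^ (-(1 / 3) : ℝ) - G₂| ≤ C * y ^ (-(1 / 12) : ℝ)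

lemma hasAsymp_vv : ∃ a b : ℝ, HasAsymp vv a b 0 := by
  obtain ⟨a, b, C, hC, h⟩ := sum_vv_asymp
  refine ⟨a, b, C, hC, fun Y hY ↦ ?_⟩
  have hY0 : 0 ≤ Y := by linarith
  have key : ∀ n : ℕ, (Y ^ ((1 : ℝ) / 24)) ^ n = Y ^ ((n : ℝ) / 24) := fun n ↦ by
    rw [← Real.rpow_natCast, ← Real.rpow_mul hY0]
    congr 1
    ring
  have := h (Y ^ ((1 : ℝ) / 24)) (Real.one_le_rpow hY (by norm_num))
  simp only [key] at this
  norm_num at this ⊢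
  exact this

lemma HasAsymp.mul {F g : ArithmeticFunction ℝ} {a b G₁ G₂ : ℝ} {k : ℕ} (hF : HasAsymp F a b k)
    (hg : IsConvAdmissible g G₁ G₂) : HasAsymp (g * F) (a * G₁) (b * G₂) (k + 1) := by
  obtain ⟨C, hC, hF⟩ := hF
  obtain ⟨D, hD, hg⟩ := hg
  refine ⟨C * D + |a| * D + |b| * D, by positivity, fun Y hY ↦ ?_⟩
  obtain ⟨g1, g2, g3⟩ := hg Y hY
  have hY0 : 0 < Y := by linarith
  have hlog : 0 ≤ Real.log Y := Real.log_nonneg hY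
  have hL : 1 ≤ (1 + Real.log Y) ^ (k + 1) := one_le_pow₀ (by linarith)
  have hdiv : ∀ e : ℕ, ∀ s : ℝ, (Y / e) ^ s = Y ^ s * (e : ℝ) ^ (-s) := fun e s ↦ by
    rw [Real.div_rpow hY0.le (by positivity), Real.rpow_neg (by positivity), div_eq_mul_inv]
  have e1 : |∑ n ∈ Ioc 0 ⌊Y⌋₊, (g * F) n
      - a * Y ^ ((1 : ℝ) / 2) * ∑ e ∈ Ioc 0 ⌊Y⌋₊, g e * (e : ℝ) ^ (-(1 / 2) : ℝ)
      - b * Y ^ ((1 : ℝ) / 3) * ∑ e ∈ Ioc 0 ⌊Y⌋₊, g e * (e : ℝ) ^ (-(1 / 3) : ℝ)|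
      ≤ C * D * (Y ^ ((1 : ℝ) / 4) * (1 + Real.log Y) ^ (k + 1)) := by
    rw [ArithmeticFunction.sum_Ioc_mul_eq_sum_sum, mul_sum, mul_sum, ← sum_sub_distrib,
      ← sum_sub_distrib]
    calc _ ≤ ∑ e ∈ Ioc 0 ⌊Y⌋₊, (C * (Y ^ ((1 : ℝ) / 4) * (1 + Real.log Y) ^ k)) *
          (|g e| * (e : ℝ) ^ (-(1 / 4) : ℝ)) := by
          refine (abs_sum_le_sum_abs _ _).trans (sum_le_sum fun e he ↦ ?_)
          have he0 : (0 : ℝ) < e := by exact_mod_cast (mem_Ioc.mp he).1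
          have he1 : (1 : ℝ) ≤ e := by exact_mod_cast (mem_Ioc.mp he).1
          have heY : (e : ℝ) ≤ Y := (Nat.le_floor_iff hY0.le).mp (mem_Ioc.mp he).2
          have h1 : 1 ≤ Y / e := (one_le_div he0).mpr heY
          have h2 := hF (Y / e) h1
          rw [Nat.floor_div_natCast, hdiv, hdiv, hdiv] at h2
          have h3 : Real.log (Y / e) ≤ Real.log Y :=
            Real.log_le_log (by positivity) (div_le_self hY0.le he1)
          have h4 : (1 + Real.log (Y / e)) ^ k ≤ (1 + Real.log Y) ^ k :=
            pow_le_pow_left₀ (by have := Real.log_nonneg h1; linarith) (by linarith) k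
          calc _ = |g e| * _ := by
                rw [← abs_mul]
                congr 1
                ring_nf
            _ ≤ |g e| * _ := mul_le_mul_of_nonneg_left h2 (abs_nonneg _)
            _ ≤ |g e| * (C * (Y ^ ((1 : ℝ) / 4) * (e : ℝ) ^ (-(1 / 4) : ℝ)
                * (1 + Real.log Y) ^ k)) := by gcongr
            _ = _ := by ring
      _ = (C * (Y ^ ((1 : ℝ) / 4) * (1 + Real.log Y) ^ k)) *
          ∑ e ∈ Ioc 0 ⌊Y⌋₊, |g e| * (e : ℝ) ^ (-(1 / 4) : ℝ) := by rw [mul_sum]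
      _ ≤ (C * (Y ^ ((1 : ℝ) / 4) * (1 + Real.log Y) ^ k)) * (D * (1 + Real.log Y)) :=
        mul_le_mul_of_nonneg_left g1 (by positivity)
      _ = _ := by ring
  have hP : 0 ≤ Y ^ ((1 : ℝ) / 4) := by positivity
  have e2 : |a * Y ^ ((1 : ℝ) / 2) * ∑ e ∈ Ioc 0 ⌊Y⌋₊, g e * (e : ℝ) ^ (-(1 / 2) : ℝ)
      - a * G₁ * Y ^ ((1 : ℝ) / 2)| ≤ |a| * D * (Y ^ ((1 : ℝ) / 4) * (1 + Real.log Y) ^ (k + 1)) := by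
    calc _ = |a| * Y ^ ((1 : ℝ) / 2) *
          |∑ e ∈ Ioc 0 ⌊Y⌋₊, g e * (e : ℝ) ^ (-(1 / 2) : ℝ) - G₁| := by
          rw [← abs_of_nonneg (show 0 ≤ Y ^ ((1 : ℝ) / 2) by positivity), ← abs_mul, ← abs_mul,
            abs_of_nonneg (show 0 ≤ Y ^ ((1 : ℝ) / 2) by positivity)]
          congr 1
          ring
      _ ≤ |a| * Y ^ ((1 : ℝ) / 2) * (D * Y ^ (-(1 / 4) : ℝ)) :=
        mul_le_mul_of_nonneg_left g2 (by positivity)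
      _ = |a| * D * (Y ^ ((1 : ℝ) / 4) * 1) := by
        rw [show |a| * Y ^ ((1 : ℝ) / 2) * (D * Y ^ (-(1 / 4) : ℝ))
          = |a| * D * (Y ^ ((1 : ℝ) / 2) * Y ^ (-(1 / 4) : ℝ)) by ring, ← Real.rpow_add hY0]
        norm_num
      _ ≤ _ := by gcongr
  have e3 : |b * Y ^ ((1 : ℝ) / 3) * ∑ e ∈ Ioc 0 ⌊Y⌋₊, g e * (e : ℝ) ^ (-(1 / 3) : ℝ)
      - b * G₂ * Y ^ ((1 : ℝ) / 3)| ≤ |b| * D * (Y ^ ((1 : ℝ) / 4) * (1 + Real.log Y) ^ (k + 1)) := by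
    calc _ = |b| * Y ^ ((1 : ℝ) / 3) *
          |∑ e ∈ Ioc 0 ⌊Y⌋₊, g e * (e : ℝ) ^ (-(1 / 3) : ℝ) - G₂| := by
          rw [← abs_of_nonneg (show 0 ≤ Y ^ ((1 : ℝ) / 3) by positivity), ← abs_mul, ← abs_mul,
            abs_of_nonneg (show 0 ≤ Y ^ ((1 : ℝ) / 3) by positivity)]
          congr 1
          ring
      _ ≤ |b| * Y ^ ((1 : ℝ) / 3) * (D * Y ^ (-(1 / 12) : ℝ)) :=
        mul_le_mul_of_nonneg_left g3 (by positivity)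
      _ = |b| * D * (Y ^ ((1 : ℝ) / 4) * 1) := by
        rw [show |b| * Y ^ ((1 : ℝ) / 3) * (D * Y ^ (-(1 / 12) : ℝ))
          = |b| * D * (Y ^ ((1 : ℝ) / 3) * Y ^ (-(1 / 12) : ℝ)) by ring, ← Real.rpow_add hY0]
        norm_num
      _ ≤ _ := by gcongr
  rw [abs_le] at *
  constructor <;> linarith

lemma sum_rpow_le_of_bounded {g : ℕ → ℝ} {T σ s : ℝ} (hs : σ < s)
    (hT : ∀ N, ∑ e ∈ Ioc 0 N, |g e| * (e : ℝ) ^ (-σ) ≤ T) :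
    ∃ G C : ℝ, 0 ≤ C ∧ ∀ y : ℝ, 1 ≤ y →
      |∑ e ∈ Ioc 0 ⌊y⌋₊, g e * (e : ℝ) ^ (-s) - G| ≤ C * y ^ (σ - s) := by
  have hT0 : 0 ≤ T := (by simpa using hT 0)
  set U : ℕ → ℝ := fun N ↦ ∑ e ∈ Ioc 0 N, |g e| * (e : ℝ) ^ (-σ) with hU
  have hU0 : ∀ N, 0 ≤ U N := fun N ↦ sum_nonneg fun e _ ↦ by positivity
  obtain ⟨G, hG⟩ := exists_abs_sub_le_of_telescoping
    (u := fun N ↦ ∑ e ∈ Ioc 0 N, g e * (e : ℝ) ^ (-s))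
    (b := fun N ↦ (N : ℝ) ^ (-(s - σ)) * (T - U N)) (fun n hn ↦ by
      have hn' : (0 : ℝ) < n := by exact_mod_cast hn
      have h1 : ((n + 1 : ℕ) : ℝ) ^ (-(s - σ)) ≤ (n : ℝ) ^ (-(s - σ)) :=
        Real.rpow_le_rpow_of_nonpos hn' (by push_cast; linarith) (by linarith)
      have h2 := mul_le_mul_of_nonneg_right h1 (sub_nonneg.mpr (hT n))
      have h3 : U (n + 1) = U n + |g (n + 1)| * ((n + 1 : ℕ) : ℝ) ^ (-σ) :=
        sum_Ioc_succ_top (by omega) _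
      have h4 : ((n + 1 : ℕ) : ℝ) ^ (-s) = ((n + 1 : ℕ) : ℝ) ^ (-(s - σ)) * ((n + 1 : ℕ) : ℝ) ^ (-σ) := by
        rw [← Real.rpow_add (by positivity)]
        congr 1
        ring
      rw [sum_Ioc_succ_top (by omega), add_sub_cancel_left, abs_mul,
        abs_of_nonneg (by positivity : (0 : ℝ) ≤ ((n + 1 : ℕ) : ℝ) ^ (-s)), h4, h3]
      change _ * (T - U n) ≤ _ * (T - U n) at h2
      linarith)
    (by
      have h1 := ((tendsto_rpow_neg_atTop (y := s - σ) (by linarith)).comp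
        tendsto_natCast_atTop_atTop).mul_const T
      rw [zero_mul] at h1
      refine squeeze_zero (fun n ↦ mul_nonneg (by positivity) (sub_nonneg.mpr (hT n)))
        (fun n ↦ ?_) h1
      exact mul_le_mul_of_nonneg_left (by linarith [hU0 n]) (by positivity))
  refine ⟨G, 2 ^ (s - σ) * T, by positivity, fun y hy ↦ ?_⟩
  have hN : 1 ≤ ⌊y⌋₊ := Nat.le_floor (by simpa using hy)
  have h4 := floor_rpow_neg_le (s := s - σ) (by linarith) hy
  calc _ ≤ (⌊y⌋₊ : ℝ) ^ (-(s - σ)) * (T - U ⌊y⌋₊) := hG _ hN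
    _ ≤ (2 ^ (s - σ) * y ^ (-(s - σ))) * T :=
      mul_le_mul h4 (by linarith [hU0 ⌊y⌋₊]) (sub_nonneg.mpr (hT _)) (by positivity)
    _ = _ := by rw [neg_sub]; ring

lemma isConvAdmissible_of_bounded {g : ArithmeticFunction ℝ} {T : ℝ}
    (hT : ∀ N, ∑ e ∈ Ioc 0 N, |g e| * (e : ℝ) ^ (-(1 / 4) : ℝ) ≤ T) :
    ∃ G₁ G₂ : ℝ, IsConvAdmissible g G₁ G₂ := by
  obtain ⟨G₁, C₁, hC₁, h₁⟩ := sum_rpow_le_of_bounded (s := 1 / 2) (by norm_num) hT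
  obtain ⟨G₂, C₂, hC₂, h₂⟩ := sum_rpow_le_of_bounded (s := 1 / 3) (by norm_num) hT
  have hT0 : 0 ≤ T := (by simpa using hT 0)
  refine ⟨G₁, G₂, T + C₁ + C₂, by positivity, fun y hy ↦ ⟨?_, ?_, ?_⟩⟩
  · have hlog : 0 ≤ Real.log y := Real.log_nonneg hy
    calc _ ≤ T := hT _
      _ ≤ T + C₁ + C₂ := by linarith
      _ ≤ _ := le_mul_of_one_le_right (by positivity) (by linarith)
  · have := h₁ y hy
    rw [show (1 : ℝ) / 4 - 1 / 2 = -(1 / 4) by norm_num] at this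
    exact this.trans (mul_le_mul_of_nonneg_right (by linarith) (by positivity))
  · have := h₂ y hy
    rw [show (1 : ℝ) / 4 - 1 / 3 = -(1 / 12) by norm_num] at this
    exact this.trans (mul_le_mul_of_nonneg_right (by linarith) (by positivity))

lemma filter_pow_four {y : ℝ} (hy : 0 ≤ y) :
    (Ioc 0 ⌊y⌋₊).filter (fun m : ℕ ↦ m ^ 4 ≤ ⌊y⌋₊) = Ioc 0 ⌊y ^ ((1 : ℝ) / 4)⌋₊ := by
  have key : ∀ m : ℕ, m ^ 4 ≤ ⌊y⌋₊ ↔ m ≤ ⌊y ^ ((1 : ℝ) / 4)⌋₊ := by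
    intro m
    rw [Nat.le_floor_iff hy, Nat.le_floor_iff (by positivity),
      ← pow_le_pow_iff_left₀ (a := (m : ℝ)) (by positivity) (by positivity) (four_ne_zero),
      ← Real.rpow_natCast (y ^ _), ← Real.rpow_mul hy]
    norm_num
  ext m
  simp only [mem_filter, mem_Ioc, ← key]
  exact ⟨fun h ↦ ⟨h.1.1, h.2⟩,
    fun h ↦ ⟨⟨h.1, (Nat.le_self_pow four_ne_zero m).trans h.2⟩, h.2⟩⟩

lemma isConvAdmissible_pw_four {h : ArithmeticFunction ℝ} (hh : ∀ n, |h n| ≤ 1) :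
    ∃ G₁ G₂ C : ℝ, IsConvAdmissible (pw 4 h) G₁ G₂ ∧ ∀ x : ℝ, 1 ≤ x →
      |∑ n ∈ Ioc 0 ⌊x⌋₊, h n * (n : ℝ) ^ (-2 : ℝ) - G₁| ≤ C * x ^ (-1 : ℝ) := by
  have hsum : ∀ N : ℕ, 1 ≤ N → |∑ n ∈ Ioc 0 N, h n| ≤ 1 * (N : ℝ) ^ (1 : ℝ) := fun N _ ↦ by
    rw [Real.rpow_one, one_mul]
    exact (abs_sum_le_sum_abs _ _).trans ((sum_le_card_nsmul _ _ 1 fun a _ ↦ hh a).trans (by simp))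
  obtain ⟨G₁, C₁, hC₁, h₁⟩ := sum_mul_rpow_neg (s := 2) zero_le_one (by norm_num) hsum
  obtain ⟨G₂, C₂, hC₂, h₂⟩ := sum_mul_rpow_neg (s := 4 / 3) zero_le_one (by norm_num) hsum
  refine ⟨G₁, G₂, C₁, ⟨1 + C₁ + C₂, by positivity, fun y hy ↦ ?_⟩, fun x hx ↦ ?_⟩
  · have hy0 : 0 ≤ y := by linarith
    have hy4 : 1 ≤ y ^ ((1 : ℝ) / 4) := Real.one_le_rpow hy (by norm_num)
    have hpow : ∀ m : ℕ, ∀ s : ℝ, ((m ^ 4 : ℕ) : ℝ) ^ (-s) = (m : ℝ) ^ (-(4 * s)) := fun m s ↦ by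
      push_cast
      rw [← Real.rpow_natCast, ← Real.rpow_mul (by positivity)]
      norm_num
    have hlog : 0 ≤ Real.log y := Real.log_nonneg hy
    refine ⟨?_, ?_, ?_⟩
    · have habs : ∀ e : ℕ, |pw 4 h e| ≤ pw 4 zt e := fun e ↦ by
        by_cases he : ∃ m : ℕ, m ^ 4 = e
        · obtain ⟨m, rfl⟩ := he
          rw [pw_pow four_ne_zero, pw_pow four_ne_zero]
          rcases eq_or_ne m 0 with rfl | hm
          · simp
          · rw [zt_apply hm]
            exact hh m
        · push Not at he
          rw [pw_eq_zero _ he, pw_eq_zero _ he, abs_zero]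
      calc _ ≤ ∑ e ∈ Ioc 0 ⌊y⌋₊, pw 4 zt e * (e : ℝ) ^ (-(1 / 4) : ℝ) :=
            sum_le_sum fun e _ ↦ mul_le_mul_of_nonneg_right (habs e) (by positivity)
        _ = ∑ m ∈ Ioc 0 ⌊y ^ ((1 : ℝ) / 4)⌋₊, zt m * ((m ^ 4 : ℕ) : ℝ) ^ (-(1 / 4) : ℝ) := by
          rw [sum_pw_mul four_ne_zero zt (fun e ↦ (e : ℝ) ^ (-(1 / 4) : ℝ)), filter_pow_four hy0]
        _ = ∑ m ∈ Ioc 0 ⌊y ^ ((1 : ℝ) / 4)⌋₊, (m : ℝ)⁻¹ := by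
          refine sum_congr rfl fun m hm ↦ ?_
          rw [hpow, zt_apply (by have := (mem_Ioc.mp hm).1; omega), one_mul,
            show -(4 * (1 / 4) : ℝ) = -1 by norm_num, Real.rpow_neg_one]
        _ ≤ 1 + Real.log (⌊y ^ ((1 : ℝ) / 4)⌋₊) := by
          have := harmonic_le_one_add_log ⌊y ^ ((1 : ℝ) / 4)⌋₊
          rw [harmonic_eq_sum_Icc] at this
          push_cast at this
          exact this
        _ ≤ 1 + Real.log y := by
          have h0 : 0 < ⌊y ^ ((1 : ℝ) / 4)⌋₊ := Nat.floor_pos.mpr hy4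
          gcongr
          calc _ ≤ y ^ ((1 : ℝ) / 4) := Nat.floor_le (by positivity)
            _ ≤ y ^ (1 : ℝ) := Real.rpow_le_rpow_of_exponent_le hy (by norm_num)
            _ = y := Real.rpow_one y
        _ ≤ _ := le_mul_of_one_le_left (by linarith) (by linarith)
    · have := h₁ _ hy4
      rw [← Real.rpow_mul hy0, show (1 : ℝ) / 4 * (1 - 2) = -(1 / 4) by norm_num] at this
      rw [sum_pw_mul four_ne_zero h (fun e ↦ (e : ℝ) ^ (-(1 / 2) : ℝ)), filter_pow_four hy0]
      simp only [hpow]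
      norm_num at this ⊢
      exact this.trans (mul_le_mul_of_nonneg_right (by linarith) (by positivity))
    · have := h₂ _ hy4
      rw [← Real.rpow_mul hy0, show (1 : ℝ) / 4 * (1 - 4 / 3) = -(1 / 12) by norm_num] at this
      rw [sum_pw_mul four_ne_zero h (fun e ↦ (e : ℝ) ^ (-(1 / 3) : ℝ)), filter_pow_four hy0]
      simp only [hpow]
      norm_num at this ⊢
      exact this.trans (mul_le_mul_of_nonneg_right (by linarith) (by positivity))
  · have := h₁ x hx
    rwa [show (1 : ℝ) - 2 = -1 by norm_num] at this

/-- The multiplicative function with prescribed values at prime powers. -/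
noncomputable def mulOf (c : ℕ → ℕ → ℝ) : ArithmeticFunction ℝ :=
  ⟨fun n ↦ if n = 0 then 0 else n.factorization.prod c, by simp⟩

lemma mulOf_apply (c : ℕ → ℕ → ℝ) {n : ℕ} (hn : n ≠ 0) :
    mulOf c n = n.factorization.prod c := if_neg hn

lemma mulOf_isMultiplicative (c : ℕ → ℕ → ℝ) : (mulOf c).IsMultiplicative := by
  rw [ArithmeticFunction.IsMultiplicative.iff_ne_zero]
  refine ⟨by simp [mulOf], fun {m n} hm hn hmn ↦ ?_⟩
  rw [mulOf_apply _ hm, mulOf_apply _ hn, mulOf_apply _ (mul_ne_zero hm hn),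
    Nat.factorization_mul_of_coprime hmn, Finsupp.prod_add_index_of_disjoint]
  simpa using hmn.disjoint_primeFactors

lemma mulOf_prime_pow (c : ℕ → ℕ → ℝ) (hc : ∀ p, c p 0 = 1) {p : ℕ} (hp : p.Prime) (k : ℕ) :
    mulOf c (p ^ k) = c p k := by
  rw [mulOf_apply _ (pow_ne_zero _ hp.ne_zero), hp.factorization_pow, Finsupp.prod_single_index (hc p)]

/-- The local factor of the Dirichlet series of `f` at `p`, as a power series. -/
noncomputable def locser (p : ℕ) (f : ArithmeticFunction ℝ) : PowerSeries ℝ :=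
  PowerSeries.mk fun k ↦ f (p ^ k)

lemma coeff_locser (p : ℕ) (f : ArithmeticFunction ℝ) (k : ℕ) :
    PowerSeries.coeff k (locser p f) = f (p ^ k) := PowerSeries.coeff_mk _ _

lemma locser_mul {p : ℕ} (hp : p.Prime) (f g : ArithmeticFunction ℝ) :
    locser p (f * g) = locser p f * locser p g := by
  ext k
  rw [coeff_locser, ArithmeticFunction.mul_apply, PowerSeries.coeff_mul]
  symm
  refine sum_bij (fun x _ ↦ (p ^ x.1, p ^ x.2)) ?_ ?_ ?_ ?_
  · intro x hx
    rw [Nat.mem_divisorsAntidiagonal, ← mem_antidiagonal.mp hx, pow_add]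
    exact ⟨rfl, mul_ne_zero (pow_ne_zero _ hp.ne_zero) (pow_ne_zero _ hp.ne_zero)⟩
  · intro x _ y _ hxy
    obtain ⟨h1, h2⟩ := Prod.mk.inj hxy
    exact Prod.ext (Nat.pow_right_injective hp.two_le h1) (Nat.pow_right_injective hp.two_le h2)
  · rintro ⟨a, b⟩ hab
    rw [Nat.mem_divisorsAntidiagonal] at hab
    obtain ⟨i, _, rfl⟩ := (Nat.dvd_prime_pow hp).mp ⟨b, hab.1.symm⟩
    obtain ⟨j, _, rfl⟩ := (Nat.dvd_prime_pow hp).mp (Dvd.intro_left _ hab.1)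
    refine ⟨(i, j), mem_antidiagonal.mpr ?_, rfl⟩
    exact Nat.pow_right_injective hp.two_le ((pow_add _ _ _).trans hab.1)
  · intro x _
    rw [coeff_locser, coeff_locser]

lemma locser_one {p : ℕ} (hp : p.Prime) : locser p 1 = 1 := by
  ext k
  rw [coeff_locser, ArithmeticFunction.one_apply, PowerSeries.coeff_one]
  simp [hp.one_lt.ne']

lemma eq_of_locser_eq {f g : ArithmeticFunction ℝ} (hf : f.IsMultiplicative)
    (hg : g.IsMultiplicative) (h : ∀ p : ℕ, p.Prime → locser p f = locser p g) : f = g := by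
  rw [ArithmeticFunction.IsMultiplicative.eq_iff_eq_on_prime_powers f hf g hg]
  intro p k hp
  rw [← coeff_locser, h p hp, coeff_locser]

lemma pw_prime_pow {k : ℕ} (hk : k ≠ 0) (h : ArithmeticFunction ℝ) {p : ℕ} (hp : p.Prime) (j : ℕ) :
    pw k h (p ^ j) = if k ∣ j then h (p ^ (j / k)) else 0 := by
  split_ifs with hkj
  · obtain ⟨i, rfl⟩ := hkj
    rw [Nat.mul_div_cancel_left _ (Nat.pos_of_ne_zero hk), mul_comm, pow_mul, pw_pow hk]
  · refine pw_eq_zero _ fun m hm ↦ hkj ?_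
    have := congrArg (fun n ↦ n.factorization p) hm
    simp only [Nat.factorization_pow, Finsupp.smul_apply, hp.factorization_self, smul_eq_mul,
      mul_one] at this
    exact ⟨_, this.symm⟩

/-- The Möbius function with real values. -/
noncomputable def mu : ArithmeticFunction ℝ :=
  ((ArithmeticFunction.moebius : ArithmeticFunction ℤ) :)

lemma mu_isMultiplicative : mu.IsMultiplicative :=
  ArithmeticFunction.isMultiplicative_moebius.intCast

lemma zt_mul_mu : zt * mu = 1 := ArithmeticFunction.coe_zeta_mul_coe_moebius

lemma mu_prime_pow {p : ℕ} (hp : p.Prime) (k : ℕ) :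
    mu (p ^ k) = if k = 0 then 1 else if k = 1 then -1 else 0 := by
  rw [mu, ArithmeticFunction.intCoe_apply]
  rcases eq_or_ne k 0 with rfl | hk
  · simp
  rw [ArithmeticFunction.moebius_apply_prime_pow hp hk]
  split_ifs <;> simp

/-- The inverse of `chi` with respect to Dirichlet convolution. -/
noncomputable def muChi : ArithmeticFunction ℝ := mu.pmul chi

lemma muChi_isMultiplicative : muChi.IsMultiplicative :=
  mu_isMultiplicative.pmul chi_isMultiplicative

lemma chi_mul_muChi : chi * muChi = 1 := by
  ext n
  have hchi : ∀ x ∈ n.divisorsAntidiagonal, chi x.1 * muChi x.2 = chi n * (zt x.1 * mu x.2) := by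
    intro x hx
    obtain ⟨rfl, h0⟩ := Nat.mem_divisorsAntidiagonal.mp hx
    rw [zt_apply (left_ne_zero_of_mul h0), muChi, ArithmeticFunction.pmul_apply, chi_apply, chi_apply,
      chi_apply, Nat.cast_mul, map_mul]
    push_cast
    ring
  rw [ArithmeticFunction.mul_apply, sum_congr rfl hchi, ← mul_sum, ← ArithmeticFunction.mul_apply,
    zt_mul_mu, ArithmeticFunction.one_apply]
  split_ifs with h
  · rw [h, chi_isMultiplicative.1, mul_one]
  · rw [mul_zero]

lemma coeff_mul_one_sub (F : PowerSeries ℝ) (c : ℝ) (k n : ℕ) :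
    PowerSeries.coeff n (F * (1 - PowerSeries.C c * PowerSeries.X ^ k)) =
      PowerSeries.coeff n F - if k ≤ n then c * PowerSeries.coeff (n - k) F else 0 := by
  rw [mul_sub, mul_one, map_sub, mul_left_comm, PowerSeries.coeff_C_mul, PowerSeries.coeff_mul_X_pow']
  split_ifs <;> simp

lemma locser_pw {k : ℕ} (hk : k ≠ 0) {h : ArithmeticFunction ℝ} {p : ℕ} (hp : p.Prime) {c : ℝ}
    (hc : ∀ j, h (p ^ j) = if j = 0 then 1 else if j = 1 then -c else 0) :
    locser p (pw k h) = 1 - PowerSeries.C c * PowerSeries.X ^ k := by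
  have := coeff_mul_one_sub 1 c k
  simp only [one_mul] at this
  ext n
  rw [this, coeff_locser, pw_prime_pow hk _ hp, hc, PowerSeries.coeff_one, PowerSeries.coeff_one]
  by_cases hkn : k ∣ n
  · obtain ⟨i, rfl⟩ := hkn
    rw [Nat.mul_div_cancel_left _ (Nat.pos_of_ne_zero hk)]
    rcases i with _ | _ | i
    · simp [hk]
    · simp [hk]
    · have h1 : k * (i + 1 + 1) - k ≠ 0 := by
        rw [mul_add, mul_one, Nat.add_sub_cancel]
        positivity
      simp [hk, h1]
  · have h1 : n ≠ 0 := by rintro rfl; simp at hkn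
    have h2 : n - k = 0 → ¬ k ≤ n := by
      intro h h'
      exact hkn (by rw [show n = k by omega])
    rw [if_neg hkn, if_neg h1]
    split_ifs with h3 h4
    · exact absurd h3 (h2 h4)
    · simp
    · simp

lemma locser_pw_mu {k : ℕ} (hk : k ≠ 0) {p : ℕ} (hp : p.Prime) :
    locser p (pw k mu) = 1 - PowerSeries.C 1 * PowerSeries.X ^ k :=
  locser_pw hk hp (mu_prime_pow hp)

lemma locser_pw_muChi {k : ℕ} (hk : k ≠ 0) {p : ℕ} (hp : p.Prime) :
    locser p (pw k muChi) = 1 - PowerSeries.C (chi p) * PowerSeries.X ^ k := by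
  refine locser_pw hk hp fun j ↦ ?_
  rw [muChi, ArithmeticFunction.pmul_apply, mu_prime_pow hp, chi_pow]
  split_ifs with h0 h1
  · simp [h0]
  · simp [h1]
  · simp

/-- The local factors of `ff`. -/
noncomputable def ffLoc (p k : ℕ) : ℝ :=
  if k = 0 then 1 else if k = 2 then chi p ^ 2 else if k = 3 then chi p ^ 2 + chi p else 0

/-- The multiplicative function counting weighted pairs `(m, a)` with `m ^ 3 * a ^ 2 = n`, where
`m` and `a` are odd, squarefree and coprime, the primes dividing `m` are `1` modulo `4`, and
the weight is the number of divisors of `m`. -/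
noncomputable def ff : ArithmeticFunction ℝ := mulOf ffLoc

lemma ff_isMultiplicative : ff.IsMultiplicative := mulOf_isMultiplicative _

/-- The quotient of `ff` by `vv` and by the Möbius function at fourth powers. -/
noncomputable def gg : ArithmeticFunction ℝ := ff * pw 2 mu * pw 3 mu * pw 3 muChi * pw 4 zt

lemma gg_isMultiplicative : gg.IsMultiplicative :=
  (((ff_isMultiplicative.mul (pw_isMultiplicative two_ne_zero mu_isMultiplicative)).mul
    (pw_isMultiplicative three_ne_zero mu_isMultiplicative)).mul
    (pw_isMultiplicative three_ne_zero muChi_isMultiplicative)).mul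
    (pw_isMultiplicative four_ne_zero zt_isMultiplicative)

lemma pw_zt_mul_pw_mu {k : ℕ} (hk : k ≠ 0) : pw k zt * pw k mu = 1 := by
  rw [← pw_mul hk, zt_mul_mu, pw_one hk]

lemma gg_mul : gg * (pw 4 mu * vv) = ff := by
  have h3 : pw 3 chi * pw 3 muChi = 1 := by
    rw [← pw_mul three_ne_zero, chi_mul_muChi, pw_one three_ne_zero]
  calc gg * (pw 4 mu * vv) = ff * (pw 2 zt * pw 2 mu) * (pw 3 zt * pw 3 mu) *
        (pw 3 chi * pw 3 muChi) * (pw 4 zt * pw 4 mu) := by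
        rw [gg, vv, rr, pw_mul three_ne_zero]
        ring
    _ = ff := by
      rw [h3, pw_zt_mul_pw_mu two_ne_zero, pw_zt_mul_pw_mu three_ne_zero,
        pw_zt_mul_pw_mu four_ne_zero]
      simp

lemma chi_prime {p : ℕ} (hp : p.Prime) : chi p = 0 ∧ p = 2 ∨ chi p = 1 ∨ chi p = -1 := by
  rw [chi_eq]
  rcases hp.eq_two_or_odd with h | h
  · simp [h]
  · simp only [h, one_ne_zero, if_false]
    split_ifs <;> simp

lemma gg_prime_pow_rec {p : ℕ} (hp : p.Prime) (n : ℕ) :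
    (gg (p ^ n) - if 4 ≤ n then 1 * gg (p ^ (n - 4)) else 0) = PowerSeries.coeff n
      (PowerSeries.mk (ffLoc p) * (1 - PowerSeries.C 1 * PowerSeries.X ^ 2) *
        (1 - PowerSeries.C 1 * PowerSeries.X ^ 3) *
        (1 - PowerSeries.C (chi p) * PowerSeries.X ^ 3)) := by
  have h4 : locser p (pw 4 zt) * locser p (pw 4 mu) = 1 := by
    rw [← locser_mul hp, pw_zt_mul_pw_mu four_ne_zero, locser_one hp]
  have hff : locser p ff = PowerSeries.mk (ffLoc p) := by
    ext k
    rw [coeff_locser, PowerSeries.coeff_mk, ff, mulOf_prime_pow _ (by simp [ffLoc]) hp]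
  rw [← coeff_locser p gg, ← coeff_locser p gg, ← coeff_mul_one_sub,
    ← locser_pw_mu four_ne_zero hp, ← locser_pw_mu two_ne_zero hp, ← locser_pw_mu three_ne_zero hp,
    ← locser_pw_muChi three_ne_zero hp, ← hff, gg]
  simp only [locser_mul hp]
  rw [mul_assoc, h4, mul_one]

lemma gg_prime_pow {p : ℕ} (hp : p.Prime) :
    (∀ n, |gg (p ^ n)| ≤ 4) ∧ (p ≠ 2 → ∀ n, 1 ≤ n → n ≤ 4 → gg (p ^ n) = 0) := by
  have hrec := gg_prime_pow_rec hp
  simp only [coeff_mul_one_sub, PowerSeries.coeff_mk, one_mul] at hrec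
  have r0 := hrec 0
  have r1 := hrec 1
  have r2 := hrec 2
  have r3 := hrec 3
  have r4 := hrec 4
  have r5 := hrec 5
  have r6 := hrec 6
  have r7 := hrec 7
  have r8 := hrec 8
  have r9 := hrec 9
  have r10 := hrec 10
  have r11 := hrec 11
  norm_num [ffLoc] at r0 r1 r2 r3 r4 r5 r6 r7 r8 r9 r10 r11
  have hbig : ∀ n, 12 ≤ n → gg (p ^ n) = gg (p ^ (n - 4)) := by
    intro n hn
    have := hrec n
    have z : ∀ k, 4 ≤ k → ffLoc p k = 0 := fun k hk ↦ by
      rw [ffLoc, if_neg (by omega), if_neg (by omega), if_neg (by omega)]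
    simp (disch := omega) only [z, if_pos] at this
    simpa [sub_eq_zero] using this
  have hbound : (∀ n < 12, |gg (p ^ n)| ≤ 4) → ∀ n, |gg (p ^ n)| ≤ 4 := by
    intro h n
    induction n using Nat.strong_induction_on with
    | _ n ih =>
      rcases lt_or_ge n 12 with hn | hn
      · exact h n hn
      · rw [hbig n hn]
        exact ih _ (by omega)
  rcases chi_prime hp with ⟨hc, h2⟩ | hc | hc <;> rw [hc] at r2 r3 r4 r5 r6 r7 r8 r9 r10 r11 <;>
    norm_num at r2 r3 r4 r5 r6 r7 r8 r9 r10 r11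
  · refine ⟨hbound fun n hn ↦ ?_, fun h ↦ absurd h2 h⟩
    interval_cases n <;> rw [abs_le] <;> constructor <;> norm_num <;> linarith
  · refine ⟨hbound fun n hn ↦ ?_, fun _ n h1 h2 ↦ ?_⟩
    · interval_cases n <;> rw [abs_le] <;> constructor <;> norm_num <;> linarith
    · interval_cases n <;> norm_num <;> linarith
  · refine ⟨hbound fun n hn ↦ ?_, fun _ n h1 h2 ↦ ?_⟩
    · interval_cases n <;> rw [abs_le] <;> constructor <;> norm_num <;> linarith
    · interval_cases n <;> norm_num <;> linarith

lemma abs_gg_prime_pow_le {p : ℕ} (hp : p.Prime) {q r : ℝ} (hq : 0 < q) (hqr : q ≤ r)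
    (h2 : p = 2 → q = r) (n : ℕ) :
    |gg (p ^ n)| * q ^ n ≤ (if n = 0 then 1 else 0) + 4 * (q / r) ^ 5 * r ^ n := by
  have hr : 0 < r := hq.trans_le hqr
  obtain ⟨h4, h0⟩ := gg_prime_pow hp
  rcases eq_or_ne n 0 with rfl | hn
  · have : gg (p ^ 0) = 1 := by rw [pow_zero, gg_isMultiplicative.1]
    rw [this]
    simp
    positivity
  rw [if_neg hn, zero_add]
  by_cases hp2 : p = 2
  · rw [h2 hp2, div_self hr.ne', one_pow, mul_one]
    gcongr
    exact h4 n
  rcases lt_or_ge 4 n with h5 | h5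
  · obtain ⟨k, rfl⟩ := Nat.exists_eq_add_of_le (show 5 ≤ n from h5)
    calc _ ≤ 4 * (q ^ 5 * q ^ k) := by
          rw [← pow_add]
          gcongr
          exact h4 _
      _ ≤ 4 * (q ^ 5 * r ^ k) := by gcongr
      _ = _ := by
        rw [div_pow, pow_add]
        field_simp
  · rw [h0 hp2 n (Nat.pos_of_ne_zero hn) h5]
    simp
    positivity

lemma exists_sum_gg_le :
    ∃ T : ℝ, ∀ N : ℕ, ∑ e ∈ Ioc 0 N, |gg e| * (e : ℝ) ^ (-(1 / 4) : ℝ) ≤ T := by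
  set r : ℝ := (2 : ℝ) ^ (-(1 / 4) : ℝ) with hrdef
  have hr0 : 0 < r := by positivity
  have hr1 : r < 1 := Real.rpow_lt_one_of_one_lt_of_neg (by norm_num) (by norm_num)
  set f : ℕ → ℝ := fun n ↦ |gg n| * (n : ℝ) ^ (-(1 / 4) : ℝ) with hf
  have hf0 : ∀ n, 0 ≤ f n := fun n ↦ by positivity
  have hf1 : f 1 = 1 := by simp [hf, gg_isMultiplicative.1]
  have hmul : ∀ {m n : ℕ}, m.Coprime n → f (m * n) = f m * f n := fun {m n} hmn ↦ by
    simp only [hf]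
    rw [gg_isMultiplicative.2 hmn, Nat.cast_mul,
      Real.mul_rpow (Nat.cast_nonneg _) (Nat.cast_nonneg _), abs_mul]
    ring
  set B : ℝ := 4 / r ^ 5 * (1 - r)⁻¹ with hB
  have hB0 : 0 ≤ B := by
    have : 0 < 1 - r := by linarith
    positivity
  have hloc : ∀ {p : ℕ}, p.Prime → Summable (fun n ↦ f (p ^ n)) ∧
      ∑' n, f (p ^ n) ≤ Real.exp (B * (p : ℝ) ^ (-(5 / 4) : ℝ)) := fun {p} hp ↦ by
    set q : ℝ := (p : ℝ) ^ (-(1 / 4) : ℝ) with hqdef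
    have hp0 : (0 : ℝ) < p := mod_cast hp.pos
    have hq0 : 0 < q := by positivity
    have hqr : q ≤ r :=
      Real.rpow_le_rpow_of_nonpos (by norm_num) (mod_cast hp.two_le) (by norm_num)
    have hle : ∀ n, f (p ^ n) ≤ (if n = 0 then 1 else 0) + 4 * (q / r) ^ 5 * r ^ n := fun n ↦ by
      have := abs_gg_prime_pow_le hp hq0 hqr (fun h ↦ by simp [hqdef, hrdef, h]) n
      have hpow : ((p ^ n : ℕ) : ℝ) ^ (-(1 / 4) : ℝ) = q ^ n := by
        rw [hqdef, Nat.cast_pow, ← Real.rpow_natCast, ← Real.rpow_natCast, ← Real.rpow_mul hp0.le,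
          ← Real.rpow_mul hp0.le, mul_comm]
      simpa only [hf, hpow] using this
    have hsum : HasSum (fun n : ℕ ↦ (if n = 0 then (1 : ℝ) else 0) + 4 * (q / r) ^ 5 * r ^ n)
        (1 + 4 * (q / r) ^ 5 * (1 - r)⁻¹) :=
      (hasSum_ite_eq 0 1).add ((hasSum_geometric_of_lt_one hr0.le hr1).mul_left _)
    have hs := Summable.of_nonneg_of_le (fun n ↦ hf0 _) hle hsum.summable
    refine ⟨hs, ?_⟩
    calc ∑' n, f (p ^ n) ≤ 1 + 4 * (q / r) ^ 5 * (1 - r)⁻¹ :=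
          (hs.tsum_le_tsum hle hsum.summable).trans_eq hsum.tsum_eq
      _ = B * (p : ℝ) ^ (-(5 / 4) : ℝ) + 1 := by
        have : (p : ℝ) ^ (-(5 / 4) : ℝ) = q ^ 5 := by
          rw [hqdef, ← Real.rpow_natCast, ← Real.rpow_mul hp0.le]
          norm_num
        rw [this, hB, div_pow]
        ring
      _ ≤ _ := Real.add_one_le_exp _
  have hz : Summable fun n : ℕ ↦ (n : ℝ) ^ (-(5 / 4) : ℝ) :=
    Real.summable_nat_rpow.mpr (by norm_num)
  refine ⟨Real.exp (B * ∑' n : ℕ, (n : ℝ) ^ (-(5 / 4) : ℝ)), fun N ↦ ?_⟩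
  obtain ⟨-, h⟩ := EulerProduct.summable_and_hasSum_smoothNumbers_prod_primesBelow_tsum hf1 hmul
    (fun {p} hp ↦ by simpa only [Real.norm_of_nonneg (hf0 _)] using (hloc hp).1) (N + 1)
  calc ∑ e ∈ Ioc 0 N, f e
      = ∑ e ∈ (Ioc 0 N).subtype (· ∈ (N + 1).smoothNumbers), f e := by
        rw [sum_subtype_of_mem]
        intro e he
        rw [mem_Ioc] at he
        exact Nat.mem_smoothNumbers_of_lt he.1 (by omega)
    _ ≤ ∏ p ∈ (N + 1).primesBelow, ∑' n : ℕ, f (p ^ n) := sum_le_hasSum _ (fun _ _ ↦ hf0 _) h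
    _ ≤ ∏ p ∈ (N + 1).primesBelow, Real.exp (B * (p : ℝ) ^ (-(5 / 4) : ℝ)) :=
        prod_le_prod (fun p _ ↦ tsum_nonneg fun _ ↦ hf0 _)
          fun p hp ↦ (hloc (Nat.prime_of_mem_primesBelow hp)).2
    _ = Real.exp (B * ∑ p ∈ (N + 1).primesBelow, (p : ℝ) ^ (-(5 / 4) : ℝ)) := by
        rw [← Real.exp_sum, mul_sum]
    _ ≤ _ := by
        gcongr
        exact hz.sum_le_tsum _ fun _ _ ↦ by positivity

lemma abs_mu_le (n : ℕ) : |mu n| ≤ 1 := by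
  rw [mu, ArithmeticFunction.intCoe_apply]
  exact_mod_cast ArithmeticFunction.abs_moebius_le_one

lemma hasAsymp_ff : ∃ a b : ℝ, HasAsymp ff a b 2 := by
  obtain ⟨a, b, h⟩ := hasAsymp_vv
  obtain ⟨G₁, G₂, C, hG, -⟩ := isConvAdmissible_pw_four abs_mu_le
  obtain ⟨T, hT⟩ := exists_sum_gg_le
  obtain ⟨H₁, H₂, hH⟩ := isConvAdmissible_of_bounded hT
  exact ⟨_, _, gg_mul ▸ (h.mul hG).mul hH⟩

/-- The indicator function of the odd numbers. -/
noncomputable def od : ArithmeticFunction ℝ := chi.pmul chi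

lemma od_apply (n : ℕ) : od n = if n % 2 = 1 then 1 else 0 := by
  rw [od, ArithmeticFunction.pmul_apply, chi_eq]
  rcases Nat.mod_two_eq_zero_or_one n with h | h
  · simp [h]
  · simp only [h, one_ne_zero, if_false, if_true]
    split_ifs <;> norm_num

lemma od_isMultiplicative : od.IsMultiplicative := chi_isMultiplicative.pmul chi_isMultiplicative

lemma od_pow (p k : ℕ) : od (p ^ k) = od p ^ k := by
  rw [od, ArithmeticFunction.pmul_apply, chi_pow, ArithmeticFunction.pmul_apply, mul_pow]

lemma od_mul_self (n : ℕ) : od n * od n = od n := by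
  rw [od_apply]
  split_ifs <;> simp

/-- The product of the Möbius function with the indicator function of the odd numbers. -/
noncomputable def muOd : ArithmeticFunction ℝ := mu.pmul od

/-- The indicator function of the odd squarefree numbers. -/
noncomputable def sqodd : ArithmeticFunction ℝ := (mu.pmul mu).pmul od

lemma sqodd_apply (n : ℕ) : sqodd n = if Squarefree n ∧ n % 2 = 1 then 1 else 0 := by
  rw [sqodd, ArithmeticFunction.pmul_apply, ArithmeticFunction.pmul_apply, od_apply, mu,
    ArithmeticFunction.intCoe_apply, ← Int.cast_mul, ← sq, ArithmeticFunction.moebius_sq]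
  by_cases h1 : Squarefree n <;> by_cases h2 : n % 2 = 1 <;> simp [h1, h2]

lemma sqodd_isMultiplicative : sqodd.IsMultiplicative :=
  (mu_isMultiplicative.pmul mu_isMultiplicative).pmul od_isMultiplicative

lemma sqodd_prime_pow {p : ℕ} (hp : p.Prime) (k : ℕ) :
    sqodd (p ^ k) = if k = 0 then 1 else if k = 1 then od p else 0 := by
  rw [sqodd, ArithmeticFunction.pmul_apply, ArithmeticFunction.pmul_apply, mu_prime_pow hp, od_pow]
  split_ifs with h0 h1
  · simp [h0]
  · simp [h1]
  · simp

lemma muOd_isMultiplicative : muOd.IsMultiplicative := mu_isMultiplicative.pmul od_isMultiplicative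

lemma muOd_prime_pow {p : ℕ} (hp : p.Prime) (k : ℕ) :
    muOd (p ^ k) = if k = 0 then 1 else if k = 1 then -od p else 0 := by
  rw [muOd, ArithmeticFunction.pmul_apply, mu_prime_pow hp, od_pow]
  split_ifs with h0 h1
  · simp [h0]
  · simp [h1]
  · simp

lemma sqodd_eq : sqodd = od * pw 2 muOd := by
  refine eq_of_locser_eq sqodd_isMultiplicative (od_isMultiplicative.mul
    (pw_isMultiplicative two_ne_zero muOd_isMultiplicative)) fun p hp ↦ ?_
  rw [locser_mul hp, locser_pw two_ne_zero hp (muOd_prime_pow hp)]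
  ext k
  rw [coeff_mul_one_sub, coeff_locser, coeff_locser, sqodd_prime_pow hp, od_pow]
  rcases k with _ | _ | k
  · simp
  · simp
  · rw [coeff_locser, od_pow, if_neg (by omega), if_neg (by omega), if_pos (by omega),
      show k + 1 + 1 - 2 = k by omega, pow_succ, pow_succ, mul_assoc, od_mul_self, mul_comm, sub_self]

lemma pw_two_pw_two (h : ArithmeticFunction ℝ) : pw 2 (pw 2 h) = pw 4 h := by
  ext n
  by_cases hn : ∃ m : ℕ, m ^ 4 = n
  · obtain ⟨m, rfl⟩ := hn
    rw [pw_pow four_ne_zero, show m ^ 4 = (m ^ 2) ^ 2 by ring, pw_pow two_ne_zero,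
      pw_pow two_ne_zero]
  · push Not at hn
    rw [pw_eq_zero h hn]
    by_cases h2 : ∃ m : ℕ, m ^ 2 = n
    · obtain ⟨m, rfl⟩ := h2
      rw [pw_pow two_ne_zero, pw_eq_zero]
      rintro j rfl
      exact hn j (by ring)
    · push Not at h2
      exact pw_eq_zero _ h2

lemma pw_two_sqodd : pw 2 sqodd = pw 4 muOd * pw 2 od := by
  rw [sqodd_eq, pw_mul two_ne_zero, pw_two_pw_two, mul_comm]

lemma sum_od (N : ℕ) : ∑ n ∈ Ioc 0 N, od n = ((N + 1) / 2 : ℕ) := by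
  induction N with
  | zero => simp
  | succ N ih =>
    rw [sum_Ioc_succ_top (by omega), ih, od_apply]
    rcases Nat.mod_two_eq_zero_or_one N with h | h
    · rw [if_pos (by omega), show (N + 1 + 1) / 2 = (N + 1) / 2 + 1 by omega]
      push_cast
      ring
    · rw [if_neg (by omega), show (N + 1 + 1) / 2 = (N + 1) / 2 by omega, add_zero]

lemma hasAsymp_pw_two_od : HasAsymp (pw 2 od) (1 / 2) 0 0 := by
  refine ⟨1, zero_le_one, fun Y hY ↦ ?_⟩
  have h1 : 1 ≤ Y ^ ((1 : ℝ) / 4) := Real.one_le_rpow hY (by norm_num)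
  set M := ⌊Y⌋₊.sqrt with hM
  have hfilter : (Ioc 0 ⌊Y⌋₊).filter (fun m ↦ m ^ 2 ≤ ⌊Y⌋₊) = Ioc 0 M := by
    ext m
    simp only [mem_filter, mem_Ioc, hM, Nat.le_sqrt']
    exact ⟨fun h ↦ ⟨h.1.1, h.2⟩, fun h ↦ ⟨⟨h.1, (Nat.le_self_pow two_ne_zero m).trans h.2⟩, h.2⟩⟩
  have hY0 : 0 ≤ Y := by linarith
  have hle : (M : ℝ) ≤ √Y := by
    have : M ^ 2 ≤ ⌊Y⌋₊ := Nat.sqrt_le' _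
    exact Real.le_sqrt_of_sq_le (mod_cast (Nat.le_floor_iff hY0).mp this)
  have hlt : √Y < M + 1 := by
    rw [Real.sqrt_lt' (by positivity)]
    have : ⌊Y⌋₊ < (M + 1) ^ 2 := Nat.lt_succ_sqrt' _
    exact_mod_cast (Nat.floor_lt hY0).mp this
  have hk1 : (M : ℝ) ≤ 2 * ((M + 1) / 2 : ℕ) := by
    exact_mod_cast (by omega : M ≤ 2 * ((M + 1) / 2))
  have hk2 : 2 * (((M + 1) / 2 : ℕ) : ℝ) ≤ M + 1 := by
    exact_mod_cast (by omega : 2 * ((M + 1) / 2) ≤ M + 1)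
  rw [sum_pw two_ne_zero, hfilter, sum_od, rpow_half_eq_sqrt, pow_zero, abs_le]
  constructor <;> linarith

lemma abs_muOd_le (n : ℕ) : |muOd n| ≤ 1 := by
  rw [muOd, ArithmeticFunction.pmul_apply, abs_mul, od_apply]
  have := abs_mu_le n
  split_ifs <;> simp [this]

lemma half_le_sum_muOd {N : ℕ} (hN : 2 ≤ N) :
    1 / 2 + 1 / (N : ℝ) ≤ ∑ n ∈ Ioc 0 N, muOd n * (n : ℝ) ^ (-2 : ℝ) := by
  induction N, hN using Nat.le_induction with
  | base =>
    have h2 : muOd 2 = 0 := by simp [muOd, od_apply]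
    have : Ioc 0 2 = {1, 2} := rfl
    rw [this, sum_pair (by norm_num), h2, muOd_isMultiplicative.1]
    norm_num
  | succ N hN ih =>
    rw [sum_Ioc_succ_top (by omega)]
    have hN0 : (0 : ℝ) < N := by positivity
    have h1 := (abs_le.mp (abs_muOd_le (N + 1))).1
    have h2 : ((N + 1 : ℕ) : ℝ) ^ (-2 : ℝ) ≤ 1 / (N : ℝ) - 1 / ((N + 1 : ℕ) : ℝ) := by
      rw [Real.rpow_neg (by positivity), Real.rpow_two, div_sub_div _ _ hN0.ne' (by positivity),
        inv_eq_one_div, div_le_div_iff₀ (by positivity) (by positivity)]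
      push_cast
      nlinarith
    have h3 : 0 ≤ ((N + 1 : ℕ) : ℝ) ^ (-2 : ℝ) := by positivity
    nlinarith

lemma hasAsymp_sqodd : ∃ a b : ℝ, 0 < a ∧ HasAsymp (pw 2 sqodd) a b 1 := by
  obtain ⟨G₁, G₂, C, hG, hlim⟩ := isConvAdmissible_pw_four abs_muOd_le
  refine ⟨1 / 2 * G₁, 0 * G₂, ?_, ?_⟩
  · by_contra! hneg
    obtain ⟨N, hN⟩ := exists_nat_gt (max 2 (2 * C))
    have hN2 : (2 : ℝ) < N := (le_max_left _ _).trans_lt hN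
    have hNC : 2 * C < N := (le_max_right _ _).trans_lt hN
    have h1 := half_le_sum_muOd (N := N) (by exact_mod_cast hN2.le)
    have h2 := (abs_le.mp (hlim N (by linarith))).2
    rw [Nat.floor_natCast] at h2
    have h3 : C * (N : ℝ) ^ (-1 : ℝ) ≤ 1 / 2 := by
      rw [Real.rpow_neg_one, ← div_eq_mul_inv, div_le_iff₀ (by linarith)]
      linarith
    have h4 : 0 < 1 / (N : ℝ) := by positivity
    linarith
  · rw [pw_two_sqodd]
    exact hasAsymp_pw_two_od.mul hG

lemma pw_two_sqodd_le_ff (n : ℕ) : pw 2 sqodd n ≤ ff n := by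
  rcases eq_or_ne n 0 with rfl | hn
  · simp
  have hm := pw_isMultiplicative two_ne_zero sqodd_isMultiplicative
  rw [hm.multiplicative_factorization _ hn, ff_isMultiplicative.multiplicative_factorization _ hn]
  have hsq0 : ∀ n, 0 ≤ sqodd n := fun n ↦ by
    rw [sqodd_apply]
    split_ifs <;> norm_num
  refine prod_le_prod (fun p hp ↦ ?_) fun p hp ↦ ?_
  · have hp := Nat.prime_of_mem_primeFactors hp
    beta_reduce
    rw [pw_prime_pow two_ne_zero _ hp]
    split_ifs
    · exact hsq0 _
    · exact le_rfl
  · have hp := Nat.prime_of_mem_primeFactors hp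
    beta_reduce
    rw [pw_prime_pow two_ne_zero _ hp, ff, mulOf_prime_pow _ (by simp [ffLoc]) hp,
      sqodd_prime_pow hp, ffLoc]
    generalize n.factorization p = k
    have h0 : 0 ≤ chi p ^ 2 + chi p := by
      rcases chi_prime hp with ⟨h, -⟩ | h | h <;> rw [h] <;> norm_num
    have h1 : od p = chi p ^ 2 := by rw [od, ArithmeticFunction.pmul_apply, sq]
    by_cases k0 : k = 0
    · simp [k0]
    by_cases k2 : k = 2
    · simp [k2, h1]
    rw [if_neg k0, if_neg k2]
    split_ifs <;> first | exact h0 | exact le_rfl | (exfalso; omega)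

/-- Pairs of coprime odd squarefree numbers, the first of which has only prime factors that
are `1` modulo `4`. -/
structure IsOddPair (D u : ℕ) : Prop where
  squarefree_left : Squarefree D
  mod_four : ∀ p : ℕ, p.Prime → p ∣ D → p % 4 = 1
  squarefree_right : Squarefree u
  odd_right : u % 2 = 1
  coprime : u.Coprime D

/-- The pairs `(D, u)` as in `IsOddPair` with `D ^ 3 * u ^ 2 ≤ N`. -/
noncomputable def oddPairs (N : ℕ) : Finset (ℕ × ℕ) :=
  {x ∈ Ioc 0 N ×ˢ Ioc 0 N | IsOddPair x.1 x.2 ∧ x.1 ^ 3 * x.2 ^ 2 ≤ N}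

lemma mem_oddPairs {N : ℕ} {x : ℕ × ℕ} :
    x ∈ oddPairs N ↔ IsOddPair x.1 x.2 ∧ x.1 ^ 3 * x.2 ^ 2 ≤ N := by
  rw [oddPairs, mem_filter, and_iff_right_iff_imp]
  rintro ⟨h, hN⟩
  have hD := Nat.pos_of_ne_zero h.squarefree_left.ne_zero
  have hu := Nat.pos_of_ne_zero h.squarefree_right.ne_zero
  simp only [mem_product, mem_Ioc]
  refine ⟨⟨hD, ?_⟩, hu, ?_⟩
  · exact ((Nat.le_self_pow three_ne_zero _).trans
      (Nat.le_mul_of_pos_right _ (pow_pos hu 2))).trans hN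
  · exact ((Nat.le_self_pow two_ne_zero _).trans
      (Nat.le_mul_of_pos_left _ (pow_pos hD 3))).trans hN

lemma IsOddPair.ff_eq {D u : ℕ} (h : IsOddPair D u) : ff (D ^ 3 * u ^ 2) = #D.divisors := by
  have hD := h.squarefree_left.ne_zero
  have hu := h.squarefree_right.ne_zero
  have h3 : ff (D ^ 3) = #D.divisors := by
    rw [Nat.card_divisors hD, ff, mulOf_apply _ (pow_ne_zero _ hD), Finsupp.prod,
      Nat.support_factorization, Nat.primeFactors_pow _ three_ne_zero, Nat.cast_prod]
    refine prod_congr rfl fun p hp ↦ ?_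
    have hpp := Nat.prime_of_mem_primeFactors hp
    have hpD := Nat.dvd_of_mem_primeFactors hp
    have h4 := h.mod_four p hpp hpD
    have h1 : D.factorization p = 1 := le_antisymm (h.squarefree_left.natFactorization_le_one p)
      (hpp.factorization_pos_of_dvd hD hpD)
    rw [Nat.factorization_pow, Finsupp.smul_apply, h1, ffLoc, chi_eq,
      if_neg (by omega : ¬ p % 2 = 0), if_pos h4]
    norm_num
  have h2 : ff (u ^ 2) = 1 := by
    rw [ff, mulOf_apply _ (pow_ne_zero _ hu), Finsupp.prod,
      Nat.support_factorization, Nat.primeFactors_pow _ two_ne_zero]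
    refine prod_eq_one fun p hp ↦ ?_
    have hpp := Nat.prime_of_mem_primeFactors hp
    have hpu := Nat.dvd_of_mem_primeFactors hp
    have hodd : p % 2 = 1 := by
      rcases hpp.eq_two_or_odd with rfl | h'
      · have := h.odd_right
        omega
      · exact h'
    have : chi p ^ 2 = 1 := by
      have := od_apply p
      rwa [od, ArithmeticFunction.pmul_apply, ← sq, if_pos hodd] at this
    have h1 : u.factorization p = 1 := le_antisymm (h.squarefree_right.natFactorization_le_one p)
      (hpp.factorization_pos_of_dvd hu hpu)
    rw [Nat.factorization_pow, Finsupp.smul_apply, h1, ffLoc]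
    simpa using this
  rw [ff_isMultiplicative.2 (Nat.Coprime.pow _ _ h.coprime.symm), h3, h2, mul_one]

lemma IsOddPair.factorization_eq {D u : ℕ} (h : IsOddPair D u) (p : ℕ) :
    D.factorization p = (D ^ 3 * u ^ 2).factorization p / 3 ∧
      u.factorization p = (D ^ 3 * u ^ 2).factorization p % 3 / 2 := by
  have hD := h.squarefree_left.ne_zero
  have hu := h.squarefree_right.ne_zero
  have h1 := h.squarefree_left.natFactorization_le_one p
  have h2 := h.squarefree_right.natFactorization_le_one p
  have h3 : D.factorization p = 0 ∨ u.factorization p = 0 := by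
    by_contra! hne
    have h1 := Nat.dvd_of_factorization_pos hne.1
    have h2 := Nat.dvd_of_factorization_pos hne.2
    have hp : p.Prime := by
      by_contra hp
      exact hne.1 (Nat.factorization_eq_zero_of_not_prime _ hp)
    exact Nat.not_coprime_of_dvd_of_dvd hp.one_lt h2 h1 h.coprime
  rw [Nat.factorization_mul (pow_ne_zero _ hD) (pow_ne_zero _ hu), Nat.factorization_pow,
    Nat.factorization_pow]
  simp only [Finsupp.add_apply, Finsupp.smul_apply, smul_eq_mul]
  omega

lemma IsOddPair.eq {D u D' u' : ℕ} (h : IsOddPair D u) (h' : IsOddPair D' u')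
    (heq : D ^ 3 * u ^ 2 = D' ^ 3 * u' ^ 2) : D = D' ∧ u = u' := by
  constructor
  · refine Nat.eq_of_factorization_eq h.squarefree_left.ne_zero h'.squarefree_left.ne_zero
      fun p ↦ ?_
    rw [(h.factorization_eq p).1, (h'.factorization_eq p).1, heq]
  · refine Nat.eq_of_factorization_eq h.squarefree_right.ne_zero h'.squarefree_right.ne_zero
      fun p ↦ ?_
    rw [(h.factorization_eq p).2, (h'.factorization_eq p).2, heq]

lemma squarefree_prod_of_forall_prime {s : Finset ℕ} (hs : ∀ p ∈ s, p.Prime) :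
    Squarefree (∏ p ∈ s, p) := by
  refine Finset.squarefree_prod_of_pairwise_isCoprime (f := fun p : ℕ ↦ p) ?_ ?_
  · intro p hp q hq hpq
    exact Nat.coprime_iff_isRelPrime.mp ((Nat.coprime_primes (hs p hp) (hs q hq)).mpr hpq)
  · exact fun p hp ↦ (hs p hp).squarefree

lemma exists_isOddPair_of_ff_ne_zero {n : ℕ} (h : ff n ≠ 0) :
    ∃ D u : ℕ, IsOddPair D u ∧ D ^ 3 * u ^ 2 = n := by
  have hn : n ≠ 0 := by rintro rfl; simp at h
  rw [ff, mulOf_apply _ hn, Finsupp.prod, prod_ne_zero_iff, Nat.support_factorization] at h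
  have hval : ∀ p ∈ n.primeFactors, (n.factorization p = 2 ∧ p % 2 = 1) ∨
      (n.factorization p = 3 ∧ p % 4 = 1) := by
    intro p hp
    have hpp := Nat.prime_of_mem_primeFactors hp
    have hp0 : n.factorization p ≠ 0 :=
      (hpp.factorization_pos_of_dvd hn (Nat.dvd_of_mem_primeFactors hp)).ne'
    have := h p hp
    rw [ffLoc, if_neg hp0, chi_eq] at this
    split_ifs at this with h2 h3 h4 h5 h6 h7 <;> norm_num at this
    · exact Or.inl ⟨h2, by omega⟩
    · exact Or.inl ⟨h2, by omega⟩
    · exact Or.inr ⟨by assumption, by assumption⟩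
  set A := n.primeFactors.filter (fun p ↦ n.factorization p = 3) with hA
  set B := n.primeFactors.filter (fun p ↦ ¬ n.factorization p = 3) with hB
  have hAp : ∀ p ∈ A, p.Prime := fun p hp ↦ Nat.prime_of_mem_primeFactors (mem_filter.mp hp).1
  have hBp : ∀ p ∈ B, p.Prime := fun p hp ↦ Nat.prime_of_mem_primeFactors (mem_filter.mp hp).1
  refine ⟨∏ p ∈ A, p, ∏ p ∈ B, p, ⟨squarefree_prod_of_forall_prime hAp, ?_,
    squarefree_prod_of_forall_prime hBp, ?_, ?_⟩, ?_⟩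
  · intro p hp hpD
    obtain ⟨q, hq, hpq⟩ := (hp.prime.dvd_finsetProd_iff _).mp hpD
    obtain rfl := (Nat.prime_dvd_prime_iff_eq hp (hAp q hq)).mp hpq
    rw [hA, mem_filter] at hq
    rcases hval p hq.1 with h' | h'
    · omega
    · exact h'.2
  · rw [← Nat.odd_iff]
    refine prod_induction _ Odd (fun _ _ ↦ Odd.mul) odd_one fun p hp ↦ ?_
    rw [hB, mem_filter] at hp
    rw [Nat.odd_iff]
    rcases hval p hp.1 with h' | h'
    · exact h'.2
    · exact absurd h'.1 hp.2
  · refine Nat.Coprime.prod_left fun p hp ↦ Nat.Coprime.prod_right fun q hq ↦ ?_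
    rw [Nat.coprime_primes (hBp p hp) (hAp q hq)]
    rintro rfl
    exact (mem_filter.mp hp).2 (mem_filter.mp hq).2
  · conv_rhs => rw [← Nat.prod_factorization_pow_eq_self hn, Finsupp.prod, Nat.support_factorization,
      ← prod_filter_mul_prod_filter_not _ (fun p ↦ n.factorization p = 3)]
    rw [← prod_pow, ← prod_pow]
    congr 1
    · exact prod_congr rfl fun p hp ↦ by rw [(mem_filter.mp hp).2]
    · refine prod_congr rfl fun p hp ↦ ?_
      rw [mem_filter] at hp
      rcases hval p hp.1 with h' | h'
      · rw [h'.1]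
      · exact absurd h'.1 hp.2

lemma sum_ff (N : ℕ) : ∑ n ∈ Ioc 0 N, ff n = ∑ x ∈ oddPairs N, (#x.1.divisors : ℝ) := by
  symm
  refine sum_of_injOn (fun x ↦ x.1 ^ 3 * x.2 ^ 2) ?_ ?_ ?_ ?_
  · rintro ⟨D, u⟩ hx ⟨D', u'⟩ hx' heq
    rw [mem_coe, mem_oddPairs] at hx hx'
    exact Prod.ext_iff.mpr (hx.1.eq hx'.1 heq)
  · intro x hx
    rw [mem_coe, mem_oddPairs] at hx
    have h1 := hx.1.squarefree_left.ne_zero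
    have h2 := hx.1.squarefree_right.ne_zero
    rw [mem_coe, mem_Ioc]
    exact ⟨by positivity, hx.2⟩
  · intro n hn hn'
    by_contra h
    obtain ⟨D, u, hDu, rfl⟩ := exists_isOddPair_of_ff_ne_zero h
    exact hn' ⟨(D, u), mem_oddPairs.mpr ⟨hDu, (mem_Ioc.mp hn).2⟩, rfl⟩
  · intro x hx
    exact ((mem_oddPairs.mp hx).1.ff_eq).symm

lemma sum_pw_two_sqodd (N : ℕ) :
    ∑ n ∈ Ioc 0 N, pw 2 sqodd n = #{x ∈ oddPairs N | x.1 = 1} := by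
  rw [sum_pw two_ne_zero, sum_congr rfl fun n _ ↦ sqodd_apply n, sum_boole, filter_filter]
  congr 1
  refine card_nbij' (fun u ↦ (1, u)) Prod.snd ?_ ?_ ?_ ?_
  · intro u hu
    simp only [coe_filter, mem_Ioc, Set.mem_ofPred_eq] at hu
    simp only [coe_filter, mem_oddPairs, Set.mem_ofPred_eq]
    refine ⟨⟨⟨squarefree_one, fun p hp h ↦ ?_, hu.2.2.1, hu.2.2.2, Nat.coprime_one_right _⟩, ?_⟩,
      trivial⟩
    · exact absurd (Nat.dvd_one.mp h) hp.ne_one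
    · simpa using hu.2.1
  · rintro ⟨D, u⟩ hx
    simp only [coe_filter, mem_oddPairs, Set.mem_ofPred_eq] at hx
    obtain ⟨⟨h, hN⟩, rfl⟩ := hx
    have hu := Nat.pos_of_ne_zero h.squarefree_right.ne_zero
    simp only [one_pow, one_mul] at hN
    simp only [coe_filter, mem_Ioc, Set.mem_ofPred_eq]
    exact ⟨⟨hu, (Nat.le_self_pow two_ne_zero u).trans hN⟩, hN, h.squarefree_right, h.odd_right⟩
  · intro u _
    rfl
  · rintro ⟨D, u⟩ hx
    simp only [coe_filter, mem_oddPairs, Set.mem_ofPred_eq] at hx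
    rw [hx.2]

lemma two_mul_card_divisors_not_dvd {D p : ℕ} (hD : Squarefree D) (hp : p.Prime) (hpD : p ∣ D) :
    2 * #{g ∈ D.divisors | ¬ p ∣ g} = #D.divisors := by
  have hD0 := hD.ne_zero
  rw [← card_filter_add_card_filter_not (s := D.divisors) (fun g ↦ p ∣ g), two_mul]
  congr 1
  refine card_nbij' (fun g ↦ p * g) (fun g ↦ g / p) ?_ ?_ ?_ ?_
  · intro g hg
    simp only [coe_filter, Nat.mem_divisors, Set.mem_ofPred_eq] at hg ⊢
    exact ⟨⟨Nat.Coprime.mul_dvd_of_dvd_of_dvd ((hp.coprime_iff_not_dvd).mpr hg.2) hpD hg.1.1, hD0⟩,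
      dvd_mul_right _ _⟩
  · intro g hg
    simp only [coe_filter, Nat.mem_divisors, Set.mem_ofPred_eq] at hg ⊢
    refine ⟨⟨(Nat.div_dvd_of_dvd hg.2).trans hg.1.1, hD0⟩, fun h ↦ ?_⟩
    obtain ⟨k, rfl⟩ := hg.2
    rw [Nat.mul_div_cancel_left _ hp.pos] at h
    exact hp.ne_one (Nat.isUnit_iff.mp (hD p ((mul_dvd_mul_left p h).trans hg.1.1)))
  · intro g _
    exact Nat.mul_div_cancel_left _ hp.pos
  · intro g hg
    simp only [coe_filter, Set.mem_ofPred_eq] at hg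
    exact Nat.mul_div_cancel' hg.2

/-- Triples `(D, u, g)` with `(D, u) ∈ oddPairs N` and `g ∣ D`. -/
noncomputable def oddTriples (N : ℕ) : Finset (Σ _ : ℕ × ℕ, ℕ) :=
  (oddPairs N).sigma fun x ↦ x.1.divisors

/-- Triples `(D, u, g)` in `oddTriples N` such that `1 < D` and `g` is prime to the smallest
prime factor of `D`. -/
noncomputable def reducedTriples (N : ℕ) : Finset (Σ _ : ℕ × ℕ, ℕ) :=
  {x ∈ oddPairs N | x.1 ≠ 1}.sigma fun x ↦ {g ∈ x.1.divisors | ¬ x.1.minFac ∣ g}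

lemma card_oddTriples (N : ℕ) : (#(oddTriples N) : ℝ) = ∑ n ∈ Ioc 0 N, ff n := by
  rw [sum_ff, oddTriples, card_sigma, Nat.cast_sum]

lemma card_reducedTriples (N : ℕ) :
    2 * (#(reducedTriples N) : ℝ) = ∑ n ∈ Ioc 0 N, ff n - ∑ n ∈ Ioc 0 N, pw 2 sqodd n := by
  rw [sum_ff, sum_pw_two_sqodd, reducedTriples, card_sigma, Nat.cast_sum, mul_sum,
    ← sum_filter_add_sum_filter_not (oddPairs N) (fun x ↦ x.1 = 1), card_eq_sum_ones, Nat.cast_sum]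
  have h1 : ∑ x ∈ oddPairs N with x.1 = 1, (#x.1.divisors : ℝ) =
      ∑ x ∈ oddPairs N with x.1 = 1, ((1 : ℕ) : ℝ) :=
    sum_congr rfl fun x hx ↦ by rw [(mem_filter.mp hx).2]; simp
  rw [h1, add_sub_cancel_left]
  refine sum_congr rfl fun x hx ↦ ?_
  rw [mem_filter, mem_oddPairs] at hx
  exact_mod_cast two_mul_card_divisors_not_dvd hx.1.1.squarefree_left
    (Nat.minFac_prime hx.2) (Nat.minFac_dvd _)

lemma IsOddPair.odd_left {D u : ℕ} (h : IsOddPair D u) : D % 2 = 1 := by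
  by_contra hD
  have := h.mod_four 2 Nat.prime_two (by omega)
  omega

lemma IsOddPair.isQuadIndex {D u : ℕ} (h : IsOddPair D u) (hD : D ≠ 1) : IsQuadIndex D := by
  have := h.squarefree_left.ne_zero
  refine ⟨by omega, h.squarefree_left, fun p hp hpD ↦ ?_⟩
  rw [h.mod_four p hp hpD]
  norm_num

lemma IsQuarticIndex.mod_four_eq_one {D g u : ℕ} {ε : ℤ} (h : IsQuarticIndex D g u ε) {p : ℕ}
    (hp : p.Prime) (hpD : p ∣ D) (hp2 : p ≠ 2) : p % 4 = 1 := by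
  have h3 := h.quad.mod_four p hp hpD
  have := hp.eq_two_or_odd
  omega

lemma isQuarticIndex_iff_of_odd {D g u : ℕ} {ε : ℤ} (hD : D % 2 = 1) (hu : u % 2 = 1) :
    IsQuarticIndex D g u ε ↔
      (IsOddPair D u ∧ D ≠ 1 ∧ g ∣ D ∧ ¬ D.minFac ∣ g) ∧ ε ^ 2 = 1 := by
  constructor
  · intro h
    refine ⟨⟨⟨h.quad.squarefree, fun p hp hpD ↦ h.mod_four_eq_one hp hpD ?_, h.squarefree, hu,
      h.coprime⟩,
      h.quad.one_lt.ne', h.dvd, h.minFac⟩, h.sq_sign⟩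
    rintro rfl
    omega
  · rintro ⟨⟨h, hD1, hg, hmin⟩, hε⟩
    exact ⟨h.isQuadIndex hD1, hg, hmin, h.squarefree_right, h.coprime, hε⟩

lemma isQuarticIndex_two_mul_right_iff {D g v : ℕ} {ε : ℤ} (hD : D % 2 = 1) :
    IsQuarticIndex D g (2 * v) ε ↔
      (IsOddPair D v ∧ D ≠ 1 ∧ g ∣ D ∧ ¬ D.minFac ∣ g) ∧ ε ^ 2 = 1 := by
  constructor
  · intro h
    have hsq := (Nat.squarefree_mul_iff (m := 2) (n := v)).mp h.squarefree
    refine ⟨⟨⟨h.quad.squarefree, fun p hp hpD ↦ h.mod_four_eq_one hp hpD ?_, hsq.2.2,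
      Nat.odd_iff.mp (Nat.coprime_two_left.mp hsq.1), Nat.Coprime.coprime_mul_left h.coprime⟩,
      h.quad.one_lt.ne',
      h.dvd, h.minFac⟩, h.sq_sign⟩
    rintro rfl
    omega
  · rintro ⟨⟨h, hD1, hg, hmin⟩, hε⟩
    refine ⟨h.isQuadIndex hD1, hg, hmin, ?_, ?_, hε⟩
    · exact Nat.squarefree_mul_iff.mpr ⟨Nat.coprime_two_left.mpr (Nat.odd_iff.mpr h.odd_right),
        Nat.prime_two.squarefree, h.squarefree_right⟩
    · exact Nat.Coprime.mul_left (Nat.coprime_two_left.mpr (Nat.odd_iff.mpr hD)) h.coprime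

lemma isQuarticIndex_two_mul_left_iff {m g u : ℕ} {ε : ℤ} :
    IsQuarticIndex (2 * m) g u ε ↔ (IsOddPair m u ∧ g ∣ m) ∧ ε ^ 2 = 1 := by
  have hmin : (2 * m).minFac = 2 := (Nat.minFac_eq_two_iff _).mpr (dvd_mul_right _ _)
  constructor
  · intro h
    have hsq := (Nat.squarefree_mul_iff (m := 2) (n := m)).mp h.quad.squarefree
    have hm := Nat.odd_iff.mp (Nat.coprime_two_left.mp hsq.1)
    refine ⟨⟨⟨hsq.2.2, fun p hp hpD ↦ h.mod_four_eq_one hp (hpD.mul_left 2) ?_, h.squarefree,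
      Nat.odd_iff.mp (Nat.coprime_two_right.mp (Nat.Coprime.coprime_mul_right_right h.coprime)),
      Nat.Coprime.coprime_mul_left_right h.coprime⟩, ?_⟩, h.sq_sign⟩
    · rintro rfl
      omega
    · have h2 := h.minFac
      rw [hmin] at h2
      exact (((Nat.prime_two.coprime_iff_not_dvd).mpr h2).symm).dvd_of_dvd_mul_left h.dvd
  · rintro ⟨⟨h, hg⟩, hε⟩
    have hm := h.odd_left
    have hm0 := h.squarefree_left.ne_zero
    refine ⟨⟨by omega, ?_, fun p hp hpD ↦ ?_⟩, hg.mul_left 2, ?_, h.squarefree_right, ?_, hε⟩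
    · exact Nat.squarefree_mul_iff.mpr ⟨Nat.coprime_two_left.mpr (Nat.odd_iff.mpr hm),
        Nat.prime_two.squarefree, h.squarefree_left⟩
    · rcases (hp.dvd_mul).mp hpD with h2 | h2
      · rw [(Nat.prime_dvd_prime_iff_eq hp Nat.prime_two).mp h2]
        norm_num
      · rw [h.mod_four p hp h2]
        norm_num
    · rw [hmin]
      intro h2
      have := h2.trans hg
      omega
    · exact Nat.Coprime.mul_right (Nat.coprime_two_right.mpr (Nat.odd_iff.mpr h.odd_right)) h.coprime

/-- The sign for which the field with odd parameters `D`, `g`, `u` is unramified at `2`. -/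
noncomputable def unramSign (D g u : ℕ) : ℤ :=
  if (g * u * (D - sqPart D) : ℤ) % 4 = 1 then 1 else -1

lemma unramSign_sq (D g u : ℕ) : unramSign D g u ^ 2 = 1 := by
  rw [unramSign]
  split_ifs <;> norm_num

lemma quarticDisc_of_odd {D g u : ℕ} {ε : ℤ} (hD : IsQuadIndex D) (hD2 : D % 2 = 1)
    (hu : u % 2 = 1) (hg : g ∣ D) (hε : ε ^ 2 = 1) :
    quarticDisc D (sqPart D) g ε u =
      (if ε = unramSign D g u then 1 else 16) * (D ^ 3 * u ^ 2 : ℕ) := by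
  obtain ⟨C, -, hB⟩ := hD.sqPart_spec
  have hD2' : (D : ℤ) % 2 = 1 := by omega
  have hu' : (u : ℤ) % 2 = 1 := by omega
  have hB := hB hD2'
  have hg2 : g % 2 = 1 := by
    obtain ⟨k, rfl⟩ := hg
    by_contra h
    rw [Nat.mul_mod, show g % 2 = 0 by omega] at hD2
    simp at hD2
  have ha : (g * u * (D - sqPart D) : ℤ) % 2 = 1 := by
    rw [← Int.odd_iff]
    have h1 : Odd (g : ℤ) := by rw [Int.odd_iff]; omega
    have h2 : Odd (u : ℤ) := by rw [Int.odd_iff]; omega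
    have h3 : Odd ((D : ℤ) - sqPart D) := by rw [Int.odd_iff]; omega
    exact (h1.mul h2).mul h3
  have hassoc : ε * g * u * (D - sqPart D) = ε * (g * u * (D - sqPart D)) := by ring
  rw [quarticDisc, if_pos hD2', if_pos hu', hassoc, unramSign]
  generalize (g * u * (D - sqPart D) : ℤ) = a at ha
  push_cast
  rcases mul_self_eq_one_iff.mp (sq ε ▸ hε) with rfl | rfl
  · split_ifs <;> first | (exfalso; omega) | ring
  · split_ifs <;> first | (exfalso; omega) | ring

lemma quarticDisc_two_mul_right {D g v : ℕ} {B ε : ℤ} (hD : D % 2 = 1) :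
    quarticDisc D B g ε (2 * v : ℕ) = 64 * (D ^ 3 * v ^ 2 : ℕ) := by
  rw [quarticDisc, if_pos (by omega), if_neg (by omega)]
  push_cast
  ring

lemma quarticDisc_two_mul_left {m g u : ℕ} {B ε : ℤ} :
    quarticDisc (2 * m : ℕ) B g ε u = 2048 * (m ^ 3 * u ^ 2 : ℕ) := by
  rw [quarticDisc, if_neg (by omega)]
  push_cast
  ring

lemma mem_oddTriples {N D u g : ℕ} : (⟨(D, u), g⟩ : Σ _ : ℕ × ℕ, ℕ) ∈ oddTriples N ↔
    (IsOddPair D u ∧ g ∣ D) ∧ D ^ 3 * u ^ 2 ≤ N := by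
  rw [oddTriples, mem_sigma, mem_oddPairs, Nat.mem_divisors]
  exact ⟨fun h ↦ ⟨⟨h.1.1, h.2.1⟩, h.1.2⟩,
    fun h ↦ ⟨⟨h.1.1, h.2⟩, h.1.2, h.1.1.squarefree_left.ne_zero⟩⟩

lemma mem_reducedTriples {N D u g : ℕ} : (⟨(D, u), g⟩ : Σ _ : ℕ × ℕ, ℕ) ∈ reducedTriples N ↔
    (IsOddPair D u ∧ D ≠ 1 ∧ g ∣ D ∧ ¬ D.minFac ∣ g) ∧ D ^ 3 * u ^ 2 ≤ N := by
  rw [reducedTriples, mem_sigma, mem_filter, mem_filter, mem_oddPairs, Nat.mem_divisors]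
  exact ⟨fun h ↦ ⟨⟨h.1.1.1, h.1.2, h.2.1.1, h.2.2⟩, h.1.1.2⟩,
    fun h ↦ ⟨⟨⟨h.1.1, h.2⟩, h.1.2.1⟩, ⟨h.1.2.2.1, h.1.1.squarefree_left.ne_zero⟩, h.1.2.2.2⟩⟩

lemma le_floor_div_iff {X : ℝ} (hX : 0 ≤ X) {c : ℕ} (hc : 0 < c) (n : ℕ) :
    n ≤ ⌊X / c⌋₊ ↔ (((c : ℤ) * (n : ℕ) : ℤ) : ℝ) ≤ X := by
  have hc' : (0 : ℝ) < c := by exact_mod_cast hc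
  rw [Nat.le_floor_iff (by positivity), le_div_iff₀ hc']
  push_cast
  rw [mul_comm]

/-- The parameters of the cyclic quartic fields of discriminant at most `X`. -/
noncomputable def indexFinset (X : ℝ) : Finset (ℕ × ℕ × ℕ × ℤ) :=
  (((reducedTriples ⌊X / (1 : ℕ)⌋₊).image
      fun x ↦ (x.1.1, x.2, x.1.2, unramSign x.1.1 x.2 x.1.2)) ∪
    ((reducedTriples ⌊X / (16 : ℕ)⌋₊).image
      fun x ↦ (x.1.1, x.2, x.1.2, -unramSign x.1.1 x.2 x.1.2)) ∪
    ((reducedTriples ⌊X / (64 : ℕ)⌋₊ ×ˢ {1, -1}).image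
      fun y ↦ (y.1.1.1, y.1.2, 2 * y.1.1.2, y.2))) ∪
    ((oddTriples ⌊X / (2048 : ℕ)⌋₊ ×ˢ {1, -1}).image
      fun y ↦ (2 * y.1.1.1, y.1.2, y.1.1.2, y.2))

lemma mem_indexFinset {X : ℝ} (hX : 0 ≤ X) (i : ℕ × ℕ × ℕ × ℤ) :
    i ∈ indexFinset X ↔ IsQuarticIndex i.1 i.2.1 i.2.2.1 i.2.2.2 ∧
      (quarticDisc i.1 (sqPart i.1) i.2.1 i.2.2.2 i.2.2.1 : ℝ) ≤ X := by
  have hsign : ∀ ε : ℤ, ε ∈ ({1, -1} : Finset ℤ) ↔ ε ^ 2 = 1 := fun ε ↦ by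
    rw [mem_insert, mem_singleton, sq, mul_self_eq_one_iff]
  simp only [indexFinset, mem_union, mem_image, mem_product, hsign]
  constructor
  · rintro (((⟨⟨⟨D, u⟩, g⟩, h, rfl⟩ | ⟨⟨⟨D, u⟩, g⟩, h, rfl⟩) | ⟨⟨⟨⟨D, v⟩, g⟩, ε⟩, ⟨h, hε⟩, rfl⟩) |
      ⟨⟨⟨⟨m, u⟩, g⟩, ε⟩, ⟨h, hε⟩, rfl⟩)
    · rw [mem_reducedTriples, le_floor_div_iff hX one_pos] at h
      have hi := (isQuarticIndex_iff_of_odd h.1.1.odd_left h.1.1.odd_right).mpr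
        ⟨h.1, unramSign_sq D g u⟩
      refine ⟨hi, ?_⟩
      rw [quarticDisc_of_odd hi.quad h.1.1.odd_left h.1.1.odd_right hi.dvd hi.sq_sign, if_pos rfl]
      exact h.2
    · rw [mem_reducedTriples, le_floor_div_iff hX (by norm_num)] at h
      have hs := unramSign_sq D g u
      have hi := (isQuarticIndex_iff_of_odd (ε := -unramSign D g u) h.1.1.odd_left
        h.1.1.odd_right).mpr ⟨h.1, by rw [neg_sq, hs]⟩
      refine ⟨hi, ?_⟩
      rw [quarticDisc_of_odd hi.quad h.1.1.odd_left h.1.1.odd_right hi.dvd hi.sq_sign, if_neg]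
      · exact h.2
      · intro h'
        rw [show unramSign D g u = 0 by omega] at hs
        norm_num at hs
    · rw [mem_reducedTriples, le_floor_div_iff hX (by norm_num)] at h
      refine ⟨(isQuarticIndex_two_mul_right_iff h.1.1.odd_left).mpr ⟨h.1, hε⟩, ?_⟩
      rw [quarticDisc_two_mul_right h.1.1.odd_left]
      exact h.2
    · rw [mem_oddTriples, le_floor_div_iff hX (by norm_num)] at h
      refine ⟨isQuarticIndex_two_mul_left_iff.mpr ⟨h.1, hε⟩, ?_⟩
      rw [quarticDisc_two_mul_left]
      exact h.2
  · obtain ⟨D, g, u, ε⟩ := i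
    rintro ⟨h, hle⟩
    simp only at h hle
    rcases Nat.even_or_odd' D with ⟨m, rfl | hD⟩
    · rw [quarticDisc_two_mul_left] at hle
      rw [isQuarticIndex_two_mul_left_iff] at h
      exact Or.inr ⟨⟨⟨(m, u), g⟩, ε⟩, ⟨mem_oddTriples.mpr
        ⟨h.1, (le_floor_div_iff hX (by norm_num) _).mpr hle⟩, h.2⟩, rfl⟩
    have hD : D % 2 = 1 := by omega
    rcases Nat.even_or_odd' u with ⟨v, rfl | hu⟩
    · rw [quarticDisc_two_mul_right hD] at hle
      rw [isQuarticIndex_two_mul_right_iff hD] at h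
      exact Or.inl (Or.inr ⟨⟨⟨(D, v), g⟩, ε⟩, ⟨mem_reducedTriples.mpr
        ⟨h.1, (le_floor_div_iff hX (by norm_num) _).mpr hle⟩, h.2⟩, rfl⟩)
    have hu : u % 2 = 1 := by omega
    rw [quarticDisc_of_odd h.quad hD hu h.dvd h.sq_sign] at hle
    rw [isQuarticIndex_iff_of_odd hD hu] at h
    refine Or.inl (Or.inl ?_)
    by_cases hε : ε = unramSign D g u
    · rw [if_pos hε] at hle
      exact Or.inl ⟨⟨(D, u), g⟩, mem_reducedTriples.mpr
        ⟨h.1, (le_floor_div_iff hX one_pos _).mpr hle⟩, by rw [hε]⟩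
    · rw [if_neg hε] at hle
      refine Or.inr ⟨⟨(D, u), g⟩, mem_reducedTriples.mpr
        ⟨h.1, (le_floor_div_iff hX (by norm_num) _).mpr hle⟩, ?_⟩
      rcases sq_eq_sq_iff_eq_or_eq_neg.mp (h.2.trans (unramSign_sq D g u).symm) with h' | h'
      · exact absurd h' hε
      · rw [h']

lemma card_indexFinset (X : ℝ) :
    #(indexFinset X) = #(reducedTriples ⌊X / (1 : ℕ)⌋₊) + #(reducedTriples ⌊X / (16 : ℕ)⌋₊) +
      #(reducedTriples ⌊X / (64 : ℕ)⌋₊) * 2 + #(oddTriples ⌊X / (2048 : ℕ)⌋₊) * 2 := by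
  have hpair : #({1, -1} : Finset ℤ) = 2 := rfl
  rw [indexFinset, card_union_of_disjoint, card_union_of_disjoint, card_union_of_disjoint,
    card_image_of_injective, card_image_of_injective, card_image_of_injective,
    card_image_of_injective, card_product, card_product, hpair]
  · rintro ⟨⟨⟨m, u⟩, g⟩, ε⟩ ⟨⟨⟨m', u'⟩, g'⟩, ε'⟩ h
    simp only [Prod.mk.injEq] at h
    obtain ⟨h1, rfl, rfl, rfl⟩ := h
    obtain rfl : m = m' := by omega
    rfl
  · rintro ⟨⟨⟨D, v⟩, g⟩, ε⟩ ⟨⟨⟨D', v'⟩, g'⟩, ε'⟩ h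
    simp only [Prod.mk.injEq] at h
    obtain ⟨rfl, rfl, h1, rfl⟩ := h
    obtain rfl : v = v' := by omega
    rfl
  · rintro ⟨⟨D, u⟩, g⟩ ⟨⟨D', u'⟩, g'⟩ h
    simp only [Prod.mk.injEq] at h
    obtain ⟨rfl, rfl, rfl, -⟩ := h
    rfl
  · rintro ⟨⟨D, u⟩, g⟩ ⟨⟨D', u'⟩, g'⟩ h
    simp only [Prod.mk.injEq] at h
    obtain ⟨rfl, rfl, rfl, -⟩ := h
    rfl
  · simp only [disjoint_left, mem_image, not_exists, not_and]
    rintro _ ⟨⟨⟨D, u⟩, g⟩, -, rfl⟩ ⟨⟨D', u'⟩, g'⟩ - h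
    simp only [Prod.mk.injEq] at h
    obtain ⟨rfl, rfl, rfl, h⟩ := h
    have hs := unramSign_sq D' g' u'
    rw [show unramSign D' g' u' = 0 by omega] at hs
    norm_num at hs
  · simp only [disjoint_left, mem_union, mem_image, not_exists, not_and]
    rintro _ (⟨⟨⟨D, u⟩, g⟩, h, rfl⟩ | ⟨⟨⟨D, u⟩, g⟩, h, rfl⟩) ⟨⟨⟨D', u'⟩, g'⟩, ε⟩ - heq <;>
    · have := (mem_reducedTriples.mp h).1.1.odd_right
      simp only [Prod.mk.injEq] at heq
      omega
  · simp only [disjoint_left, mem_union, mem_image, mem_product, not_exists, not_and]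
    rintro _ ((⟨⟨⟨D, u⟩, g⟩, h, rfl⟩ | ⟨⟨⟨D, u⟩, g⟩, h, rfl⟩) | ⟨⟨⟨⟨D, u⟩, g⟩, ε⟩, ⟨h, -⟩, rfl⟩)
      ⟨⟨⟨D', u'⟩, g'⟩, ε'⟩ - heq <;>
    · have := (mem_reducedTriples.mp h).1.1.odd_left
      simp only [Prod.mk.injEq] at heq
      omega

lemma galoisCount_eq_sum {X : ℝ} (hX : 0 ≤ X) :
    (galoisCount (Multiplicative (ZMod 4)) X : ℝ) =
      (1 / 2) * ((∑ n ∈ Ioc 0 ⌊X / (1 : ℕ)⌋₊, ff n + ∑ n ∈ Ioc 0 ⌊X / (16 : ℕ)⌋₊, ff n +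
        2 * ∑ n ∈ Ioc 0 ⌊X / (64 : ℕ)⌋₊, ff n + 4 * ∑ n ∈ Ioc 0 ⌊X / (2048 : ℕ)⌋₊, ff n) -
        (∑ n ∈ Ioc 0 ⌊X / (1 : ℕ)⌋₊, pw 2 sqodd n + ∑ n ∈ Ioc 0 ⌊X / (16 : ℕ)⌋₊, pw 2 sqodd n +
        2 * ∑ n ∈ Ioc 0 ⌊X / (64 : ℕ)⌋₊, pw 2 sqodd n)) := by
  have h : galoisCount (Multiplicative (ZMod 4)) X = #(indexFinset X) := by
    rw [galoisCount_eq_card_index]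
    simp only [← mem_indexFinset hX]
    exact Nat.card_eq_card_toFinset _ |>.trans (by simp)
  have h1 := card_reducedTriples ⌊X / (1 : ℕ)⌋₊
  have h2 := card_reducedTriples ⌊X / (16 : ℕ)⌋₊
  have h3 := card_reducedTriples ⌊X / (64 : ℕ)⌋₊
  have h4 := card_oddTriples ⌊X / (2048 : ℕ)⌋₊
  rw [h, card_indexFinset, ← h4]
  push_cast at h1 h2 h3 ⊢
  linarith

lemma HasAsymp.isBigO {F : ArithmeticFunction ℝ} {a b : ℝ} {k : ℕ} (h : HasAsymp F a b k)
    (hk : k ≤ 4) {c : ℕ} (hc : 0 < c) :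
    (fun X : ℝ ↦ ∑ n ∈ Ioc 0 ⌊X / c⌋₊, F n - a * (c : ℝ) ^ (-(1 / 2) : ℝ) * X ^ ((1 : ℝ) / 2)
      - b * (c : ℝ) ^ (-(1 / 3) : ℝ) * X ^ ((1 : ℝ) / 3))
      =O[atTop] fun X : ℝ ↦ X ^ ((1 : ℝ) / 4) * Real.log X ^ 4 := by
  obtain ⟨C, hC, h⟩ := h
  have hc1 : (1 : ℝ) ≤ c := by exact_mod_cast hc
  have hc0 : (0 : ℝ) < c := by linarith
  refine Asymptotics.IsBigO.of_bound (C * 2 ^ 4) ?_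
  filter_upwards [eventually_ge_atTop (c : ℝ), eventually_ge_atTop (Real.exp 1)] with X hX hXe
  have hX0 : 0 < X := by linarith
  have hY : 1 ≤ X / c := (one_le_div hc0).mpr hX
  have hYX : X / c ≤ X := div_le_self hX0.le hc1
  have hlog : 1 ≤ Real.log X := by
    rwa [Real.le_log_iff_exp_le hX0]
  have hdiv : ∀ s : ℝ, (X / c) ^ s = (c : ℝ) ^ (-s) * X ^ s := fun s ↦ by
    rw [Real.div_rpow hX0.le hc0.le, Real.rpow_neg hc0.le, div_eq_mul_inv, mul_comm]
  have h1 := h (X / c) hY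
  rw [hdiv, hdiv, ← mul_assoc, ← mul_assoc] at h1
  have hlogY : 0 ≤ Real.log (X / c) := Real.log_nonneg hY
  rw [Real.norm_eq_abs, Real.norm_of_nonneg (by positivity)]
  refine h1.trans ?_
  calc C * ((X / c) ^ ((1 : ℝ) / 4) * (1 + Real.log (X / c)) ^ k)
      ≤ C * (X ^ ((1 : ℝ) / 4) * (2 * Real.log X) ^ 4) := by
        gcongr
        calc (1 + Real.log (X / c)) ^ k ≤ (1 + Real.log (X / c)) ^ 4 :=
              pow_le_pow_right₀ (by linarith) hk
          _ ≤ (2 * Real.log X) ^ 4 := by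
            have := Real.log_le_log (by positivity) hYX
            gcongr
            linarith
    _ = _ := by ring

lemma HasAsymp.isLittleO {F : ArithmeticFunction ℝ} {a b : ℝ} {k : ℕ} (h : HasAsymp F a b k)
    (hk : k ≤ 4) :
    (fun X : ℝ ↦ ∑ n ∈ Ioc 0 ⌊X⌋₊, F n - a * X ^ ((1 : ℝ) / 2))
      =o[atTop] fun X : ℝ ↦ X ^ ((1 : ℝ) / 2) := by
  have h1 := h.isBigO hk one_pos
  simp only [Nat.cast_one, div_one, Real.one_rpow, mul_one] at h1
  have h2 : (fun X : ℝ ↦ X ^ ((1 : ℝ) / 4) * Real.log X ^ 4)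
      =o[atTop] fun X : ℝ ↦ X ^ ((1 : ℝ) / 2) := by
    have := (Asymptotics.isBigO_refl (fun X : ℝ ↦ X ^ ((1 : ℝ) / 4)) atTop).mul_isLittleO
      (isLittleO_log_rpow_rpow_atTop (s := 1 / 4) 4 (by norm_num))
    refine this.congr' ?_ ?_
    · filter_upwards with X
      norm_cast
    · filter_upwards [eventually_gt_atTop 0] with X hX
      rw [← Real.rpow_add hX]
      norm_num
  have h3 : (fun X : ℝ ↦ b * X ^ ((1 : ℝ) / 3)) =o[atTop] fun X : ℝ ↦ X ^ ((1 : ℝ) / 2) := by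
    have := (Asymptotics.isBigO_refl (fun X : ℝ ↦ X ^ ((1 : ℝ) / 3)) atTop).mul_isLittleO
      (isLittleO_log_rpow_rpow_atTop (s := 1 / 6) 0 (by norm_num))
    refine (this.congr' ?_ ?_).const_mul_left b
    · filter_upwards with X
      rw [Real.rpow_zero, mul_one]
    · filter_upwards [eventually_gt_atTop 0] with X hX
      rw [← Real.rpow_add hX]
      norm_num
  simpa using (h1.trans_isLittleO h2).add h3

lemma HasAsymp.le_of_le {F F' : ArithmeticFunction ℝ} {a b a' b' : ℝ} {k k' : ℕ}
    (h : HasAsymp F a b k) (hk : k ≤ 4) (h' : HasAsymp F' a' b' k') (hk' : k' ≤ 4)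
    (hle : ∀ n, F n ≤ F' n) : a ≤ a' := by
  by_contra! hlt
  have hbound := ((h.isLittleO hk).sub (h'.isLittleO hk')).bound (c := (a - a') / 2) (by linarith)
  obtain ⟨X, hX0, hX⟩ := ((eventually_gt_atTop 0).and hbound).exists
  have hs : 0 < X ^ ((1 : ℝ) / 2) := by positivity
  rw [Real.norm_eq_abs, Real.norm_of_nonneg hs.le] at hX
  have h1 := (abs_le.mp hX).1
  have h2 : ∑ n ∈ Ioc 0 ⌊X⌋₊, F n ≤ ∑ n ∈ Ioc 0 ⌊X⌋₊, F' n := sum_le_sum fun n _ ↦ hle n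
  nlinarith [mul_pos (sub_pos.mpr hlt) hs]

lemma isBigO_galoisCount_sub {a b q r : ℝ} (hf : HasAsymp ff a b 2)
    (hq : HasAsymp (pw 2 sqodd) q r 1) : ∃ c₃ : ℝ,
      (fun X : ℝ ↦ (galoisCount (Multiplicative (ZMod 4)) X : ℝ)
        - (a * (3 / 4 + 2 * (2048 : ℝ) ^ (-(1 / 2) : ℝ)) - q * (3 / 4)) * X ^ ((1 : ℝ) / 2)
        - c₃ * X ^ ((1 : ℝ) / 3))
        =O[atTop] fun X : ℝ ↦ X ^ ((1 : ℝ) / 4) * Real.log X ^ 4 := by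
  have e16 : (16 : ℝ) ^ (-(1 / 2) : ℝ) = 1 / 4 := by
    rw [show (16 : ℝ) = 4 ^ (2 : ℝ) by norm_num, ← Real.rpow_mul (by norm_num)]
    norm_num [Real.rpow_neg_one]
  have e64 : (64 : ℝ) ^ (-(1 / 2) : ℝ) = 1 / 8 := by
    rw [show (64 : ℝ) = 8 ^ (2 : ℝ) by norm_num, ← Real.rpow_mul (by norm_num)]
    norm_num [Real.rpow_neg_one]
  have hf' := fun c : ℕ ↦ hf.isBigO (by norm_num) (c := c)
  have hq' := fun c : ℕ ↦ hq.isBigO (by norm_num) (c := c)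
  have key := ((((hf' 1 (by norm_num)).add (hf' 16 (by norm_num))).add
    ((hf' 64 (by norm_num)).const_mul_left 2)).add
    ((hf' 2048 (by norm_num)).const_mul_left 4)).sub
    (((hq' 1 (by norm_num)).add (hq' 16 (by norm_num))).add
    ((hq' 64 (by norm_num)).const_mul_left 2)) |>.const_mul_left (1 / 2)
  refine ⟨1 / 2 * (b * (1 + (16 : ℝ) ^ (-(1 / 3) : ℝ) + 2 * (64 : ℝ) ^ (-(1 / 3) : ℝ)
    + 4 * (2048 : ℝ) ^ (-(1 / 3) : ℝ)) - r * (1 + (16 : ℝ) ^ (-(1 / 3) : ℝ)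
    + 2 * (64 : ℝ) ^ (-(1 / 3) : ℝ))), key.congr' ?_ EventuallyEq.rfl⟩
  filter_upwards [eventually_ge_atTop 0] with X hX
  rw [galoisCount_eq_sum hX]
  simp only [Nat.cast_one, Real.one_rpow, Nat.cast_ofNat, e16, e64]
  ring

end C4Count

/-- asymptotic count of C₄-extensions of ℚ with square-root saving error. -/
theorem count_C4_fields :
    ∃ c₂ c₃ : ℝ, 0 < c₂ ∧
      (fun X : ℝ => (galoisCount (Multiplicative (ZMod 4)) X : ℝ)
          - c₂ * X ^ ((1:ℝ)/2) - c₃ * X ^ ((1:ℝ)/3))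
        =O[Filter.atTop] fun X : ℝ => X ^ ((1:ℝ)/4) * Real.log X ^ 4 := by
  obtain ⟨a, b, hf⟩ := C4Count.hasAsymp_ff
  obtain ⟨q, r, hq0, hq⟩ := C4Count.hasAsymp_sqodd
  have hqa : q ≤ a := hq.le_of_le (by norm_num) hf (by norm_num) C4Count.pw_two_sqodd_le_ff
  obtain ⟨c₃, h⟩ := C4Count.isBigO_galoisCount_sub hf hq
  refine ⟨_, c₃, ?_, h⟩
  have : 0 < (2048 : ℝ) ^ (-(1 / 2) : ℝ) := by positivity
  nlinarith [mul_pos (hq0.trans_le hqa) this]
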